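/- Assume conditions (i) and (ii), let 2 ≤ k ≤ m and let 0 ≤ r < m(k−1)/(m−k). Then for every subdomain Ω′ ⊂⊂ Ω there exists a constant C, depending only on Ω, Ω′, X_1,…,X_m and r, such that every u ∈ C²(Ω) ∩ L¹(Ω) that is k-convex with respect to X satisfies ∫_{Ω′} |Xu|^r Δ_X u ≤ C ( ∫_Ω |u| )^{1+r}. -/

import Mathlib

open MeasureTheory Filter Topology

noncomputable section

/-- Action of a first-order vector field with coefficient vector `c` on a function `u`:
`(Xu)(x) = ∑ j c(x)_j D_j u(x) = Du(x)·c(x)`. -/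
def Xop {n : ℕ} (c : (Fin n → ℝ) → (Fin n → ℝ)) (u : (Fin n → ℝ) → ℝ)
    (x : Fin n → ℝ) : ℝ :=
  fderiv ℝ u x (c x)

/-- Lie bracket of the coefficient vector fields `c`, `d`. -/
def vfBracket {n : ℕ} (c d : (Fin n → ℝ) → (Fin n → ℝ)) (x : Fin n → ℝ) :
    Fin n → ℝ :=
  fun l => fderiv ℝ (fun y => d y l) x (c x) - fderiv ℝ (fun y => c y l) x (d x)

/-- The sub-Laplacian `Δ_X u = ∑ i X_i X_i u`. -/
def subLap {n m : ℕ} (b : Fin m → (Fin n → ℝ) → (Fin n → ℝ))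
    (u : (Fin n → ℝ) → ℝ) (x : Fin n → ℝ) : ℝ :=
  ∑ i, Xop (b i) (Xop (b i) u) x

/-- The commutator `[X_i, X_j] u = X_i X_j u - X_j X_i u`. -/
def commOp {n m : ℕ} (b : Fin m → (Fin n → ℝ) → (Fin n → ℝ)) (i j : Fin m)
    (u : (Fin n → ℝ) → ℝ) (x : Fin n → ℝ) : ℝ :=
  Xop (b i) (Xop (b j) u) x - Xop (b j) (Xop (b i) u) x

/-- The symmetric Hessian `X_s² u = [½ (X_i X_j + X_j X_i) u]`. -/
def symmHess {n m : ℕ} (b : Fin m → (Fin n → ℝ) → (Fin n → ℝ))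
    (u : (Fin n → ℝ) → ℝ) (x : Fin n → ℝ) : Matrix (Fin m) (Fin m) ℝ :=
  fun i j => (Xop (b i) (Xop (b j) u) x + Xop (b j) (Xop (b i) u) x) / 2

theorem symmHess_isHermitian {n m : ℕ} (b : Fin m → (Fin n → ℝ) → (Fin n → ℝ))
    (u : (Fin n → ℝ) → ℝ) (x : Fin n → ℝ) : (symmHess b u x).IsHermitian := by
  unfold Matrix.IsHermitian
  ext i j
  simp only [Matrix.conjTranspose_apply, symmHess, star_trivial]
  ring

/-- Eigenvalues of the symmetric Hessian. -/
def hessEig {n m : ℕ} (b : Fin m → (Fin n → ℝ) → (Fin n → ℝ))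
    (u : (Fin n → ℝ) → ℝ) (x : Fin n → ℝ) : Fin m → ℝ :=
  (symmHess_isHermitian b u x).eigenvalues

/-- `k`-th elementary symmetric function of `m` real numbers. -/
def esymmF {m : ℕ} (k : ℕ) (lam : Fin m → ℝ) : ℝ :=
  ∑ s ∈ Finset.powersetCard k (Finset.univ : Finset (Fin m)), ∏ i ∈ s, lam i

/-- `S_{j,i}(λ)`: the `j`-th elementary symmetric function with the variable `λ_i` set to `0`. -/
def esymmDrop {m : ℕ} (j : ℕ) (i : Fin m) (lam : Fin m → ℝ) : ℝ :=
  ∑ s ∈ Finset.powersetCard j ((Finset.univ : Finset (Fin m)).erase i), ∏ l ∈ s, lam l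

/-- `u` is `k`-convex with respect to the vector fields `b` on `Ω`:
`S_j(λ(X_s²u)) ≥ 0` on `Ω` for `j = 1, …, k`. -/
def IsKConvex {n m : ℕ} (Ω : Set (Fin n → ℝ)) (b : Fin m → (Fin n → ℝ) → (Fin n → ℝ))
    (k : ℕ) (u : (Fin n → ℝ) → ℝ) : Prop :=
  ∀ x ∈ Ω, ∀ j, 1 ≤ j → j ≤ k → 0 ≤ esymmF j (hessEig b u x)

/-- `F_2[u] = S_2(λ(X_s²u))`. -/
def F2fun {n m : ℕ} (b : Fin m → (Fin n → ℝ) → (Fin n → ℝ))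
    (u : (Fin n → ℝ) → ℝ) (x : Fin n → ℝ) : ℝ :=
  esymmF 2 (hessEig b u x)

/-- `𝓔_2[u] = ∑_{i<j} ([X_i,X_j]u)²`. -/
def E2fun {n m : ℕ} (b : Fin m → (Fin n → ℝ) → (Fin n → ℝ))
    (u : (Fin n → ℝ) → ℝ) (x : Fin n → ℝ) : ℝ :=
  ∑ i : Fin m, ∑ j ∈ Finset.Ioi i, (commOp b i j u x) ^ 2

/-- `𝓕_2[u] = F_2[u] + (3/4) 𝓔_2[u]`. -/
def calF2 {n m : ℕ} (b : Fin m → (Fin n → ℝ) → (Fin n → ℝ))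
    (u : (Fin n → ℝ) → ℝ) (x : Fin n → ℝ) : ℝ :=
  F2fun b u x + (3 / 4) * E2fun b u x

/-- `|Xu|(x)`, the length of the subelliptic gradient. -/
def XgradNorm {n m : ℕ} (b : Fin m → (Fin n → ℝ) → (Fin n → ℝ))
    (u : (Fin n → ℝ) → ℝ) (x : Fin n → ℝ) : ℝ :=
  Real.sqrt (∑ i, (Xop (b i) u x) ^ 2)

/-- Condition (i): each `X_i` is divergence free, i.e. anti-self-adjoint. -/
def DivFree {n m : ℕ} (Ω : Set (Fin n → ℝ))
    (b : Fin m → (Fin n → ℝ) → (Fin n → ℝ)) : Prop :=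
  ∀ i : Fin m, ∀ x ∈ Ω, ∑ j, fderiv ℝ (fun y => b i y j) x (Pi.single j 1) = 0

/-- The set of iterated Lie brackets generated by the fields `b`. -/
inductive LieGen {n m : ℕ} (b : Fin m → (Fin n → ℝ) → (Fin n → ℝ)) :
    ((Fin n → ℝ) → (Fin n → ℝ)) → Prop
  | base (i : Fin m) : LieGen b (b i)
  | bracket {c d : (Fin n → ℝ) → (Fin n → ℝ)} :
      LieGen b c → LieGen b d → LieGen b (fun x => vfBracket c d x)

/-- Condition (ii): the Hörmander condition; iterated commutators span `ℝⁿ` at each point. -/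
def Hormander {n m : ℕ} (Ω : Set (Fin n → ℝ))
    (b : Fin m → (Fin n → ℝ) → (Fin n → ℝ)) : Prop :=
  ∀ x ∈ Ω, Submodule.span ℝ {v : Fin n → ℝ | ∃ c, LieGen b c ∧ c x = v} = ⊤

/-- Condition (iii): all second commutators `[X_i,[X_i,X_j]]` vanish. -/
def SecondCommVanish {n m : ℕ} (Ω : Set (Fin n → ℝ))
    (b : Fin m → (Fin n → ℝ) → (Fin n → ℝ)) : Prop :=
  ∀ i j : Fin m, ∀ x ∈ Ω, vfBracket (b i) (fun y => vfBracket (b i) (b j) y) x = 0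

/-- `Ω' ⊂⊂ Ω`: `Ω'` is open and compactly contained in `Ω`. -/
def CptIn {n : ℕ} (Ω' Ω : Set (Fin n → ℝ)) : Prop :=
  IsOpen Ω' ∧ IsCompact (closure Ω') ∧ closure Ω' ⊆ Ω

/-- A sub-unitary (piecewise C¹) curve on `[0,T]` with respect to the fields `b`. -/
def IsSubunitary {n m : ℕ} (b : Fin m → (Fin n → ℝ) → (Fin n → ℝ)) (T : ℝ)
    (γ : ℝ → Fin n → ℝ) : Prop :=
  ContinuousOn γ (Set.Icc 0 T) ∧
  ∃ S : Finset ℝ, ∀ t ∈ Set.Ioo 0 T, t ∉ S →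
    ∃ γ' : Fin n → ℝ, HasDerivAt γ γ' t ∧
      ∀ ξ : Fin n → ℝ, (∑ j, γ' j * ξ j) ^ 2 ≤ ∑ i, (∑ j, b i (γ t) j * ξ j) ^ 2

/-- The Carnot–Carathéodory distance associated with the fields `b`. -/
def ccDist {n m : ℕ} (b : Fin m → (Fin n → ℝ) → (Fin n → ℝ))
    (x y : Fin n → ℝ) : ℝ :=
  sInf {T : ℝ | 0 < T ∧ ∃ γ : ℝ → Fin n → ℝ,
    IsSubunitary b T γ ∧ γ 0 = x ∧ γ T = y}

/-- The C-C ball of radius `R` about `x`. -/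
def ccBall {n m : ℕ} (b : Fin m → (Fin n → ℝ) → (Fin n → ℝ))
    (x : Fin n → ℝ) (R : ℝ) : Set (Fin n → ℝ) :=
  {y | ccDist b x y < R}

/-- The doubling property `|B_{tR}(x)| ≥ C t^Q |B_R(x)|`. -/
def DoublingDim {n m : ℕ} (Ω : Set (Fin n → ℝ))
    (b : Fin m → (Fin n → ℝ) → (Fin n → ℝ)) (Q : ℕ) : Prop :=
  ∃ C > (0 : ℝ), ∃ R0 > (0 : ℝ), ∀ x ∈ Ω, ∀ t ∈ Set.Ioo (0 : ℝ) 1,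
    ∀ R : ℝ, 0 < R → R < R0 →
      C * t ^ Q * (volume (ccBall b x R)).toReal ≤ (volume (ccBall b x (t * R))).toReal

/-- `Q` is the homogeneous dimension of the system `b` in `Ω`. -/
def IsHomDim {n m : ℕ} (Ω : Set (Fin n → ℝ))
    (b : Fin m → (Fin n → ℝ) → (Fin n → ℝ)) (Q : ℕ) : Prop :=
  0 < Q ∧ DoublingDim Ω b Q ∧ ∀ Q' : ℕ, 0 < Q' → DoublingDim Ω b Q' → Q ≤ Q'

/-- The class `φ^k(Ω)` of `L¹_loc(Ω)` limits of smooth `k`-convex functions. -/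
def PhiK {n m : ℕ} (Ω : Set (Fin n → ℝ)) (b : Fin m → (Fin n → ℝ) → (Fin n → ℝ))
    (k : ℕ) (u : (Fin n → ℝ) → ℝ) : Prop :=
  LocallyIntegrableOn u Ω ∧
  ∀ Ω' : Set (Fin n → ℝ), CptIn Ω' Ω →
    ∃ us : ℕ → (Fin n → ℝ) → ℝ,
      (∀ l, ContDiffOn ℝ 2 (us l) Ω' ∧ IsKConvex Ω' b k (us l)) ∧
      ∀ K : Set (Fin n → ℝ), K ⊆ Ω' → IsCompact K →
        Tendsto (fun l => ∫ x in K, |us l x - u x|) atTop (𝓝 0)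

end

section RealRooted

open Polynomial

theorem Multiset.card_sq_le_sum_mul_sum_inv (s : Multiset ℝ) (hs : ∀ x ∈ s, 0 < x) :
    0 ≤ s.sum ∧ 0 ≤ (s.map fun x => 1 / x).sum ∧
      (Multiset.card s : ℝ) ^ 2 ≤ s.sum * (s.map fun x => 1 / x).sum := by
  induction s using Multiset.induction with
  | empty => simp
  | cons a s ih =>
    obtain ⟨h1, h2, h3⟩ := ih fun x hx => hs x (Multiset.mem_cons_of_mem hx)
    have ha : 0 < a := hs a (Multiset.mem_cons_self a s)
    simp only [Multiset.sum_cons, Multiset.map_cons, Multiset.card_cons, Nat.cast_add,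
      Nat.cast_one]
    set S := s.sum
    set T := (s.map fun x => 1 / x).sum
    set N : ℝ := (Multiset.card s : ℝ)
    have hN : 0 ≤ N := Nat.cast_nonneg _
    refine ⟨by positivity, by positivity, ?_⟩
    have hp : 0 ≤ S / a := by positivity
    have hq : 0 ≤ a * T := by positivity
    have hpq : N ^ 2 ≤ (S / a) * (a * T) := by
      have : (S / a) * (a * T) = S * T := by field_simp
      rw [this]; exact h3
    have hs2 : (2 * N) ^ 2 ≤ (S / a + a * T) ^ 2 := by
      nlinarith [sq_nonneg (S / a - a * T)]
    have h4 : 2 * N ≤ S / a + a * T := by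
      exact le_of_sq_le_sq hs2 (by positivity)
    have : (a + S) * (1 / a + T) = 1 + (S / a + a * T) + S * T := by field_simp; ring
    rw [this]; nlinarith

theorem Polynomial.Splits.derivative_real {p : ℝ[X]} (hp : p.Splits) : p.derivative.Splits := by
  by_cases h0 : p.natDegree = 0
  · rw [Polynomial.eq_C_of_natDegree_eq_zero h0]; simp
  rw [splits_iff_card_roots] at hp ⊢
  have h1 := card_roots_le_derivative p
  have h2 := card_roots' p.derivative
  have h3 := natDegree_derivative_lt h0
  omega

theorem Polynomial.Splits.iterate_derivative_real {p : ℝ[X]} (hp : p.Splits) (j : ℕ) :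
    (derivative^[j] p).Splits := by
  induction j with
  | zero => simpa using hp
  | succ j ih => rw [Function.iterate_succ_apply']; exact ih.derivative_real

/-- A real-rooted polynomial of degree `k ≥ 1` with positive coefficients satisfies
`k² a_k a_0 ≤ a_{k-1} a_1`. -/
theorem Polynomial.Splits.coeff_mul_le {p : ℝ[X]} (hp : p.Splits) {k : ℕ} (hk : 1 ≤ k)
    (hdeg : p.natDegree = k) (hpos : ∀ j ≤ k, 0 < p.coeff j) :
    (k : ℝ) ^ 2 * (p.coeff k * p.coeff 0) ≤ p.coeff (k - 1) * p.coeff 1 := by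
  have hroot : ∀ x ∈ p.roots, 0 < -x := by
    intro x hx
    by_contra hneg
    have hx0 : 0 ≤ x := by linarith
    have he : p.eval x = 0 := (mem_roots'.1 hx).2
    rw [eval_eq_sum_range, hdeg] at he
    have : 0 < ∑ i ∈ Finset.range (k + 1), p.coeff i * x ^ i := by
      apply Finset.sum_pos' (fun i hi => mul_nonneg (hpos i (by simp at hi; omega)).le
        (pow_nonneg hx0 i))
      exact ⟨0, by simp, by simpa using hpos 0 (by omega)⟩
    linarith
  have h0 : p.eval 0 ≠ 0 := by
    rw [← coeff_zero_eq_eval_zero]; exact (hpos 0 (by omega)).ne'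
  have h1 := hp.eval_derivative_eq_eval_mul_sum h0
  rw [← coeff_zero_eq_eval_zero, ← coeff_zero_eq_eval_zero, coeff_derivative] at h1
  have h2 := hp.nextCoeff_eq_neg_sum_roots_mul_leadingCoeff
  rw [nextCoeff_of_natDegree_pos (by omega), leadingCoeff, hdeg] at h2
  have hcard := hp.natDegree_eq_card_roots
  obtain ⟨-, -, h3⟩ := Multiset.card_sq_le_sum_mul_sum_inv (p.roots.map fun x => -x) (by
    intro x hx
    obtain ⟨y, hy, rfl⟩ := Multiset.mem_map.1 hx
    exact hroot y hy)
  rw [Multiset.card_map, ← hcard, hdeg, Multiset.map_map] at h3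
  simp only [Function.comp_def, Multiset.sum_map_neg'] at h3
  simp only [zero_sub, zero_add, Nat.cast_zero, mul_one] at h1
  rw [h1, h2]
  have := mul_le_mul_of_nonneg_right h3 (mul_pos (hpos k le_rfl) (hpos 0 (by omega))).le
  calc _ ≤ _ := this
    _ = _ := by ring

/-- Maclaurin-type inequality between consecutive elementary symmetric functions. -/
theorem Finset.esymm_maclaurin {ι : Type*} (s : Finset ι) (f : ι → ℝ) {k : ℕ} (hk : 1 ≤ k)
    (hks : k ≤ s.card)
    (hpos : ∀ j ≤ k, 0 < ∑ t ∈ s.powersetCard j, ∏ i ∈ t, f i) :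
    (k : ℝ) * s.card * ∑ t ∈ s.powersetCard k, ∏ i ∈ t, f i ≤
      ((s.card : ℝ) - k + 1) * (∑ i ∈ s, f i) *
        ∑ t ∈ s.powersetCard (k - 1), ∏ i ∈ t, f i := by
  set N := s.card with hN
  set S : ℕ → ℝ := fun j => ∑ t ∈ s.powersetCard j, ∏ i ∈ t, f i with hS
  set p : ℝ[X] := ∏ i ∈ s, (X + C (f i)) with hp
  have hps : p.Splits := Splits.prod fun i _ => Splits.X_add_C _
  have hcoef : ∀ j ≤ k, (derivative^[N - k] p).coeff j =
      ((j + (N - k)).descFactorial (N - k) : ℝ) * S (k - j) := by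
    intro j hj
    rw [coeff_iterate_derivative, hp, Finset.prod_X_add_C_coeff _ _ (by omega), nsmul_eq_mul,
      ← hN, show N - (j + (N - k)) = k - j by omega]
  have hdegp : p.natDegree ≤ N := by
    rw [hp]
    refine (natDegree_prod_le _ _).trans ?_
    simp [hN]
  have hcpos : ∀ j ≤ k, 0 < (derivative^[N - k] p).coeff j := by
    intro j hj
    rw [hcoef j hj]
    refine mul_pos ?_ (hpos _ (by omega))
    exact_mod_cast Nat.descFactorial_pos.2 (by omega)
  have hdeg : (derivative^[N - k] p).natDegree = k := by
    apply le_antisymm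
    · refine (natDegree_iterate_derivative _ _).trans (by omega)
    · exact le_natDegree_of_ne_zero (hcpos k le_rfl).ne'
  have key := (hps.iterate_derivative_real (N - k)).coeff_mul_le hk hdeg hcpos
  rw [hcoef k le_rfl, hcoef 0 (by omega), hcoef (k - 1) (by omega), hcoef 1 hk] at key
  rw [show k - (k - 1) = 1 by omega, Nat.sub_self, Nat.sub_zero,
    show k + (N - k) = N by omega, show k - 1 + (N - k) = N - 1 by omega, zero_add] at key
  have hS0 : S 0 = 1 := by simp [hS]
  have hS1 : S 1 = ∑ i ∈ s, f i := by simp [hS, Finset.powersetCard_one]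
  obtain ⟨a, ha⟩ : ∃ a, k = a + 1 := ⟨k - 1, by omega⟩
  obtain ⟨d, hd⟩ : ∃ d, N = k + d := ⟨N - k, by omega⟩
  have e1 : (N.descFactorial (N - k) : ℝ) * k = N * (N - 1).descFactorial (N - k) := by
    have : N.descFactorial (N - k) * k = N * (N - 1).descFactorial (N - k) := by
      have h1 := Nat.succ_descFactorial (a + d) d
      rw [show N = a + d + 1 by omega, show a + d + 1 - k = d by omega,
        show a + d + 1 - 1 = a + d by omega]
      rw [show (a + d).succ - d = k by omega] at h1
      rw [mul_comm]; exact h1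
    exact_mod_cast this
  have e2 : ((1 + (N - k)).descFactorial (N - k) : ℝ) =
      ((N : ℝ) - k + 1) * (N - k).descFactorial (N - k) := by
    have h1 := Nat.succ_descFactorial d d
    rw [show d.succ - d = 1 by omega, one_mul] at h1
    rw [hd, show k + d - k = d by omega, add_comm 1 d]
    push_cast
    have : ((d.succ.descFactorial d : ℕ) : ℝ) = (d.succ : ℝ) * (d.descFactorial d : ℝ) := by
      exact_mod_cast h1
    rw [show d + 1 = d.succ from rfl, this]
    push_cast; ring
  rw [e2, hS0, hS1] at key
  set A : ℝ := (N.descFactorial (N - k) : ℝ)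
  set B : ℝ := ((N - 1).descFactorial (N - k) : ℝ)
  set D : ℝ := ((N - k).descFactorial (N - k) : ℝ)
  have hB : 0 < B := by
    have : 0 < (N - 1).descFactorial (N - k) := Nat.descFactorial_pos.2 (by omega)
    exact Nat.cast_pos.2 this
  have hD : 0 < D := by
    have : 0 < (N - k).descFactorial (N - k) := Nat.descFactorial_pos.2 (by omega)
    exact Nat.cast_pos.2 this
  have hBD : 0 < B * D := mul_pos hB hD
  refine le_of_mul_le_mul_left ?_ hBD
  calc B * D * (k * N * S k) = k * (N * B) * D * S k := by ring
    _ = (k : ℝ) ^ 2 * (A * 1 * (D * S k)) := by rw [← e1]; ring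
    _ ≤ _ := key
    _ = _ := by ring

/-- The smallest entry of a vector in the closed `k`-positive cone is bounded below in terms of
the sum of the entries. -/
theorem le_of_esymmF_nonneg {m k : ℕ} (hk2 : 2 ≤ k) (hkm : k < m) (lam : Fin m → ℝ)
    (h : ∀ j, 1 ≤ j → j ≤ k → 0 ≤ esymmF j lam) (i : Fin m) :
    -(((m : ℝ) - k) / (m * (k - 1))) * ∑ l, lam l ≤ lam i := by
  have hk2' : (2 : ℝ) ≤ k := by exact_mod_cast hk2
  have hkm' : (k : ℝ) + 1 ≤ m := by exact_mod_cast hkm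
  have hden : 0 < (m : ℝ) * (k - 1) := by apply mul_pos <;> linarith
  have hsum : 0 ≤ ∑ l, lam l := by
    have := h 1 le_rfl (by omega)
    simpa [esymmF, Finset.powersetCard_one] using this
  by_cases hi : 0 ≤ lam i
  · refine le_trans ?_ hi
    rw [neg_mul, neg_nonpos]
    exact mul_nonneg (div_nonneg (by linarith) hden.le) hsum
  push Not at hi
  set s := (Finset.univ : Finset (Fin m)).erase i with hs
  have hcard : s.card = m - 1 := by simp [hs]
  set S : ℕ → ℝ := fun j => ∑ t ∈ s.powersetCard j, ∏ l ∈ t, lam l with hS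
  have hrec : ∀ j, esymmF (j + 1) lam = S (j + 1) + lam i * S j := by
    intro j
    have hins : (Finset.univ : Finset (Fin m)) = insert i s := by simp [hs]
    have hnot : i ∉ s := by simp [hs]
    unfold esymmF
    rw [hins, Finset.powersetCard_succ_insert hnot, Finset.sum_union, Finset.sum_image]
    · congr 1
      rw [Finset.mul_sum]
      refine Finset.sum_congr rfl fun t ht => ?_
      rw [Finset.prod_insert]
      exact fun hit => hnot ((Finset.mem_powersetCard.1 ht).1 hit)
    · intro t ht t' ht' htt
      have h1 : i ∉ t := fun hit => hnot ((Finset.mem_powersetCard.1 ht).1 hit)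
      have h2 : i ∉ t' := fun hit => hnot ((Finset.mem_powersetCard.1 ht').1 hit)
      rw [← Finset.erase_insert h1, ← Finset.erase_insert h2, htt]
    · rw [Finset.disjoint_left]
      intro t ht ht'
      obtain ⟨t', -, rfl⟩ := Finset.mem_image.1 ht'
      exact hnot ((Finset.mem_powersetCard.1 ht).1 (Finset.mem_insert_self i t'))
  have hSpos : ∀ j ≤ k, 0 < S j := by
    intro j
    induction j with
    | zero => intro _; simp [hS]
    | succ j ih =>
      intro hj
      have h1 := h (j + 1) (by omega) hj
      rw [hrec] at h1
      have h2 := ih (by omega)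
      nlinarith
  have hmac := Finset.esymm_maclaurin s lam (k := k) (by omega) (by omega) hSpos
  have hkk := h k (by omega) le_rfl
  obtain ⟨a, rfl⟩ : ∃ a, k = a + 1 := ⟨k - 1, by omega⟩
  rw [hrec] at hkk
  have hsplit : ∑ l, lam l = lam i + ∑ l ∈ s, lam l :=
    (Finset.add_sum_erase _ _ (Finset.mem_univ i)).symm
  have hSa := hSpos a (by omega)
  simp only [Nat.add_sub_cancel] at hmac
  rw [hcard, Nat.cast_sub (by omega)] at hmac
  change _ * S (a + 1) ≤ _ * S a at hmac
  set T := ∑ l ∈ s, lam l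
  push_cast at *
  have h5 : ((a : ℝ) + 1) * (m - 1) * (-lam i) * S a ≤ (m - 1 - (a + 1) + 1) * T * S a := by
    refine le_trans ?_ hmac
    have : 0 ≤ ((a : ℝ) + 1) * (m - 1) := mul_nonneg (by linarith) (by linarith)
    nlinarith
  have h6 := le_of_mul_le_mul_right h5 hSa
  rw [hsplit, neg_mul, neg_le, div_mul_eq_mul_div, le_div_iff₀ hden]
  nlinarith

theorem symmHess_quadForm_ge {n m k : ℕ} (hk2 : 2 ≤ k) (hkm : k < m)
    (b : Fin m → (Fin n → ℝ) → (Fin n → ℝ)) (u : (Fin n → ℝ) → ℝ) (x : Fin n → ℝ)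
    (h : ∀ j, 1 ≤ j → j ≤ k → 0 ≤ esymmF j (hessEig b u x)) (ξ : Fin m → ℝ) :
    0 ≤ subLap b u x ∧
    -(((m : ℝ) - k) / (m * (k - 1))) * subLap b u x * ∑ i, ξ i ^ 2 ≤
      ∑ i, ∑ j, ξ i * ξ j * Xop (b i) (Xop (b j) u) x := by
  have htr : subLap b u x = ∑ l, hessEig b u x l := by
    have := (symmHess_isHermitian b u x).trace_eq_sum_eigenvalues
    simp only [Matrix.trace, Matrix.diag, symmHess, add_self_div_two] at this
    simpa [subLap, hessEig] using this
  have hmin := le_of_esymmF_nonneg hk2 hkm _ h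
  rw [← htr] at hmin
  refine ⟨?_, ?_⟩
  · have := h 1 le_rfl (by omega)
    rw [htr]
    simpa [esymmF, Finset.powersetCard_one] using this
  set c := -(((m : ℝ) - k) / (m * (k - 1))) * subLap b u x with hc
  have hA := symmHess_isHermitian b u x
  have hpsd : (symmHess b u x - Matrix.diagonal fun _ => c).PosSemidef := by
    set U : Matrix (Fin m) (Fin m) ℝ := (hA.eigenvectorUnitary : Matrix (Fin m) (Fin m) ℝ)
    have hsp : symmHess b u x = U * Matrix.diagonal (hessEig b u x) * U.conjTranspose := by
      have := hA.spectral_theorem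
      rw [Unitary.conjStarAlgAut_apply] at this
      exact this
    have hU : U * U.conjTranspose = 1 := Unitary.mul_star_self_of_mem hA.eigenvectorUnitary.2
    have hcc : (Matrix.diagonal fun _ : Fin m => c) =
        U * (Matrix.diagonal fun _ => c) * U.conjTranspose := by
      rw [show (Matrix.diagonal fun _ : Fin m => c) = c • (1 : Matrix (Fin m) (Fin m) ℝ) by
        rw [Matrix.smul_one_eq_diagonal]]
      rw [Matrix.mul_smul, Matrix.mul_one, Matrix.smul_mul, hU]
    rw [hcc, hsp, ← Matrix.sub_mul, ← Matrix.mul_sub, Matrix.diagonal_sub]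
    refine Matrix.PosSemidef.mul_mul_conjTranspose_same (Matrix.PosSemidef.diagonal ?_) _
    intro i
    simpa using hmin i
  have := hpsd.dotProduct_mulVec_nonneg ξ
  simp only [star_trivial, Matrix.sub_mulVec, dotProduct_sub, sub_nonneg] at this
  have h1 : ξ ⬝ᵥ (Matrix.diagonal fun _ => c).mulVec ξ = c * ∑ i, ξ i ^ 2 := by
    simp only [dotProduct, Matrix.mulVec_diagonal, Finset.mul_sum]
    exact Finset.sum_congr rfl fun i _ => by ring
  have h2 : ξ ⬝ᵥ (symmHess b u x).mulVec ξ =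
      ∑ i, ∑ j, ξ i * ξ j * Xop (b i) (Xop (b j) u) x := by
    have e : ∀ i, ξ i * ∑ j, symmHess b u x i j * ξ j =
        (∑ j, ξ i * ξ j * Xop (b i) (Xop (b j) u) x) / 2 +
          (∑ j, ξ i * ξ j * Xop (b j) (Xop (b i) u) x) / 2 := by
      intro i
      rw [Finset.mul_sum, Finset.sum_div, Finset.sum_div, ← Finset.sum_add_distrib]
      exact Finset.sum_congr rfl fun j _ => by simp only [symmHess]; ring
    simp only [dotProduct, Matrix.mulVec]
    rw [Finset.sum_congr rfl fun i _ => e i, Finset.sum_add_distrib, ← Finset.sum_div,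
      ← Finset.sum_div]
    rw [Finset.sum_comm (f := fun i j => ξ i * ξ j * Xop (b j) (Xop (b i) u) x)]
    have : ∀ i j, ξ j * ξ i * Xop (b i) (Xop (b j) u) x =
        ξ i * ξ j * Xop (b i) (Xop (b j) u) x := fun i j => by ring
    simp only [this]
    ring
  rw [h1, h2] at this
  exact this

end RealRooted

section IntegrationByParts

open scoped ContDiff

variable {n : ℕ}

/-- The divergence of a vector field on `ℝⁿ`. -/
noncomputable def vfDiv (c : (Fin n → ℝ) → (Fin n → ℝ)) (x : Fin n → ℝ) : ℝ :=
  ∑ j, fderiv ℝ (fun y => c y j) x (Pi.single j 1)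

theorem integral_fderiv_eq_zero_of_hasCompactSupport {φ : (Fin n → ℝ) → ℝ} (hφ : ContDiff ℝ 1 φ)
    (hc : HasCompactSupport φ) (v : Fin n → ℝ) : ∫ x, fderiv ℝ φ x v = 0 := by
  have hi : Integrable (fun x => fderiv ℝ φ x v) :=
    ((hφ.continuous_fderiv one_ne_zero).clm_apply continuous_const).integrable_of_hasCompactSupport
      (hc.fderiv_apply (𝕜 := ℝ) v)
  have h := integral_mul_fderiv_eq_neg_fderiv_mul_of_integrable (μ := volume)
    (f := fun _ : Fin n → ℝ => (1 : ℝ)) (g := φ) (v := v)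
    (by simp) (by simpa using hi) (by simpa using hφ.continuous.integrable_of_hasCompactSupport hc)
    (fun x _ => differentiableAt_const _) (fun x _ => hφ.differentiable one_ne_zero x)
  simpa using h

theorem vec_eq_sum_single (v : Fin n → ℝ) : v = ∑ j, v j • (Pi.single j (1 : ℝ) : Fin n → ℝ) := by
  ext i
  simp [Finset.sum_apply, Pi.single_apply]

theorem Xop_eq_sum (c : (Fin n → ℝ) → (Fin n → ℝ)) (φ : (Fin n → ℝ) → ℝ) (x : Fin n → ℝ) :
    Xop c φ x = ∑ j, c x j * fderiv ℝ φ x (Pi.single j 1) := by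
  unfold Xop
  conv_lhs => rw [vec_eq_sum_single (c x)]
  simp

theorem Xop_mul {c : (Fin n → ℝ) → (Fin n → ℝ)} {f g : (Fin n → ℝ) → ℝ} {x : Fin n → ℝ}
    (hf : DifferentiableAt ℝ f x) (hg : DifferentiableAt ℝ g x) :
    Xop c (fun y => f y * g y) x = f x * Xop c g x + g x * Xop c f x := by
  unfold Xop
  rw [fderiv_fun_mul hf hg]
  simp

theorem continuous_Xop {c : (Fin n → ℝ) → (Fin n → ℝ)} (hc : Continuous c)
    {f : (Fin n → ℝ) → ℝ} (hf : ContDiff ℝ 1 f) : Continuous (Xop c f) :=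
  (hf.continuous_fderiv one_ne_zero).clm_apply hc

theorem contDiff_Xop {c : (Fin n → ℝ) → (Fin n → ℝ)} {k l : WithTop ℕ∞} (hc : ContDiff ℝ k c)
    {f : (Fin n → ℝ) → ℝ} (hf : ContDiff ℝ l f) (hkl : k + 1 ≤ l) : ContDiff ℝ k (Xop c f) :=
  (hf.fderiv_right hkl).clm_apply hc

theorem hasCompactSupport_Xop (c : (Fin n → ℝ) → (Fin n → ℝ))
    {f : (Fin n → ℝ) → ℝ} (hf : HasCompactSupport f) : HasCompactSupport (Xop c f) := by
  refine (hf.fderiv (𝕜 := ℝ)).mono fun x hx => ?_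
  contrapose! hx
  simp only [Function.mem_support, not_not] at hx ⊢
  simp [Xop, hx]

theorem tsupport_Xop_subset (c : (Fin n → ℝ) → (Fin n → ℝ)) (f : (Fin n → ℝ) → ℝ) :
    tsupport (Xop c f) ⊆ tsupport f := by
  refine (closure_mono ?_).trans (tsupport_fderiv_subset ℝ (f := f))
  intro x hx
  contrapose! hx
  simp only [Function.mem_support, not_not] at hx ⊢
  simp [Xop, hx]

theorem continuous_vfDiv {c : (Fin n → ℝ) → (Fin n → ℝ)} (hc : ContDiff ℝ 1 c) :
    Continuous (vfDiv c) := by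
  refine continuous_finsetSum _ fun j _ => ?_
  exact ((contDiff_pi.1 hc j).continuous_fderiv one_ne_zero).clm_apply continuous_const

theorem integral_Xop {c : (Fin n → ℝ) → (Fin n → ℝ)} (hc : ContDiff ℝ 1 c)
    {φ : (Fin n → ℝ) → ℝ} (hφ : ContDiff ℝ 1 φ) (hs : HasCompactSupport φ) :
    ∫ x, Xop c φ x = - ∫ x, vfDiv c x * φ x := by
  have hcj : ∀ j, ContDiff ℝ 1 fun y => c y j := contDiff_pi.1 hc
  have h1 : ∀ x, Xop c φ x + vfDiv c x * φ x =
      ∑ j, fderiv ℝ (fun y => c y j * φ y) x (Pi.single j 1) := by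
    intro x
    rw [Xop_eq_sum, vfDiv, Finset.sum_mul, ← Finset.sum_add_distrib]
    refine Finset.sum_congr rfl fun j _ => ?_
    rw [fderiv_fun_mul ((hcj j).differentiable one_ne_zero x) (hφ.differentiable one_ne_zero x)]
    simp; ring
  have hi1 : Integrable (Xop c φ) := (continuous_Xop hc.continuous hφ).integrable_of_hasCompactSupport
    (hasCompactSupport_Xop c hs)
  have hi2 : Integrable (fun x => vfDiv c x * φ x) :=
    ((continuous_vfDiv hc).mul hφ.continuous).integrable_of_hasCompactSupport hs.mul_left
  rw [eq_neg_iff_add_eq_zero, ← integral_add hi1 hi2]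
  simp_rw [h1]
  rw [integral_finsetSum]
  · exact Finset.sum_eq_zero fun j _ =>
      integral_fderiv_eq_zero_of_hasCompactSupport ((hcj j).mul hφ) hs.mul_left _
  · intro j _
    exact ((((hcj j).mul hφ).continuous_fderiv one_ne_zero).clm_apply
      continuous_const).integrable_of_hasCompactSupport
      ((hs.mul_left (f := fun y => c y j)).fderiv_apply (𝕜 := ℝ) _)

theorem integral_mul_Xop {c : (Fin n → ℝ) → (Fin n → ℝ)} (hc : ContDiff ℝ 1 c)
    {f g : (Fin n → ℝ) → ℝ} (hf : ContDiff ℝ 1 f) (hg : ContDiff ℝ 1 g)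
    (hs : HasCompactSupport f) :
    ∫ x, f x * Xop c g x = - ∫ x, (Xop c f x + vfDiv c x * f x) * g x := by
  have h := integral_Xop hc (hf.mul hg) hs.mul_right
  have hi1 : Integrable (fun x => f x * Xop c g x) :=
    (hf.continuous.mul (continuous_Xop hc.continuous hg)).integrable_of_hasCompactSupport
      hs.mul_right
  have hi2 : Integrable (fun x => g x * Xop c f x) :=
    (hg.continuous.mul (continuous_Xop hc.continuous hf)).integrable_of_hasCompactSupport
      (hasCompactSupport_Xop c hs).mul_left
  have hi3 : Integrable (fun x => vfDiv c x * (f x * g x)) :=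
    ((continuous_vfDiv hc).mul (hf.continuous.mul hg.continuous)).integrable_of_hasCompactSupport
      hs.mul_right.mul_left
  have h1 : ∀ x, Xop c (fun y => f y * g y) x = f x * Xop c g x + g x * Xop c f x := fun x =>
    Xop_mul (hf.differentiable one_ne_zero x) (hg.differentiable one_ne_zero x)
  simp_rw [h1] at h
  rw [integral_add hi1 hi2] at h
  have h2 : ∫ x, (Xop c f x + vfDiv c x * f x) * g x =
      ∫ x, g x * Xop c f x + vfDiv c x * (f x * g x) := by
    congr 1; ext x; ring
  rw [h2, integral_add hi2 hi3]
  linarith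

/-- Second order commutator identity. -/
theorem Xop_vfBracket {c d : (Fin n → ℝ) → (Fin n → ℝ)} (hc : ContDiff ℝ 1 c)
    (hd : ContDiff ℝ 1 d) {g : (Fin n → ℝ) → ℝ} (hg : ContDiff ℝ 2 g) (x : Fin n → ℝ) :
    Xop (vfBracket c d) g x = Xop c (Xop d g) x - Xop d (Xop c g) x := by
  have hg' : Differentiable ℝ (fderiv ℝ g) :=
    (hg.fderiv_right (m := 1) (by norm_num)).differentiable one_ne_zero
  have key : ∀ {c d : (Fin n → ℝ) → (Fin n → ℝ)}, ContDiff ℝ 1 d →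
      Xop c (Xop d g) x = fderiv ℝ (fderiv ℝ g) x (c x) (d x) +
        fderiv ℝ g x (fderiv ℝ d x (c x)) := by
    intro c d hd
    have : fderiv ℝ (fun y => fderiv ℝ g y (d y)) x = _ :=
      fderiv_clm_apply (hg' x) (hd.differentiable one_ne_zero x)
    unfold Xop
    rw [this]
    simp
    ring
  rw [key hd, key hc]
  have hsymm : fderiv ℝ (fderiv ℝ g) x (c x) (d x) = fderiv ℝ (fderiv ℝ g) x (d x) (c x) :=
    (hg.contDiffAt.isSymmSndFDerivAt (by simp)) _ _
  rw [hsymm]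
  have hb : vfBracket c d x = fderiv ℝ d x (c x) - fderiv ℝ c x (d x) := by
    ext l
    have h1 : ∀ {d : (Fin n → ℝ) → (Fin n → ℝ)}, ContDiff ℝ 1 d → ∀ v,
        fderiv ℝ (fun y => d y l) x v = fderiv ℝ d x v l := by
      intro d hd v
      rw [fderiv_apply (hd.differentiable one_ne_zero x) l]
      simp
    simp [vfBracket, h1 hc, h1 hd]
  unfold Xop
  rw [hb, map_sub]
  ring

theorem contDiff_vfBracket {c d : (Fin n → ℝ) → (Fin n → ℝ)} (hc : ContDiff ℝ ∞ c)
    (hd : ContDiff ℝ ∞ d) : ContDiff ℝ ∞ (vfBracket c d) := by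
  refine contDiff_pi.2 fun l => ?_
  exact (((contDiff_pi.1 hd l).fderiv_right (m := ∞) (by simp)).clm_apply hc).sub
    (((contDiff_pi.1 hc l).fderiv_right (m := ∞) (by simp)).clm_apply hd)

theorem hasCompactSupport_vfBracket {c d : (Fin n → ℝ) → (Fin n → ℝ)}
    (hc : HasCompactSupport c) :
    HasCompactSupport (vfBracket c d) := by
  refine hc.mono' ?_
  intro x hx
  by_contra hxc
  apply hx
  have h0 : c =ᶠ[𝓝 x] 0 := notMem_tsupport_iff_eventuallyEq.1 hxc
  ext l
  have h1 : (fun y => c y l) =ᶠ[𝓝 x] fun _ => 0 := h0.mono fun y hy => by simp [hy]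
  simp [vfBracket, h0.eq_of_nhds, h1.fderiv_eq]

end IntegrationByParts

section Mollifier

open scoped ContDiff

variable {n : ℕ}

/-- The average of the translates `f (x - t y)` against the weight `ψ y`. -/
noncomputable def moll (ψ : (Fin n → ℝ) → ℝ) (t : ℝ) (f : (Fin n → ℝ) → ℝ)
    (x : Fin n → ℝ) : ℝ :=
  ∫ y, ψ y * f (x - t • y)

/-- The squared `L²` norm. -/
noncomputable def sqInt (f : (Fin n → ℝ) → ℝ) : ℝ := ∫ x, f x ^ 2

theorem sqInt_nonneg (f : (Fin n → ℝ) → ℝ) : 0 ≤ sqInt f :=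
  integral_nonneg fun _ => sq_nonneg _

theorem integrable_moll_integrand {ψ f : (Fin n → ℝ) → ℝ} (hψ : Continuous ψ)
    (hψs : HasCompactSupport ψ) (hf : Continuous f) (t : ℝ) (x : Fin n → ℝ) :
    Integrable fun y => ψ y * f (x - t • y) :=
  (hψ.mul (by fun_prop)).integrable_of_hasCompactSupport hψs.mul_right

theorem continuous_moll {ψ f : (Fin n → ℝ) → ℝ} (hψ : Continuous ψ)
    (hψs : HasCompactSupport ψ) (hf : Continuous f) :
    Continuous fun p : ℝ × (Fin n → ℝ) => moll ψ p.1 f p.2 := by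
  have h := continuous_parametric_integral_of_continuous (μ := volume)
    (f := fun (p : ℝ × (Fin n → ℝ)) (y : Fin n → ℝ) => ψ y * f (p.2 - p.1 • y))
    (by unfold Function.uncurry; fun_prop) (s := tsupport ψ) hψs
  refine h.congr fun p => ?_
  refine setIntegral_eq_integral_of_forall_compl_eq_zero fun y hy => ?_
  simp [image_eq_zero_of_notMem_tsupport hy]

theorem continuous_moll_right {ψ f : (Fin n → ℝ) → ℝ} (hψ : Continuous ψ)
    (hψs : HasCompactSupport ψ) (hf : Continuous f) (t : ℝ) : Continuous (moll ψ t f) :=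
  (continuous_moll hψ hψs hf).comp (Continuous.prodMk_right t)

theorem hasCompactSupport_moll {ψ f : (Fin n → ℝ) → ℝ}
    (hψs : HasCompactSupport ψ) (hfs : HasCompactSupport f) (t : ℝ) :
    HasCompactSupport (moll ψ t f) := by
  have hK : IsCompact ((fun p : (Fin n → ℝ) × (Fin n → ℝ) => p.1 + t • p.2) ''
      (tsupport f ×ˢ tsupport ψ)) := (hfs.isCompact.prod hψs.isCompact).image (by fun_prop)
  refine HasCompactSupport.intro hK fun x hx => ?_
  refine integral_eq_zero_of_ae (Eventually.of_forall fun y => ?_)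
  by_cases hy : y ∈ tsupport ψ
  · have : x - t • y ∉ tsupport f := fun h => hx ⟨(x - t • y, y), ⟨h, hy⟩, by simp⟩
    simp [image_eq_zero_of_notMem_tsupport this]
  · simp [image_eq_zero_of_notMem_tsupport hy]

theorem hasFDerivAt_moll {ψ f : (Fin n → ℝ) → ℝ} (hψ : Continuous ψ)
    (hψs : HasCompactSupport ψ) (hf : ContDiff ℝ 1 f) (hfs : HasCompactSupport f)
    (p : ℝ × (Fin n → ℝ)) :
    HasFDerivAt (fun p : ℝ × (Fin n → ℝ) => moll ψ p.1 f p.2)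
      (∫ y, ψ y • (fderiv ℝ f (p.2 - p.1 • y)).comp
        (ContinuousLinearMap.snd ℝ ℝ (Fin n → ℝ) -
          (ContinuousLinearMap.fst ℝ ℝ (Fin n → ℝ)).smulRight y)) p := by
  obtain ⟨M, hM⟩ := (hfs.fderiv (𝕜 := ℝ)).exists_bound_of_continuous
    (hf.continuous_fderiv one_ne_zero)
  have hM0 : 0 ≤ M := (norm_nonneg _).trans (hM 0)
  have hcont := hf.continuous_fderiv one_ne_zero
  refine hasFDerivAt_integral_of_dominated_of_fderiv_le (s := Set.univ)
    (F := fun (p : ℝ × (Fin n → ℝ)) y => ψ y * f (p.2 - p.1 • y))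
    (F' := fun (p : ℝ × (Fin n → ℝ)) y => ψ y • (fderiv ℝ f (p.2 - p.1 • y)).comp
        (ContinuousLinearMap.snd ℝ ℝ (Fin n → ℝ) -
          (ContinuousLinearMap.fst ℝ ℝ (Fin n → ℝ)).smulRight y))
    (bound := fun y => ‖ψ y‖ * (M * (1 + ‖y‖))) Filter.univ_mem ?_ ?_ ?_ ?_ ?_ ?_
  · exact Eventually.of_forall fun p =>
      (integrable_moll_integrand hψ hψs hf.continuous _ _).aestronglyMeasurable
  · exact integrable_moll_integrand hψ hψs hf.continuous _ _
  · refine Continuous.aestronglyMeasurable ?_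
    refine hψ.smul ?_
    refine Continuous.clm_comp (by fun_prop) ?_
    refine continuous_const.sub ?_
    exact (ContinuousLinearMap.smulRightL ℝ (ℝ × (Fin n → ℝ)) (Fin n → ℝ)
      (ContinuousLinearMap.fst ℝ ℝ (Fin n → ℝ))).continuous
  · refine Eventually.of_forall fun y p _ => ?_
    rw [norm_smul]
    refine mul_le_mul_of_nonneg_left ?_ (norm_nonneg _)
    refine (ContinuousLinearMap.opNorm_comp_le _ _).trans ?_
    refine mul_le_mul (hM _) ?_ (norm_nonneg _) hM0
    refine (norm_sub_le _ _).trans (add_le_add (ContinuousLinearMap.norm_snd_le ..) ?_)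
    rw [ContinuousLinearMap.norm_smulRight_apply]
    exact mul_le_of_le_one_left (norm_nonneg _) (ContinuousLinearMap.norm_fst_le ..)
  · refine Continuous.integrable_of_hasCompactSupport (by fun_prop) ?_
    exact hψs.norm.mul_right
  · refine Eventually.of_forall fun y p _ => ?_
    refine HasFDerivAt.const_mul ?_ _
    have h1 : HasFDerivAt (fun p : ℝ × (Fin n → ℝ) => p.2 - p.1 • y)
        (ContinuousLinearMap.snd ℝ ℝ (Fin n → ℝ) -
          (ContinuousLinearMap.fst ℝ ℝ (Fin n → ℝ)).smulRight y) p :=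
      hasFDerivAt_snd.sub (hasFDerivAt_fst.smul_const y)
    exact (hf.differentiable one_ne_zero _).hasFDerivAt.comp p h1

theorem integrable_moll_fderiv {ψ f : (Fin n → ℝ) → ℝ} (hψ : Continuous ψ)
    (hψs : HasCompactSupport ψ) (hf : ContDiff ℝ 1 f)
    (p : ℝ × (Fin n → ℝ)) : Integrable fun y => ψ y • (fderiv ℝ f (p.2 - p.1 • y)).comp
        (ContinuousLinearMap.snd ℝ ℝ (Fin n → ℝ) -
          (ContinuousLinearMap.fst ℝ ℝ (Fin n → ℝ)).smulRight y) := by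
  have hcont := hf.continuous_fderiv one_ne_zero
  refine Continuous.integrable_of_hasCompactSupport ?_ hψs.smul_right
  refine hψ.smul ?_
  refine Continuous.clm_comp (by fun_prop) ?_
  refine continuous_const.sub ?_
  exact (ContinuousLinearMap.smulRightL ℝ (ℝ × (Fin n → ℝ)) (Fin n → ℝ)
    (ContinuousLinearMap.fst ℝ ℝ (Fin n → ℝ))).continuous

theorem differentiable_moll {ψ f : (Fin n → ℝ) → ℝ} (hψ : Continuous ψ)
    (hψs : HasCompactSupport ψ) (hf : ContDiff ℝ 1 f) (hfs : HasCompactSupport f) (t : ℝ) :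
    Differentiable ℝ (moll ψ t f) := fun x =>
  ((hasFDerivAt_moll hψ hψs hf hfs (t, x)).comp x (hasFDerivAt_prodMk_right t x)).differentiableAt

theorem fderiv_moll {ψ f : (Fin n → ℝ) → ℝ} (hψ : Continuous ψ)
    (hψs : HasCompactSupport ψ) (hf : ContDiff ℝ 1 f) (hfs : HasCompactSupport f) (t : ℝ)
    (x v : Fin n → ℝ) :
    fderiv ℝ (moll ψ t f) x v = moll ψ t (fun z => fderiv ℝ f z v) x := by
  have h := ((hasFDerivAt_moll hψ hψs hf hfs (t, x)).comp x (hasFDerivAt_prodMk_right t x)).fderiv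
  have h2 : (fun p : ℝ × (Fin n → ℝ) => moll ψ p.1 f p.2) ∘ (fun y => (t, y)) = moll ψ t f := rfl
  rw [h2] at h
  rw [h, ContinuousLinearMap.comp_apply,
    ContinuousLinearMap.integral_apply (integrable_moll_fderiv hψ hψs hf _)]
  simp [moll]

theorem hasDerivAt_moll {ψ f : (Fin n → ℝ) → ℝ} (hψ : Continuous ψ)
    (hψs : HasCompactSupport ψ) (hf : ContDiff ℝ 1 f) (hfs : HasCompactSupport f) (t : ℝ)
    (x : Fin n → ℝ) :
    HasDerivAt (fun s => moll ψ s f x)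
      (-∑ j, moll (fun y => y j * ψ y) t (fun z => fderiv ℝ f z (Pi.single j 1)) x) t := by
  have h := ((hasFDerivAt_moll hψ hψs hf hfs (t, x)).comp t (hasFDerivAt_prodMk_left t x)).hasDerivAt
  refine h.congr_deriv ?_
  symm
  rw [ContinuousLinearMap.comp_apply,
    ContinuousLinearMap.integral_apply (integrable_moll_fderiv hψ hψs hf _)]
  have hcont := hf.continuous_fderiv one_ne_zero
  unfold moll
  rw [← integral_finsetSum, ← integral_neg]
  · congr 1
    ext y
    simp only [smul_apply, ContinuousLinearMap.comp_apply, smul_eq_mul]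
    have : ((ContinuousLinearMap.snd ℝ ℝ (Fin n → ℝ) -
          (ContinuousLinearMap.fst ℝ ℝ (Fin n → ℝ)).smulRight y)
        ((ContinuousLinearMap.inl ℝ ℝ (Fin n → ℝ)) 1)) = - y := by simp
    rw [this, map_neg]
    conv_rhs => rw [vec_eq_sum_single y]
    simp only [map_sum, map_smul, smul_eq_mul]
    rw [← vec_eq_sum_single y, mul_neg, Finset.mul_sum]
    congr 1
    refine Finset.sum_congr rfl fun j _ => ?_
    ring
  · intro j _
    exact integrable_moll_integrand (ψ := fun y => y j * ψ y)
      (f := fun z => fderiv ℝ f z (Pi.single j 1)) (by fun_prop) hψs.mul_left (by fun_prop) _ _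

theorem mul_fderiv_moll {ψ f : (Fin n → ℝ) → ℝ} (hψ : ContDiff ℝ 1 ψ)
    (hψs : HasCompactSupport ψ) (hf : ContDiff ℝ 1 f) (hfs : HasCompactSupport f) (t : ℝ)
    (x v : Fin n → ℝ) :
    t * fderiv ℝ (moll ψ t f) x v = moll (fun y => fderiv ℝ ψ y v) t f x := by
  rw [fderiv_moll hψ.continuous hψs hf hfs]
  have hg : ContDiff ℝ 1 fun y => f (x - t • y) := by fun_prop
  have h := integral_mul_Xop (c := fun _ => v) contDiff_const hψ hg hψs
  have h1 : ∀ y, Xop (fun _ => v) (fun y => f (x - t • y)) y =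
      -(t * fderiv ℝ f (x - t • y) v) := by
    intro y
    have h1 : HasFDerivAt (fun y : Fin n → ℝ => x - t • y)
        (-(t • ContinuousLinearMap.id ℝ (Fin n → ℝ))) y :=
      ((hasFDerivAt_id y).const_smul t).const_sub x
    have h2 := ((hf.differentiable one_ne_zero (x - t • y)).hasFDerivAt.comp y h1).fderiv
    unfold Xop
    change fderiv ℝ (f ∘ fun y => x - t • y) y v = _
    rw [h2]
    simp
  have h2 : ∀ y, vfDiv (fun _ => v) y = 0 := by intro y; simp [vfDiv]
  simp only [h1, h2, zero_mul, add_zero, mul_neg, integral_neg, neg_inj] at h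
  unfold moll
  rw [← integral_const_mul]
  refine Eq.trans ?_ h
  congr 1; ext y; ring

theorem contDiff_moll {ψ f : (Fin n → ℝ) → ℝ} (hψ : ContDiff ℝ ∞ ψ)
    (hψs : HasCompactSupport ψ) (hf : ContDiff ℝ 1 f) (hfs : HasCompactSupport f) {t : ℝ}
    (ht : t ≠ 0) : ContDiff ℝ ∞ (moll ψ t f) := by
  refine contDiff_infty.2 fun k => ?_
  induction k generalizing ψ with
  | zero =>
    rw [Nat.cast_zero, contDiff_zero]
    exact continuous_moll_right hψ.continuous hψs hf.continuous t
  | succ k ih =>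
    rw [Nat.cast_succ, contDiff_succ_iff_fderiv_apply]
    refine ⟨differentiable_moll hψ.continuous hψs hf hfs t, by simp, fun v => ?_⟩
    have h1 : ∀ x, fderiv ℝ (moll ψ t f) x v = t⁻¹ * moll (fun y => fderiv ℝ ψ y v) t f x := by
      intro x
      rw [← mul_fderiv_moll (hψ.of_le (by simp)) hψs hf hfs, inv_mul_cancel_left₀ ht]
    simp_rw [h1]
    refine contDiff_const.mul (ih ?_ (hψs.fderiv_apply (𝕜 := ℝ) v))
    exact (hψ.fderiv_right (by simp)).clm_apply contDiff_const

/-- Cauchy–Schwarz for real integrals. -/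
theorem sq_integral_mul_le {α : Type*} [MeasurableSpace α] {μ : Measure α} {A B : α → ℝ}
    (hA : Integrable (fun y => A y ^ 2) μ) (hB : Integrable (fun y => B y ^ 2) μ)
    (hAB : Integrable (fun y => A y * B y) μ) :
    (∫ y, A y * B y ∂μ) ^ 2 ≤ (∫ y, A y ^ 2 ∂μ) * ∫ y, B y ^ 2 ∂μ := by
  have h : ∀ a : ℝ, 0 ≤ (∫ y, A y ^ 2 ∂μ) * (a * a) + (-2 * ∫ y, A y * B y ∂μ) * a +
      ∫ y, B y ^ 2 ∂μ := by
    intro a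
    have h0 : 0 ≤ ∫ y, (B y - a * A y) ^ 2 ∂μ := integral_nonneg fun y => sq_nonneg _
    have e : ∫ y, (B y - a * A y) ^ 2 ∂μ =
        ∫ y, (A y ^ 2 * (a * a) + -2 * a * (A y * B y)) + B y ^ 2 ∂μ := by
      congr 1; ext y; ring
    have i1 : Integrable (fun y => A y ^ 2 * (a * a)) μ := hA.mul_const _
    have i2 : Integrable (fun y => -2 * a * (A y * B y)) μ := hAB.const_mul _
    have i3 : Integrable (fun y => A y ^ 2 * (a * a) + -2 * a * (A y * B y)) μ := i1.add i2
    rw [e, integral_add i3 hB, integral_add i1 i2, integral_mul_const,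
      integral_const_mul] at h0
    linarith
  have := discrim_le_zero h
  unfold discrim at this
  nlinarith

/-- Cauchy–Schwarz with a weight. -/
theorem sq_integral_weight_mul_le {w F : (Fin n → ℝ) → ℝ} (hw : Continuous w)
    (hws : HasCompactSupport w) (hw0 : ∀ y, 0 ≤ w y) (hF : Continuous F) :
    (∫ y, w y * F y) ^ 2 ≤ (∫ y, w y) * ∫ y, w y * F y ^ 2 := by
  have e1 : ∀ y, √(w y) ^ 2 = w y := fun y => Real.sq_sqrt (hw0 y)
  have e2 : ∀ y, (√(w y) * F y) ^ 2 = w y * F y ^ 2 := fun y => by rw [mul_pow, e1]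
  have e3 : ∀ y, √(w y) * (√(w y) * F y) = w y * F y := fun y => by
    rw [← mul_assoc, ← pow_two, e1]
  have h := sq_integral_mul_le (μ := volume) (A := fun y => √(w y)) (B := fun y => √(w y) * F y)
  simp only [e1, e2, e3] at h
  exact h (hw.integrable_of_hasCompactSupport hws)
    ((hw.mul (hF.pow 2)).integrable_of_hasCompactSupport hws.mul_right)
    ((hw.mul hF).integrable_of_hasCompactSupport hws.mul_right)

theorem integrable_sq {f : (Fin n → ℝ) → ℝ} (hf : Continuous f) (hfs : HasCompactSupport f) :
    Integrable fun x => f x ^ 2 := by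
  refine (hf.pow 2).integrable_of_hasCompactSupport ?_
  simp only [pow_two]; exact hfs.mul_right

theorem abs_moll_le {ψ h f : (Fin n → ℝ) → ℝ} (hψ : Continuous ψ) (hψs : HasCompactSupport ψ)
    (hh : Continuous h) (hhs : HasCompactSupport h) (hf : Continuous f)
    (hle : ∀ y, |ψ y| ≤ h y) (t : ℝ) (x : Fin n → ℝ) :
    |moll ψ t f x| ≤ moll h t (fun z => |f z|) x := by
  unfold moll
  refine (abs_integral_le_integral_abs).trans ?_
  refine integral_mono (integrable_moll_integrand hψ hψs hf _ _).abs
    (integrable_moll_integrand hh hhs hf.abs _ _) fun y => ?_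
  simp only [abs_mul]
  exact mul_le_mul_of_nonneg_right (hle y) (abs_nonneg _)

/-- Young's inequality in `L²`, nonnegative weight. -/
theorem sqInt_moll_le_of_nonneg {w f : (Fin n → ℝ) → ℝ} (hw : Continuous w)
    (hws : HasCompactSupport w) (hw0 : ∀ y, 0 ≤ w y) (hf : Continuous f)
    (hfs : HasCompactSupport f) (t : ℝ) :
    sqInt (moll w t f) ≤ (∫ y, w y) ^ 2 * sqInt f := by
  have hc := continuous_moll_right hw hws hf t
  have hs := hasCompactSupport_moll hws hfs t
  have hf2 : Continuous fun z => f z ^ 2 := hf.pow 2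
  have hf2s : HasCompactSupport fun z => f z ^ 2 := by
    simp only [pow_two]; exact hfs.mul_right
  have hc2 := continuous_moll_right hw hws hf2 t
  have hs2 := hasCompactSupport_moll hws hf2s t
  have h1 : sqInt (moll w t f) ≤ ∫ x, (∫ y, w y) * moll w t (fun z => f z ^ 2) x := by
    refine integral_mono ?_ ((hc2.integrable_of_hasCompactSupport hs2).const_mul _) fun x => ?_
    · refine (hc.pow 2).integrable_of_hasCompactSupport ?_
      simp only [pow_two]; exact hs.mul_right
    · exact sq_integral_weight_mul_le hw hws hw0 (F := fun y => f (x - t • y)) (by fun_prop)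
  refine h1.trans (le_of_eq ?_)
  rw [integral_const_mul, pow_two, mul_assoc]
  congr 1
  unfold moll sqInt
  rw [integral_integral_swap]
  · rw [← integral_mul_const]
    congr 1; ext y
    rw [integral_const_mul]
    congr 1
    exact integral_sub_right_eq_self (fun z => f z ^ 2) (t • y)
  · have hK : IsCompact ((fun p : (Fin n → ℝ) × (Fin n → ℝ) => (p.1 + t • p.2, p.2)) ''
      (tsupport f ×ˢ tsupport w)) := (hfs.isCompact.prod hws.isCompact).image (by fun_prop)
    refine Continuous.integrable_of_hasCompactSupport (by unfold Function.uncurry; fun_prop) ?_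
    refine HasCompactSupport.intro hK fun p hp => ?_
    obtain ⟨x, y⟩ := p
    by_cases hy : y ∈ tsupport w
    · have : x - t • y ∉ tsupport f := fun h => hp ⟨(x - t • y, y), ⟨h, hy⟩, by simp⟩
      simp [Function.uncurry, image_eq_zero_of_notMem_tsupport this]
    · simp [Function.uncurry, image_eq_zero_of_notMem_tsupport hy]

theorem sqInt_mono {f g : (Fin n → ℝ) → ℝ} (hf : Continuous f) (hfs : HasCompactSupport f)
    (hg : Continuous g) (hgs : HasCompactSupport g) (h : ∀ x, |f x| ≤ |g x|) :
    sqInt f ≤ sqInt g := by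
  exact integral_mono (integrable_sq hf hfs) (integrable_sq hg hgs) fun x => sq_le_sq.2 (h x)

theorem sqInt_moll_le {ψ f : (Fin n → ℝ) → ℝ} (hψ : Continuous ψ)
    (hψs : HasCompactSupport ψ) (hf : Continuous f)
    (hfs : HasCompactSupport f) (t : ℝ) :
    sqInt (moll ψ t f) ≤ (∫ y, |ψ y|) ^ 2 * sqInt f := by
  have h := sqInt_moll_le_of_nonneg hψ.abs hψs.norm (fun y => abs_nonneg _) hf.abs hfs.norm t
  have e : sqInt (fun z => |f z|) = sqInt f := by simp [sqInt]
  rw [e] at h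
  refine (sqInt_mono (continuous_moll_right hψ hψs hf t) (hasCompactSupport_moll hψs hfs t)
    (continuous_moll_right hψ.abs hψs.norm hf.abs t) (hasCompactSupport_moll hψs.norm hfs.norm t)
    fun x => ?_).trans h
  exact (abs_moll_le hψ hψs hψ.abs hψs.norm hf (fun y => le_rfl) t x).trans (le_abs_self _)

theorem sq_moll_le {ψ f : (Fin n → ℝ) → ℝ} (hψ : Continuous ψ)
    (hψs : HasCompactSupport ψ) (hf : Continuous f)
    (hfs : HasCompactSupport f) {t : ℝ} (ht : 0 < t) (x : Fin n → ℝ) :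
    t ^ n * moll ψ t f x ^ 2 ≤ sqInt ψ * sqInt f := by
  set F : (Fin n → ℝ) → ℝ := fun y => f (x - t • y) with hF
  have hFc : Continuous F := by fun_prop
  have hFs : HasCompactSupport F := by
    have hK : IsCompact ((fun z : Fin n → ℝ => t⁻¹ • (x - z)) '' tsupport f) :=
      hfs.isCompact.image (by fun_prop)
    refine HasCompactSupport.intro hK fun y hy => ?_
    refine image_eq_zero_of_notMem_tsupport (f := f) (x := x - t • y) fun h => hy ⟨_, h, ?_⟩
    simp [smul_smul, inv_mul_cancel₀ ht.ne']
  have hQ : t ^ n * ∫ y, F y ^ 2 = sqInt f := by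
    have h1 := Measure.integral_comp_smul (μ := (volume : Measure (Fin n → ℝ)))
      (fun z => f (x - z) ^ 2) t
    simp only [Module.finrank_fin_fun, smul_eq_mul] at h1
    rw [hF, h1, abs_of_pos (by positivity), mul_inv_cancel_left₀ (by positivity)]
    exact integral_sub_left_eq_self (fun z => f z ^ 2) volume x
  have i1 : Integrable fun y => ψ y * F y := (hψ.mul hFc).integrable_of_hasCompactSupport
    hψs.mul_right
  have h3 : (∫ y, ψ y * F y) ^ 2 ≤ sqInt ψ * ∫ y, F y ^ 2 :=
    sq_integral_mul_le (integrable_sq hψ hψs) (integrable_sq hFc hFs) i1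
  calc t ^ n * moll ψ t f x ^ 2 ≤ t ^ n * (sqInt ψ * ∫ y, F y ^ 2) :=
        mul_le_mul_of_nonneg_left h3 (by positivity)
    _ = sqInt ψ * sqInt f := by rw [← hQ]; ring

theorem moll_zero {ψ f : (Fin n → ℝ) → ℝ} (hψ1 : ∫ y, ψ y = 1) (x : Fin n → ℝ) :
    moll ψ 0 f x = f x := by
  simp [moll, integral_mul_const, hψ1]

end Mollifier

section SubellipticGain

open scoped ContDiff

variable {n m : ℕ}

/-- Smooth compactly supported vector fields. -/
def CVField (c : (Fin n → ℝ) → (Fin n → ℝ)) : Prop :=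
  ContDiff ℝ ∞ c ∧ HasCompactSupport c

theorem CVField.contDiff_one {c : (Fin n → ℝ) → (Fin n → ℝ)} (h : CVField c) : ContDiff ℝ 1 c :=
  h.1.of_le (by simp)

theorem CVField.bracket {c d : (Fin n → ℝ) → (Fin n → ℝ)} (hc : CVField c)
    (hd : ContDiff ℝ ∞ d) : CVField (vfBracket c d) :=
  ⟨contDiff_vfBracket hc.1 hd, hasCompactSupport_vfBracket hc.2⟩

/-- Compactly supported continuous functions. -/
def CCFun (f : (Fin n → ℝ) → ℝ) : Prop := Continuous f ∧ HasCompactSupport f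

theorem CCFun.sq {f : (Fin n → ℝ) → ℝ} (hf : CCFun f) : Integrable fun x => f x ^ 2 :=
  integrable_sq hf.1 hf.2

theorem sqInt_le_sum {ι : Type*} [Fintype ι] {F : (Fin n → ℝ) → ℝ} {G : ι → (Fin n → ℝ) → ℝ}
    {A : ℝ} (hF : CCFun F) (hG : ∀ i, CCFun (G i))
    (h : ∀ x, F x ^ 2 ≤ A * ∑ i, G i x ^ 2) : sqInt F ≤ A * ∑ i, sqInt (G i) := by
  unfold sqInt
  rw [← integral_finsetSum _ fun i _ => (hG i).sq, ← integral_const_mul]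
  exact integral_mono hF.sq ((integrable_finsetSum _ fun i _ => (hG i).sq).const_mul _) h

theorem sqInt_const_mul (a : ℝ) (f : (Fin n → ℝ) → ℝ) :
    sqInt (fun x => a * f x) = a ^ 2 * sqInt f := by
  simp [sqInt, mul_pow, integral_const_mul]

theorem sqInt_add_le {f g : (Fin n → ℝ) → ℝ} (hf : CCFun f) (hg : CCFun g) :
    sqInt (fun x => f x + g x) ≤ 2 * (sqInt f + sqInt g) := by
  have h := sqInt_le_sum (ι := Fin 2) (F := fun x => f x + g x) (G := ![f, g]) (A := 2)
    ⟨hf.1.add hg.1, hf.2.add hg.2⟩ (by intro i; fin_cases i <;> simp [hf, hg])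
    (by intro x; simp [Fin.sum_univ_two]; nlinarith [sq_nonneg (f x - g x)])
  simpa [Fin.sum_univ_two] using h

/-- The energy `∫ f² + ∑ ∫ (X_i f)²`. -/
noncomputable def energy (b : Fin m → (Fin n → ℝ) → (Fin n → ℝ)) (f : (Fin n → ℝ) → ℝ) : ℝ :=
  sqInt f + ∑ i, sqInt (Xop (b i) f)

theorem sqInt_le_energy (b : Fin m → (Fin n → ℝ) → (Fin n → ℝ)) (f : (Fin n → ℝ) → ℝ) :
    sqInt f ≤ energy b f :=
  le_add_of_nonneg_right (Finset.sum_nonneg fun _ _ => sqInt_nonneg _)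

theorem sqInt_Xop_le_energy (b : Fin m → (Fin n → ℝ) → (Fin n → ℝ)) (f : (Fin n → ℝ) → ℝ)
    (i : Fin m) : sqInt (Xop (b i) f) ≤ energy b f :=
  (Finset.single_le_sum (f := fun i => sqInt (Xop (b i) f)) (fun _ _ => sqInt_nonneg _)
    (Finset.mem_univ i)).trans (le_add_of_nonneg_left (sqInt_nonneg _))

theorem energy_nonneg (b : Fin m → (Fin n → ℝ) → (Fin n → ℝ)) (f : (Fin n → ℝ) → ℝ) :
    0 ≤ energy b f := (sqInt_nonneg f).trans (sqInt_le_energy b f)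

theorem CCFun.xop {c : (Fin n → ℝ) → (Fin n → ℝ)} (hc : Continuous c) {f : (Fin n → ℝ) → ℝ}
    (hf : ContDiff ℝ 1 f) (hfs : HasCompactSupport f) : CCFun (Xop c f) :=
  ⟨continuous_Xop hc hf, hasCompactSupport_Xop c hfs⟩

theorem CCFun.moll {ψ f : (Fin n → ℝ) → ℝ} (hψ : CCFun ψ) (hf : CCFun f) (t : ℝ) :
    CCFun (moll ψ t f) :=
  ⟨continuous_moll_right hψ.1 hψ.2 hf.1 t, hasCompactSupport_moll hψ.2 hf.2 t⟩

/-- Friedrichs' lemma. -/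
theorem exists_sqInt_Xop_moll_le {c : (Fin n → ℝ) → (Fin n → ℝ)} (hc : CVField c)
    {ψ : (Fin n → ℝ) → ℝ} (hψ : ContDiff ℝ ∞ ψ) (hψs : HasCompactSupport ψ) :
    ∃ C, 0 ≤ C ∧ ∀ t, 0 < t → ∀ f, ContDiff ℝ 1 f → HasCompactSupport f →
      sqInt (Xop c (moll ψ t f)) ≤ C * (sqInt f + sqInt (Xop c f)) := by
  have hc1 := hc.contDiff_one
  have hψ1 : ContDiff ℝ 1 ψ := hψ.of_le (by simp)
  obtain ⟨L, hL⟩ := hc1.lipschitzWith_of_hasCompactSupport hc.2 one_ne_zero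
  have hdivs : HasCompactSupport (vfDiv c) := by
    refine hc.2.mono' fun x hx => ?_
    by_contra hxc
    apply hx
    have h0 : c =ᶠ[𝓝 x] 0 := notMem_tsupport_iff_eventuallyEq.1 hxc
    refine Finset.sum_eq_zero fun j _ => ?_
    have h1 : (fun y => c y j) =ᶠ[𝓝 x] fun _ => 0 := h0.mono fun y hy => by simp [hy]
    simp [h1.fderiv_eq]
  obtain ⟨M, hM⟩ := hdivs.exists_bound_of_continuous (continuous_vfDiv hc1)
  have hDψ := hψ1.continuous_fderiv one_ne_zero
  set h : (Fin n → ℝ) → ℝ := fun y => ‖fderiv ℝ ψ y‖ * (L * ‖y‖) + M * |ψ y| with hh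
  have hhc : Continuous h := by have := hψ.continuous; fun_prop
  have hhs : HasCompactSupport h :=
    ((hψs.fderiv (𝕜 := ℝ)).norm.mul_right).add (hψs.norm.mul_left (f := fun _ => M))
  refine ⟨2 * ((∫ y, |h y|) ^ 2 + (∫ y, |ψ y|) ^ 2), by positivity, fun t ht f hf hfs => ?_⟩
  have hDf := hf.continuous_fderiv one_ne_zero
  have hXf : CCFun (Xop c f) := CCFun.xop hc.1.continuous hf hfs
  have hψc : CCFun ψ := ⟨hψ.continuous, hψs⟩
  have hpt : ∀ x, |Xop c (moll ψ t f) x - moll ψ t (Xop c f) x| ≤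
      moll h t (fun z => |f z|) x := by
    intro x
    set a : (Fin n → ℝ) → (Fin n → ℝ) := fun y => c x - c (x - t • y) with ha
    have hac : ContDiff ℝ 1 a := by fun_prop
    set g : (Fin n → ℝ) → ℝ := fun y => f (x - t • y) with hg
    have hgc : ContDiff ℝ 1 g := by fun_prop
    have hsub : ∀ y, HasFDerivAt (fun y : Fin n → ℝ => x - t • y)
        (-(t • ContinuousLinearMap.id ℝ (Fin n → ℝ))) y := fun y =>
      ((hasFDerivAt_id y).const_smul t).const_sub x
    have e1 : ∀ y, Xop a g y = -(t * fderiv ℝ f (x - t • y) (a y)) := by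
      intro y
      have h2 := ((hf.differentiable one_ne_zero (x - t • y)).hasFDerivAt.comp y (hsub y)).fderiv
      unfold Xop
      change fderiv ℝ (f ∘ fun y => x - t • y) y (a y) = _
      rw [h2]
      simp
    have e2 : ∀ y, vfDiv a y = t * vfDiv c (x - t • y) := by
      intro y
      unfold vfDiv
      rw [Finset.mul_sum]
      refine Finset.sum_congr rfl fun j _ => ?_
      have hcj : HasFDerivAt (fun z => c z j) (fderiv ℝ (fun z => c z j) (x - t • y))
          (x - t • y) := ((contDiff_pi.1 hc1 j).differentiable one_ne_zero _).hasFDerivAt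
      have h2 := ((hcj.comp y (hsub y)).const_sub (c x j)).fderiv
      change fderiv ℝ (fun y => c x j - ((fun z => c z j) ∘ fun y => x - t • y) y) y _ = _
      rw [h2]
      simp
    have hibp := integral_mul_Xop hac hψ1 hgc hψs
    simp only [e1, e2] at hibp
    have e3 : Xop c (moll ψ t f) x - moll ψ t (Xop c f) x =
        ∫ y, ψ y * fderiv ℝ f (x - t • y) (a y) := by
      unfold Xop
      rw [fderiv_moll hψ.continuous hψs hf hfs]
      unfold moll
      rw [← integral_sub]
      · congr 1; ext y
        simp only [ha, map_sub]; ring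
      · exact integrable_moll_integrand (f := fun z => fderiv ℝ f z (c x)) hψ.continuous hψs
          (by fun_prop) t x
      · exact integrable_moll_integrand (f := Xop c f) hψ.continuous hψs hXf.1 t x
    have e4 : t * (Xop c (moll ψ t f) x - moll ψ t (Xop c f) x) =
        ∫ y, (Xop a ψ y + t * vfDiv c (x - t • y) * ψ y) * g y := by
      rw [e3, ← integral_const_mul, ← neg_inj, ← hibp, ← integral_neg]
      congr 1; ext y; ring
    have e5 : |∫ y, (Xop a ψ y + t * vfDiv c (x - t • y) * ψ y) * g y| ≤
        ∫ y, t * (h y * |f (x - t • y)|) := by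
      refine (abs_integral_le_integral_abs).trans ?_
      have hXa : Continuous (Xop a ψ) := continuous_Xop hac.continuous hψ1
      have hdc := continuous_vfDiv hc1
      have hψc' := hψ.continuous
      have hgc' := hgc.continuous
      refine integral_mono ?_ ?_ fun y => ?_
      · refine Continuous.integrable_of_hasCompactSupport (by fun_prop) ?_
        exact HasCompactSupport.norm
          (((hasCompactSupport_Xop a hψs).add hψs.mul_left).mul_right)
      · exact (integrable_moll_integrand hhc hhs hf.continuous.abs t x).const_mul _
      · simp only [abs_mul]
        rw [← mul_assoc]
        refine mul_le_mul_of_nonneg_right ?_ (abs_nonneg _)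
        refine (abs_add_le _ _).trans ?_
        have h1 : |Xop a ψ y| ≤ ‖fderiv ℝ ψ y‖ * (L * (t * ‖y‖)) := by
          refine ((fderiv ℝ ψ y).le_opNorm (a y)).trans ?_
          refine mul_le_mul_of_nonneg_left ?_ (norm_nonneg _)
          have := hL.norm_sub_le x (x - t • y)
          simpa [norm_smul, abs_of_pos ht] using this
        have h2 : |t * vfDiv c (x - t • y) * ψ y| ≤ t * M * |ψ y| := by
          rw [abs_mul, abs_mul, abs_of_pos ht]
          gcongr
          exact hM _
        simp only [hh]
        calc _ ≤ _ := add_le_add h1 h2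
          _ = _ := by ring
    rw [← e4, abs_mul, abs_of_pos ht, integral_const_mul] at e5
    exact le_of_mul_le_mul_left e5 ht
  have hR : CCFun fun x => Xop c (moll ψ t f) x - moll ψ t (Xop c f) x := by
    have h1 : CCFun (Xop c (moll ψ t f)) := CCFun.xop hc.1.continuous
      ((contDiff_moll hψ hψs hf hfs ht.ne').of_le (by simp)) (hasCompactSupport_moll hψs hfs t)
    have h2 := hψc.moll hXf t
    exact ⟨h1.1.sub h2.1, h1.2.sub h2.2⟩
  have hR2 : sqInt (fun x => Xop c (moll ψ t f) x - moll ψ t (Xop c f) x) ≤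
      (∫ y, |h y|) ^ 2 * sqInt f := by
    have hm : CCFun (moll h t fun z => |f z|) :=
      CCFun.moll ⟨hhc, hhs⟩ ⟨hf.continuous.abs, hfs.norm⟩ t
    refine (sqInt_mono hR.1 hR.2 hm.1 hm.2 fun x => (hpt x).trans (le_abs_self _)).trans ?_
    have := sqInt_moll_le hhc hhs hf.continuous.abs hfs.norm t
    simpa [sqInt] using this
  have hS := sqInt_moll_le hψ.continuous hψs hXf.1 hXf.2 t
  have := sqInt_add_le hR (hψc.moll hXf t)
  simp only [sub_add_cancel] at this
  refine this.trans ?_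
  have q1 := sqInt_nonneg f
  have q2 := sqInt_nonneg (Xop c f)
  have p1 := mul_nonneg (sq_nonneg (∫ y, |h y|)) q2
  have p2 := mul_nonneg (sq_nonneg (∫ y, |ψ y|)) q1
  nlinarith

theorem sq_Xop_le {c : (Fin n → ℝ) → (Fin n → ℝ)} {M : ℝ} (hM : ∀ x, ‖c x‖ ≤ M)
    (g : (Fin n → ℝ) → ℝ) (x : Fin n → ℝ) :
    Xop c g x ^ 2 ≤ (n * M ^ 2) * ∑ j, (Xop (fun _ => Pi.single j 1) g x) ^ 2 := by
  rw [Xop_eq_sum]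
  refine (Finset.sum_mul_sq_le_sq_mul_sq _ _ _).trans ?_
  refine mul_le_mul_of_nonneg_right ?_ (Finset.sum_nonneg fun _ _ => sq_nonneg _)
  calc ∑ j, c x j ^ 2 ≤ ∑ _j : Fin n, M ^ 2 := Finset.sum_le_sum fun j _ => by
        rw [← sq_abs]
        exact pow_le_pow_left₀ (abs_nonneg _) ((norm_le_pi_norm (c x) j).trans (hM x)) 2
    _ = n * M ^ 2 := by simp

theorem Xop_single_moll {ψ f : (Fin n → ℝ) → ℝ} (hψ : ContDiff ℝ ∞ ψ)
    (hψs : HasCompactSupport ψ) (hf : ContDiff ℝ 1 f) (hfs : HasCompactSupport f) {t : ℝ}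
    (ht : t ≠ 0) (v : Fin n → ℝ) :
    Xop (fun _ => v) (moll ψ t f) =
      fun x => t⁻¹ * moll (fun y => fderiv ℝ ψ y v) t f x := by
  ext x
  rw [← mul_fderiv_moll (hψ.of_le (by simp)) hψs hf hfs, inv_mul_cancel_left₀ ht]
  rfl

theorem contDiff_fderiv_apply_infty {ψ : (Fin n → ℝ) → ℝ} (hψ : ContDiff ℝ ∞ ψ)
    (v : Fin n → ℝ) : ContDiff ℝ ∞ fun y => fderiv ℝ ψ y v :=
  (hψ.fderiv_right (by simp)).clm_apply contDiff_const

theorem exists_sq_mul_sqInt_Xop_moll_le {c : (Fin n → ℝ) → (Fin n → ℝ)} (hc : CVField c)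
    {ψ : (Fin n → ℝ) → ℝ} (hψ : ContDiff ℝ ∞ ψ) (hψs : HasCompactSupport ψ) :
    ∃ C, 0 ≤ C ∧ ∀ t, 0 < t → ∀ f, ContDiff ℝ 1 f → HasCompactSupport f →
      t ^ 2 * sqInt (Xop c (moll ψ t f)) ≤ C * sqInt f := by
  obtain ⟨M, hM⟩ := hc.2.exists_bound_of_continuous hc.1.continuous
  refine ⟨(n * M ^ 2) * ∑ j, (∫ y, |fderiv ℝ ψ y (Pi.single j 1)|) ^ 2, by positivity,
    fun t ht f hf hfs => ?_⟩
  have hg : ContDiff ℝ 1 (moll ψ t f) := (contDiff_moll hψ hψs hf hfs ht.ne').of_le (by simp)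
  have hgs := hasCompactSupport_moll hψs hfs t
  have h := sqInt_le_sum (CCFun.xop hc.1.continuous hg hgs)
    (fun j => CCFun.xop continuous_const hg hgs) (sq_Xop_le hM (moll ψ t f))
  have h2 : ∀ j : Fin n, t ^ 2 * sqInt (Xop (fun _ => Pi.single j 1) (moll ψ t f)) ≤
      (∫ y, |fderiv ℝ ψ y (Pi.single j 1)|) ^ 2 * sqInt f := by
    intro j
    rw [Xop_single_moll hψ hψs hf hfs ht.ne', sqInt_const_mul, ← mul_assoc, ← mul_pow,
      mul_inv_cancel₀ ht.ne', one_pow, one_mul]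
    exact sqInt_moll_le (contDiff_fderiv_apply_infty hψ _).continuous
      (hψs.fderiv_apply (𝕜 := ℝ) _) hf.continuous hfs t
  calc _ ≤ t ^ 2 * _ := mul_le_mul_of_nonneg_left h (by positivity)
    _ = (n * M ^ 2) * ∑ j : Fin n, t ^ 2 * sqInt (Xop (fun _ => Pi.single j 1) (moll ψ t f)) := by
        rw [← Finset.mul_sum]; ring
    _ ≤ (n * M ^ 2) * ∑ j, (∫ y, |fderiv ℝ ψ y (Pi.single j 1)|) ^ 2 * sqInt f := by
        refine mul_le_mul_of_nonneg_left (Finset.sum_le_sum fun j _ => h2 j) (by positivity)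
    _ = _ := by rw [← Finset.sum_mul]; ring

/-- The field `Z` gains `ε / 2` derivatives: `t² ‖Z S_t f‖² ≤ C t^ε E(f)` for all mollifiers. -/
def Gain (b : Fin m → (Fin n → ℝ) → (Fin n → ℝ)) (ε : ℝ) (Z : (Fin n → ℝ) → (Fin n → ℝ)) : Prop :=
  ∀ ψ : (Fin n → ℝ) → ℝ, ContDiff ℝ ∞ ψ → HasCompactSupport ψ →
    ∃ C, 0 ≤ C ∧ ∀ t, 0 < t → t ≤ 1 → ∀ f, ContDiff ℝ 1 f → HasCompactSupport f →
      t ^ 2 * sqInt (Xop Z (moll ψ t f)) ≤ C * (t ^ ε * energy b f)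

end SubellipticGain

section SubellipticBracket

open scoped ContDiff

variable {n m : ℕ} {b : Fin m → (Fin n → ℝ) → (Fin n → ℝ)}

theorem two_le_infty : (2 : WithTop ℕ∞) ≤ ∞ :=
  ENat.LEInfty.out

theorem Gain.mono {ε ε' : ℝ} {Z : (Fin n → ℝ) → (Fin n → ℝ)} (h : Gain b ε Z) (hε : ε' ≤ ε) :
    Gain b ε' Z := by
  intro ψ hψ hψs
  obtain ⟨C, hC, hC'⟩ := h ψ hψ hψs
  refine ⟨C, hC, fun t ht ht1 f hf hfs => (hC' t ht ht1 f hf hfs).trans ?_⟩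
  have := energy_nonneg b f
  gcongr C * (?_ * _)
  exact Real.rpow_le_rpow_of_exponent_ge ht ht1 hε

theorem Gain.sub {ε : ℝ} {Z Z' W : (Fin n → ℝ) → (Fin n → ℝ)} (h : Gain b ε Z) (h' : Gain b ε Z')
    (hZ : Continuous Z) (hZ' : Continuous Z')
    (hW : ∀ g, ContDiff ℝ ∞ g → ∀ x, Xop W g x = Xop Z g x - Xop Z' g x) : Gain b ε W := by
  intro ψ hψ hψs
  obtain ⟨C, hC, hC'⟩ := h ψ hψ hψs
  obtain ⟨D, hD, hD'⟩ := h' ψ hψ hψs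
  refine ⟨2 * (C + D), by positivity, fun t ht ht1 f hf hfs => ?_⟩
  have hg := contDiff_moll hψ hψs hf hfs ht.ne'
  have hg1 : ContDiff ℝ 1 (moll ψ t f) := hg.of_le (by simp)
  have hgs := hasCompactSupport_moll hψs hfs t
  have h1 : CCFun (Xop Z (moll ψ t f)) := CCFun.xop hZ hg1 hgs
  have h2 : CCFun (fun x => (-1) * Xop Z' (moll ψ t f) x) :=
    ⟨continuous_const.mul (continuous_Xop hZ' hg1), (hasCompactSupport_Xop Z' hgs).mul_left⟩
  have h3 := sqInt_add_le h1 h2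
  rw [sqInt_const_mul] at h3
  have e : Xop W (moll ψ t f) = fun x => Xop Z (moll ψ t f) x + (-1) * Xop Z' (moll ψ t f) x := by
    ext x; rw [hW _ hg]; ring
  rw [← e] at h3
  have := hC' t ht ht1 f hf hfs
  have := hD' t ht ht1 f hf hfs
  have := mul_le_mul_of_nonneg_left h3 (sq_nonneg t)
  linarith

/-- A gain for `Z` controls second order operators `V Z` applied to mollifications. -/
theorem Gain.second {ε : ℝ} (hε : ε ≤ 2) {V Z : (Fin n → ℝ) → (Fin n → ℝ)} (hV : CVField V)
    (hZ : CVField Z) (h : Gain b ε Z) {ψ : (Fin n → ℝ) → ℝ} (hψ : ContDiff ℝ ∞ ψ)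
    (hψs : HasCompactSupport ψ) :
    ∃ C, 0 ≤ C ∧ ∀ t, 0 < t → t ≤ 1 → ∀ f, ContDiff ℝ 1 f → HasCompactSupport f →
      t ^ 4 * sqInt (Xop V (Xop Z (moll ψ t f))) ≤ C * (t ^ ε * energy b f) := by
  obtain ⟨M, hM⟩ := hV.2.exists_bound_of_continuous hV.1.continuous
  have hD : ∀ j : Fin n, ∃ C, 0 ≤ C ∧ ∀ t, 0 < t → t ≤ 1 → ∀ f, ContDiff ℝ 1 f →
      HasCompactSupport f → t ^ 4 * sqInt (Xop (fun _ => Pi.single j 1) (Xop Z (moll ψ t f))) ≤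
        C * (t ^ ε * energy b f) := by
    intro j
    set v : Fin n → ℝ := Pi.single j 1
    have hψv := contDiff_fderiv_apply_infty hψ v
    have hψvs := hψs.fderiv_apply (𝕜 := ℝ) v
    obtain ⟨C, hC, hC'⟩ := h _ hψv hψvs
    have hbr : CVField (vfBracket Z fun _ => v) := hZ.bracket contDiff_const
    obtain ⟨D, hD, hD'⟩ := exists_sq_mul_sqInt_Xop_moll_le hbr hψ hψs
    refine ⟨2 * (C + D), by positivity, fun t ht ht1 f hf hfs => ?_⟩
    have hg := contDiff_moll hψ hψs hf hfs ht.ne'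
    have hg1 : ContDiff ℝ 1 (moll ψ t f) := hg.of_le (by simp)
    have hgs := hasCompactSupport_moll hψs hfs t
    have hg' : ContDiff ℝ 1 (moll (fun y => fderiv ℝ ψ y v) t f) :=
      (contDiff_moll hψv hψvs hf hfs ht.ne').of_le (by simp)
    have hgs' := hasCompactSupport_moll hψvs hfs t
    have e1 : Xop (fun _ => v) (Xop Z (moll ψ t f)) = fun x =>
        t⁻¹ * Xop Z (moll (fun y => fderiv ℝ ψ y v) t f) x +
          (-1) * Xop (vfBracket Z fun _ => v) (moll ψ t f) x := by
      ext x
      rw [Xop_vfBracket hZ.contDiff_one contDiff_const (hg.of_le two_le_infty),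
        Xop_single_moll hψ hψs hf hfs ht.ne']
      have : Xop Z (fun x => t⁻¹ * moll (fun y => fderiv ℝ ψ y v) t f x) x =
          t⁻¹ * Xop Z (moll (fun y => fderiv ℝ ψ y v) t f) x := by
        unfold Xop
        rw [fderiv_const_mul (hg'.differentiable one_ne_zero x)]
        rfl
      rw [this]; ring
    have h1 : CCFun (Xop Z (moll (fun y => fderiv ℝ ψ y v) t f)) :=
      CCFun.xop hZ.1.continuous hg' hgs'
    have h2 : CCFun (Xop (vfBracket Z fun _ => v) (moll ψ t f)) :=
      CCFun.xop hbr.1.continuous hg1 hgs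
    have h3 := sqInt_add_le (f := fun x => t⁻¹ * Xop Z (moll (fun y => fderiv ℝ ψ y v) t f) x)
      (g := fun x => (-1) * Xop (vfBracket Z fun _ => v) (moll ψ t f) x)
      ⟨continuous_const.mul h1.1, h1.2.mul_left⟩ ⟨continuous_const.mul h2.1, h2.2.mul_left⟩
    rw [← e1, sqInt_const_mul, sqInt_const_mul] at h3
    have h4 := hC' t ht ht1 f hf hfs
    have h5 := hD' t ht f hf hfs
    have hE := energy_nonneg b f
    have h6 : t ^ 2 * sqInt f ≤ t ^ ε * energy b f := by
      rw [← Real.rpow_natCast]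
      refine mul_le_mul (Real.rpow_le_rpow_of_exponent_ge ht ht1 (by simpa using hε))
        (sqInt_le_energy b f) (sqInt_nonneg f) (by positivity)
    have h7 : t ^ 4 * sqInt (Xop (fun _ => v) (Xop Z (moll ψ t f))) ≤
        2 * (t ^ 2 * sqInt (Xop Z (moll (fun y => fderiv ℝ ψ y v) t f)) +
          t ^ 2 * (t ^ 2 * sqInt (Xop (vfBracket Z fun _ => v) (moll ψ t f)))) := by
      refine (mul_le_mul_of_nonneg_left h3 (by positivity)).trans (le_of_eq ?_)
      field_simp
    have h8 : t ^ 2 * (t ^ 2 * sqInt (Xop (vfBracket Z fun _ => v) (moll ψ t f))) ≤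
        D * (t ^ 2 * sqInt f) :=
      (mul_le_mul_of_nonneg_left h5 (by positivity)).trans (le_of_eq (by ring))
    have h9 := mul_le_mul_of_nonneg_left h6 hD
    linarith
  choose C hC hC' using hD
  refine ⟨n * M ^ 2 * ∑ j, C j, mul_nonneg (by positivity)
    (Finset.sum_nonneg fun j _ => hC j), fun t ht ht1 f hf hfs => ?_⟩
  have hg : ContDiff ℝ 1 (Xop Z (moll ψ t f)) :=
    contDiff_Xop hZ.contDiff_one (l := 2) ((contDiff_moll hψ hψs hf hfs ht.ne').of_le
      two_le_infty) (by norm_num)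
  have hgs := hasCompactSupport_Xop Z (hasCompactSupport_moll hψs hfs t)
  have h := sqInt_le_sum (CCFun.xop hV.1.continuous hg hgs)
    (fun j => CCFun.xop continuous_const hg hgs) (sq_Xop_le hM (Xop Z (moll ψ t f)))
  calc _ ≤ t ^ 4 * _ := mul_le_mul_of_nonneg_left h (by positivity)
    _ = (n * M ^ 2) * ∑ j : Fin n,
          t ^ 4 * sqInt (Xop (fun _ => Pi.single j 1) (Xop Z (moll ψ t f))) := by
        rw [← Finset.mul_sum]; ring
    _ ≤ (n * M ^ 2) * ∑ j, C j * (t ^ ε * energy b f) := by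
        refine mul_le_mul_of_nonneg_left (Finset.sum_le_sum fun j _ => hC' j t ht ht1 f hf hfs)
          (by positivity)
    _ = _ := by rw [← Finset.sum_mul]; ring

/-- Weighted Cauchy inequality for integrals. -/
theorem two_mul_integral_mul_le {A B : (Fin n → ℝ) → ℝ} (hA : CCFun A) (hB : CCFun B) {lam : ℝ}
    (hlam : 0 < lam) : 2 * ∫ x, A x * B x ≤ lam * sqInt A + lam⁻¹ * sqInt B := by
  unfold sqInt
  rw [← integral_const_mul, ← integral_const_mul, ← integral_const_mul,
    ← integral_add (hA.sq.const_mul _) (hB.sq.const_mul _)]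
  refine integral_mono ?_ ((hA.sq.const_mul _).add (hB.sq.const_mul _)) fun x => ?_
  · exact ((hA.1.mul hB.1).integrable_of_hasCompactSupport hA.2.mul_right).const_mul _
  · have h1 : lam * A x ^ 2 + lam⁻¹ * B x ^ 2 - 2 * (A x * B x) = lam⁻¹ * (lam * A x - B x) ^ 2 := by
      field_simp; ring
    have h2 : 0 ≤ lam⁻¹ * (lam * A x - B x) ^ 2 := by positivity
    change 2 * (A x * B x) ≤ lam * A x ^ 2 + lam⁻¹ * B x ^ 2
    linarith

/-- If `W Z` and `[Y, W]` are controlled, so is `Y W + a W`, with `Z`, `Y` in the two roles. -/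
theorem Gain.commuted {ε : ℝ} (hε : ε ≤ 2) {W Z : (Fin n → ℝ) → (Fin n → ℝ)} (hW : CVField W)
    (hZ : CVField Z) (h : Gain b ε Z) {ψ : (Fin n → ℝ) → ℝ} (hψ : ContDiff ℝ ∞ ψ)
    (hψs : HasCompactSupport ψ) :
    ∃ C, 0 ≤ C ∧ ∀ t, 0 < t → t ≤ 1 → ∀ f, ContDiff ℝ 1 f → HasCompactSupport f →
      t ^ 4 * sqInt (fun x => Xop Z (Xop W (moll ψ t f)) x + vfDiv Z x * Xop W (moll ψ t f) x) ≤
        C * (t ^ ε * energy b f) := by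
  have hdivs : HasCompactSupport (vfDiv Z) := by
    refine hZ.2.mono' fun x hx => ?_
    by_contra hxc
    apply hx
    have h0 : Z =ᶠ[𝓝 x] 0 := notMem_tsupport_iff_eventuallyEq.1 hxc
    refine Finset.sum_eq_zero fun j _ => ?_
    have h1 : (fun y => Z y j) =ᶠ[𝓝 x] fun _ => 0 := h0.mono fun y hy => by simp [hy]
    simp [h1.fderiv_eq]
  obtain ⟨M, hM⟩ := hdivs.exists_bound_of_continuous (continuous_vfDiv hZ.contDiff_one)
  obtain ⟨C1, hC1, hC1'⟩ := h.second hε hW hZ hψ hψs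
  have hbr := hZ.bracket hW.1
  obtain ⟨C2, hC2, hC2'⟩ := exists_sq_mul_sqInt_Xop_moll_le hbr hψ hψs
  obtain ⟨C3, hC3, hC3'⟩ := exists_sq_mul_sqInt_Xop_moll_le hW hψ hψs
  refine ⟨3 * (1 + M ^ 2) * (C1 + C2 + C3), by positivity, fun t ht ht1 f hf hfs => ?_⟩
  have hg := contDiff_moll hψ hψs hf hfs ht.ne'
  have hg2 : ContDiff ℝ 2 (moll ψ t f) := hg.of_le two_le_infty
  have hg1 : ContDiff ℝ 1 (moll ψ t f) := hg.of_le (by simp)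
  have hgs := hasCompactSupport_moll hψs hfs t
  set g := moll ψ t f with hgdef
  have k1 : CCFun (Xop W (Xop Z g)) := CCFun.xop hW.1.continuous
    (contDiff_Xop hZ.contDiff_one hg2 (by norm_num)) (hasCompactSupport_Xop _ hgs)
  have k2 : CCFun (Xop (vfBracket Z W) g) := CCFun.xop hbr.1.continuous hg1 hgs
  have k3 : CCFun (Xop W g) := CCFun.xop hW.1.continuous hg1 hgs
  have k0 : CCFun (Xop Z (Xop W g)) := CCFun.xop hZ.1.continuous
    (contDiff_Xop hW.contDiff_one hg2 (by norm_num)) (hasCompactSupport_Xop _ hgs)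
  have hdc := continuous_vfDiv hZ.contDiff_one
  have key := sqInt_le_sum (ι := Fin 3)
    (F := fun x => Xop Z (Xop W g) x + vfDiv Z x * Xop W g x)
    (G := ![Xop W (Xop Z g), Xop (vfBracket Z W) g, Xop W g]) (A := 3 * (1 + M ^ 2))
    ⟨k0.1.add (hdc.mul k3.1), k0.2.add k3.2.mul_left⟩
    (by intro i; fin_cases i <;> simp [k1, k2, k3]) ?_
  · simp only [Fin.sum_univ_three, Matrix.cons_val_zero, Matrix.cons_val_one,
      Matrix.cons_val_two, Matrix.head_cons, Matrix.tail_cons] at key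
    have h4 := hC1' t ht ht1 f hf hfs
    have h5 := hC2' t ht f hf hfs
    have h6 := hC3' t ht f hf hfs
    rw [← hgdef] at h4 h5 h6
    have h7 : t ^ 2 * sqInt f ≤ t ^ ε * energy b f := by
      rw [← Real.rpow_natCast]
      refine mul_le_mul (Real.rpow_le_rpow_of_exponent_ge ht ht1 (by simpa using hε))
        (sqInt_le_energy b f) (sqInt_nonneg f) (by positivity)
    have h8 := mul_le_mul_of_nonneg_left h5 (sq_nonneg t)
    have h9 := mul_le_mul_of_nonneg_left h6 (sq_nonneg t)
    have h10 := mul_le_mul_of_nonneg_left h7 hC2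
    have h11 := mul_le_mul_of_nonneg_left h7 hC3
    refine (mul_le_mul_of_nonneg_left key (by positivity)).trans ?_
    calc _ = 3 * (1 + M ^ 2) * (t ^ 4 * sqInt (Xop W (Xop Z g)) +
          t ^ 2 * (t ^ 2 * sqInt (Xop (vfBracket Z W) g)) +
          t ^ 2 * (t ^ 2 * sqInt (Xop W g))) := by ring
      _ ≤ 3 * (1 + M ^ 2) * ((C1 + C2 + C3) * (t ^ ε * energy b f)) := by
          refine mul_le_mul_of_nonneg_left ?_ (by positivity)
          linarith
      _ = _ := by ring
  · intro x
    simp only [Fin.sum_univ_three, Matrix.cons_val_zero, Matrix.cons_val_one,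
      Matrix.cons_val_two, Matrix.head_cons, Matrix.tail_cons]
    rw [show Xop Z (Xop W g) x = Xop W (Xop Z g) x + Xop (vfBracket Z W) g x by
      rw [Xop_vfBracket hZ.contDiff_one hW.contDiff_one hg2]; ring]
    set p := Xop W (Xop Z g) x
    set q := Xop (vfBracket Z W) g x
    set s := Xop W g x
    have hd : vfDiv Z x ^ 2 ≤ M ^ 2 := by
      have := hM x
      rw [Real.norm_eq_abs] at this
      exact sq_le_sq' (by linarith [neg_abs_le (vfDiv Z x)]) ((le_abs_self _).trans this)
    have e1 : (p + q + vfDiv Z x * s) ^ 2 ≤ 3 * (p ^ 2 + q ^ 2 + (vfDiv Z x * s) ^ 2) := by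
      nlinarith [sq_nonneg (p - q), sq_nonneg (p - vfDiv Z x * s), sq_nonneg (q - vfDiv Z x * s)]
    have e2 : (vfDiv Z x * s) ^ 2 ≤ M ^ 2 * s ^ 2 := by
      rw [mul_pow]; exact mul_le_mul_of_nonneg_right hd (sq_nonneg s)
    nlinarith [sq_nonneg s, mul_nonneg (sq_nonneg M) (sq_nonneg p),
      mul_nonneg (sq_nonneg M) (sq_nonneg q)]

theorem Gain.bracket {ε : ℝ} (hε : ε ≤ 2) {X Z : (Fin n → ℝ) → (Fin n → ℝ)}
    (hX : CVField X) (hZ : CVField Z)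
    (h1 : ∀ ψ : (Fin n → ℝ) → ℝ, ContDiff ℝ ∞ ψ → HasCompactSupport ψ →
      ∃ C, 0 ≤ C ∧ ∀ t, 0 < t → t ≤ 1 → ∀ f, ContDiff ℝ 1 f → HasCompactSupport f →
        sqInt (Xop X (moll ψ t f)) ≤ C * energy b f)
    (h : Gain b ε Z) : Gain b (ε / 2) (vfBracket X Z) := by
  intro ψ hψ hψs
  have hX2 : Gain b 2 X := by
    intro ψ hψ hψs
    obtain ⟨C, hC, hC'⟩ := h1 ψ hψ hψs
    refine ⟨C, hC, fun t ht ht1 f hf hfs => ?_⟩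
    have := mul_le_mul_of_nonneg_left (hC' t ht ht1 f hf hfs) (sq_nonneg t)
    rw [show ((2 : ℝ)) = ((2 : ℕ) : ℝ) by norm_num, Real.rpow_natCast]
    linarith
  have hW := hX.bracket hZ.1
  obtain ⟨C1, hC1, hC1'⟩ := h1 ψ hψ hψs
  obtain ⟨C2, hC2, hC2'⟩ := h ψ hψ hψs
  obtain ⟨C3, hC3, hC3'⟩ := Gain.commuted le_rfl hW hX hX2 hψ hψs
  obtain ⟨C4, hC4, hC4'⟩ := Gain.commuted hε hW hZ h hψ hψs
  refine ⟨C1 + C2 + C3 + C4, by positivity, fun t ht ht1 f hf hfs => ?_⟩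
  have hg := contDiff_moll hψ hψs hf hfs ht.ne'
  have hg2 : ContDiff ℝ 2 (moll ψ t f) := hg.of_le two_le_infty
  have hg1 : ContDiff ℝ 1 (moll ψ t f) := hg.of_le (by simp)
  have hgs := hasCompactSupport_moll hψs hfs t
  have b1 := hC1' t ht ht1 f hf hfs
  have b2 := hC2' t ht ht1 f hf hfs
  have b3 := hC3' t ht ht1 f hf hfs
  have b4 := hC4' t ht ht1 f hf hfs
  set g := moll ψ t f with hgdef
  have kX1 : ContDiff ℝ 1 (Xop X g) := contDiff_Xop hX.contDiff_one hg2 (by norm_num)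
  have kZ1 : ContDiff ℝ 1 (Xop Z g) := contDiff_Xop hZ.contDiff_one hg2 (by norm_num)
  have kW1 : ContDiff ℝ 1 (Xop (vfBracket X Z) g) :=
    contDiff_Xop hW.contDiff_one hg2 (by norm_num)
  have kWs := hasCompactSupport_Xop (vfBracket X Z) hgs
  have kX : CCFun (Xop X g) := ⟨kX1.continuous, hasCompactSupport_Xop _ hgs⟩
  have kZ : CCFun (Xop Z g) := ⟨kZ1.continuous, hasCompactSupport_Xop _ hgs⟩
  have kA : ∀ {Y : (Fin n → ℝ) → (Fin n → ℝ)}, CVField Y → CCFun fun x =>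
      Xop Y (Xop (vfBracket X Z) g) x + vfDiv Y x * Xop (vfBracket X Z) g x := fun hY =>
    ⟨(continuous_Xop hY.1.continuous kW1).add ((continuous_vfDiv hY.contDiff_one).mul
      kW1.continuous), (hasCompactSupport_Xop _ kWs).add kWs.mul_left⟩
  have i1 := integral_mul_Xop hX.contDiff_one kW1 kZ1 kWs
  have i2 := integral_mul_Xop hZ.contDiff_one kW1 kX1 kWs
  have e : sqInt (Xop (vfBracket X Z) g) =
      (∫ x, Xop (vfBracket X Z) g x * Xop X (Xop Z g) x) -
        ∫ x, Xop (vfBracket X Z) g x * Xop Z (Xop X g) x := by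
    rw [← integral_sub]
    · unfold sqInt
      congr 1; ext x
      rw [← mul_sub, ← Xop_vfBracket hX.contDiff_one hZ.contDiff_one hg2, pow_two]
    · exact (kW1.continuous.mul (continuous_Xop hX.1.continuous kZ1)).integrable_of_hasCompactSupport
        kWs.mul_right
    · exact (kW1.continuous.mul (continuous_Xop hZ.1.continuous kX1)).integrable_of_hasCompactSupport
        kWs.mul_right
  have hsp : ∀ x y : ℝ, t ^ (x + y) = t ^ x * t ^ y := fun x y => Real.rpow_add ht x y
  set τ := t ^ (ε / 2) with hτ
  have hτ0 : 0 < τ := Real.rpow_pos_of_pos ht _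
  have hτ2 : t ^ ε = τ * τ := by rw [hτ, ← hsp]; congr 1; ring
  have ht2 : t ^ (2 : ℝ) = t ^ 2 := by
    rw [show ((2 : ℝ)) = ((2 : ℕ) : ℝ) by norm_num, Real.rpow_natCast]
  have j1 := two_mul_integral_mul_le (kA hX)
    (B := fun x => (-1) * Xop Z g x) ⟨continuous_const.mul kZ.1, kZ.2.mul_left⟩ hτ0
  have j2 := two_mul_integral_mul_le (kA hZ) kX (lam := t ^ 2 / τ) (by positivity)
  rw [sqInt_const_mul] at j1
  have e1 : ∫ x, (Xop X (Xop (vfBracket X Z) g) x + vfDiv X x * Xop (vfBracket X Z) g x) *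
      ((-1) * Xop Z g x) =
      - ∫ x, (Xop X (Xop (vfBracket X Z) g) x + vfDiv X x * Xop (vfBracket X Z) g x) * Xop Z g x := by
    rw [← integral_neg]; congr 1; ext x; ring
  rw [e1, ← i1] at j1
  rw [e]
  rw [ht2] at b3
  rw [hτ2] at b2 b4
  have hE := energy_nonneg b f
  set SA := sqInt fun x => Xop X (Xop (vfBracket X Z) g) x + vfDiv X x * Xop (vfBracket X Z) g x
  set SB := sqInt fun x => Xop Z (Xop (vfBracket X Z) g) x + vfDiv Z x * Xop (vfBracket X Z) g x
  have hi2 : -∫ x, Xop (vfBracket X Z) g x * Xop Z (Xop X g) x =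
      ∫ x, (Xop Z (Xop (vfBracket X Z) g) x + vfDiv Z x * Xop (vfBracket X Z) g x) * Xop X g x := by
    rw [i2, neg_neg]
  have c3 : t ^ 2 * (τ * SA) ≤ τ * (C3 * energy b f) := by
    have : t ^ 2 * (t ^ 2 * SA) ≤ t ^ 2 * (C3 * energy b f) := by linarith
    have := le_of_mul_le_mul_left this (by positivity)
    nlinarith
  have c2 : t ^ 2 * (τ⁻¹ * sqInt (Xop Z g)) ≤ τ * (C2 * energy b f) := by
    have := mul_le_mul_of_nonneg_left b2 (inv_nonneg.2 hτ0.le)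
    calc _ = τ⁻¹ * (t ^ 2 * sqInt (Xop Z g)) := by ring
      _ ≤ _ := this
      _ = _ := by field_simp
  have c4 : t ^ 2 * (t ^ 2 / τ * SB) ≤ τ * (C4 * energy b f) := by
    have := mul_le_mul_of_nonneg_left b4 (inv_nonneg.2 hτ0.le)
    calc _ = τ⁻¹ * (t ^ 4 * SB) := by field_simp
      _ ≤ _ := this
      _ = _ := by field_simp
  have c1 : t ^ 2 * ((t ^ 2 / τ)⁻¹ * sqInt (Xop X g)) ≤ τ * (C1 * energy b f) := by
    have := mul_le_mul_of_nonneg_left b1 hτ0.le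
    calc _ = τ * sqInt (Xop X g) := by field_simp
      _ ≤ _ := this
  rw [← hi2] at j2
  have ht0 : 0 ≤ t ^ 2 := by positivity
  have j1' := mul_le_mul_of_nonneg_left j1 ht0
  have j2' := mul_le_mul_of_nonneg_left j2 ht0
  have hfin : 0 ≤ (C1 + C2 + C3 + C4) * (τ * energy b f) := by positivity
  nlinarith

theorem exists_gain_of_lieGen (hb : ∀ i, CVField (b i)) {c : (Fin n → ℝ) → (Fin n → ℝ)}
    (hc : LieGen b c) : CVField c ∧ (∃ ε, 0 < ε ∧ ε ≤ 2 ∧ Gain b ε c) ∧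
      ∀ Z, CVField Z → (∃ ε, 0 < ε ∧ ε ≤ 2 ∧ Gain b ε Z) →
        ∃ ε, 0 < ε ∧ ε ≤ 2 ∧ Gain b ε (vfBracket c Z) := by
  induction hc with
  | base i =>
    have h1 : ∀ ψ : (Fin n → ℝ) → ℝ, ContDiff ℝ ∞ ψ → HasCompactSupport ψ →
        ∃ C, 0 ≤ C ∧ ∀ t, 0 < t → t ≤ 1 → ∀ f, ContDiff ℝ 1 f → HasCompactSupport f →
          sqInt (Xop (b i) (moll ψ t f)) ≤ C * energy b f := by
      intro ψ hψ hψs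
      obtain ⟨C, hC, hC'⟩ := exists_sqInt_Xop_moll_le (hb i) hψ hψs
      refine ⟨C * 2, by positivity, fun t ht _ f hf hfs => (hC' t ht f hf hfs).trans ?_⟩
      have := sqInt_le_energy b f
      have := sqInt_Xop_le_energy b f i
      nlinarith
    refine ⟨hb i, ⟨2, by norm_num, le_rfl, ?_⟩, ?_⟩
    · intro ψ hψ hψs
      obtain ⟨C, hC, hC'⟩ := h1 ψ hψ hψs
      refine ⟨C, hC, fun t ht ht1 f hf hfs => ?_⟩
      have := mul_le_mul_of_nonneg_left (hC' t ht ht1 f hf hfs) (sq_nonneg t)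
      rw [show ((2 : ℝ)) = ((2 : ℕ) : ℝ) by norm_num, Real.rpow_natCast]
      linarith
    · rintro Z hZ ⟨ε, hε0, hε, hg⟩
      exact ⟨ε / 2, by positivity, by linarith, hg.bracket hε (hb i) hZ h1⟩
  | bracket _ _ ihc ihd =>
    rename_i c d _ _
    obtain ⟨hc, -, hRc⟩ := ihc
    obtain ⟨hd, hGd, hRd⟩ := ihd
    refine ⟨hc.bracket hd.1, hRc d hd hGd, fun Z hZ hGZ => ?_⟩
    have hdZ := hd.bracket hZ.1
    have hcZ := hc.bracket hZ.1
    obtain ⟨ε1, h10, h12, hG1⟩ := hRc _ hdZ (hRd Z hZ hGZ)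
    obtain ⟨ε2, h20, h22, hG2⟩ := hRd _ hcZ (hRc Z hZ hGZ)
    refine ⟨min ε1 ε2, lt_min h10 h20, (min_le_left _ _).trans h12,
      Gain.sub (hG1.mono (min_le_left _ _)) (hG2.mono (min_le_right _ _))
        (hc.bracket hdZ.1).1.continuous (hd.bracket hcZ.1).1.continuous fun g hg x => ?_⟩
    have hg2 : ContDiff ℝ 2 g := hg.of_le two_le_infty
    have hX : ∀ {Y : (Fin n → ℝ) → (Fin n → ℝ)}, CVField Y → ContDiff ℝ 2 (Xop Y g) := fun hY =>
      (contDiff_Xop hY.1 hg (by simp)).of_le two_le_infty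
    have hsub : ∀ {u v : (Fin n → ℝ) → ℝ} {Y : (Fin n → ℝ) → (Fin n → ℝ)}, ContDiff ℝ 1 u →
        ContDiff ℝ 1 v → Xop Y (fun y => u y - v y) x = Xop Y u x - Xop Y v x := by
      intro u v Y hu hv
      unfold Xop
      rw [fderiv_fun_sub (hu.differentiable one_ne_zero x) (hv.differentiable one_ne_zero x)]
      rfl
    have hXX : ∀ {Y Y' : (Fin n → ℝ) → (Fin n → ℝ)}, CVField Y → CVField Y' →
        ContDiff ℝ 1 (Xop Y (Xop Y' g)) := fun hY hY' =>
      contDiff_Xop hY.contDiff_one (hX hY') (by norm_num)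
    have hfun : ∀ {Y Y' : (Fin n → ℝ) → (Fin n → ℝ)}, CVField Y → CVField Y' →
        Xop (vfBracket Y Y') g = fun y => Xop Y (Xop Y' g) y - Xop Y' (Xop Y g) y := fun hY hY' =>
      funext fun y => Xop_vfBracket hY.contDiff_one hY'.contDiff_one hg2 y
    have hcd := hc.bracket hd.1
    change Xop (vfBracket (vfBracket c d) Z) g x = _
    rw [hfun hcd hZ, hfun hc hdZ, hfun hd hcZ]
    beta_reduce
    rw [hfun hc hd, hfun hd hZ, hfun hc hZ, hsub (hXX hc hd) (hXX hd hc),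
      hsub (hXX hd hZ) (hXX hZ hd), hsub (hXX hc hZ) (hXX hZ hc),
      Xop_vfBracket hc.contDiff_one hd.contDiff_one (hX hZ),
      Xop_vfBracket hd.contDiff_one hZ.contDiff_one (hX hc),
      Xop_vfBracket hc.contDiff_one hZ.contDiff_one (hX hd)]
    ring

end SubellipticBracket

section Spanning

open scoped ContDiff

variable {n m : ℕ} {b : Fin m → (Fin n → ℝ) → (Fin n → ℝ)}

/-- A quantitative form of the spanning condition on a compact set. -/
theorem exists_sum_sq_le_of_span {P : ((Fin n → ℝ) → (Fin n → ℝ)) → Prop}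
    (hP : ∀ c, P c → Continuous c) {K : Set (Fin n → ℝ)} (hK : IsCompact K)
    (hspan : ∀ x ∈ K, Submodule.span ℝ {v : Fin n → ℝ | ∃ c, P c ∧ c x = v} = ⊤) :
    ∃ (l : ℕ) (c : Fin l → (Fin n → ℝ) → (Fin n → ℝ)) (C : ℝ), (∀ i, P (c i)) ∧ 0 ≤ C ∧
      ∀ x ∈ K, ∀ p : Fin n → ℝ, ∑ j, p j ^ 2 ≤ C * ∑ i, (∑ j, c i x j * p j) ^ 2 := by
  have hS : IsCompact (K ×ˢ Metric.sphere (0 : Fin n → ℝ) 1) := hK.prod (isCompact_sphere _ _)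
  have hex : ∀ z : (Fin n → ℝ) × (Fin n → ℝ), z ∈ K ×ˢ Metric.sphere (0 : Fin n → ℝ) 1 →
      ∃ c, P c ∧ ∑ j, c z.1 j * z.2 j ≠ 0 := by
    rintro ⟨x, p⟩ ⟨hx, hp⟩
    by_contra! hcon
    have hle : Submodule.span ℝ {v : Fin n → ℝ | ∃ c, P c ∧ c x = v} ≤
        LinearMap.ker (∑ j, p j • LinearMap.proj (R := ℝ) (φ := fun _ : Fin n => ℝ) j) := by
      rw [Submodule.span_le]
      rintro v ⟨c, hc, rfl⟩
      have := hcon c hc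
      simp only [SetLike.mem_coe, LinearMap.mem_ker, LinearMap.sum_apply, LinearMap.smul_apply,
        LinearMap.proj_apply, smul_eq_mul]
      rw [← this]
      exact Finset.sum_congr rfl fun j _ => mul_comm _ _
    rw [hspan x hx] at hle
    have hp0 : p = 0 := by
      ext j
      have := hle (Submodule.mem_top (x := Pi.single j (1 : ℝ)))
      simpa [Pi.single_apply] using this
    simp [hp0] at hp
  choose! c hcP hc0 using hex
  obtain ⟨T, hTsub, hT⟩ := hS.elim_nhds_subcover
    (fun z => {w | ∑ j, c z w.1 j * w.2 j ≠ 0}) fun z hz => by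
      have h1 := hP _ (hcP z hz)
      have : Continuous fun w : (Fin n → ℝ) × (Fin n → ℝ) => ∑ j, c z w.1 j * w.2 j := by fun_prop
      exact (this.isOpen_preimage _ isOpen_ne).mem_nhds (hc0 z hz)
  set F : (Fin n → ℝ) × (Fin n → ℝ) → ℝ := fun w => ∑ z ∈ T, (∑ j, c z w.1 j * w.2 j) ^ 2
  have hF : Continuous F := by
    refine continuous_finsetSum _ fun z hz => ?_
    have h1 := hP _ (hcP z (hTsub z hz))
    fun_prop
  obtain ⟨δ, hδ, hδF⟩ := hS.exists_forall_le' (f := F) hF.continuousOn (a := 0) (by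
    intro w hw
    obtain ⟨z, hz, hzw⟩ := Set.mem_iUnion₂.1 (hT hw)
    exact Finset.sum_pos' (fun _ _ => sq_nonneg _) ⟨z, hz, by
      have : ∑ j, c z w.1 j * w.2 j ≠ 0 := hzw
      positivity⟩)
  refine ⟨T.card, fun i => c (T.equivFin.symm i), n / δ, fun i => hcP _ (hTsub _ (Subtype.mem _)),
    by positivity, fun x hx p => ?_⟩
  have hsum : ∑ i, (∑ j, c (T.equivFin.symm i) x j * p j) ^ 2 = F (x, p) := by
    rw [Equiv.sum_comp T.equivFin.symm (fun z : T => (∑ j, c z x j * p j) ^ 2)]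
    exact Finset.sum_coe_sort T fun z => (∑ j, c z x j * p j) ^ 2
  rw [hsum]
  have hle : ∑ j, p j ^ 2 ≤ n * ‖p‖ ^ 2 := by
    calc ∑ j, p j ^ 2 ≤ ∑ _j : Fin n, ‖p‖ ^ 2 := Finset.sum_le_sum fun j _ => by
          rw [← sq_abs]
          exact pow_le_pow_left₀ (abs_nonneg _) (norm_le_pi_norm p j) 2
      _ = n * ‖p‖ ^ 2 := by simp
  refine hle.trans ?_
  by_cases hp : p = 0
  · simp only [hp, norm_zero]
    have : 0 ≤ F (x, 0) := Finset.sum_nonneg fun _ _ => sq_nonneg _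
    have : 0 ≤ n / δ * F (x, 0) := by positivity
    simpa using this
  have hn : 0 < ‖p‖ := norm_pos_iff.2 hp
  have h1 := hδF (x, ‖p‖⁻¹ • p) ⟨hx, by simp [norm_smul, hn.ne']⟩
  have h2 : F (x, ‖p‖⁻¹ • p) = (‖p‖⁻¹) ^ 2 * F (x, p) := by
    simp only [F, Finset.mul_sum]
    refine Finset.sum_congr rfl fun z _ => ?_
    rw [← mul_pow, Finset.mul_sum]
    congr 1
    refine Finset.sum_congr rfl fun j _ => ?_
    simp; ring
  rw [h2] at h1
  have h3 : δ * ‖p‖ ^ 2 ≤ F (x, p) := by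
    have := mul_le_mul_of_nonneg_right h1 (sq_nonneg ‖p‖)
    calc _ ≤ _ := this
      _ = _ := by field_simp
  calc _ = n / δ * (δ * ‖p‖ ^ 2) := by field_simp
    _ ≤ _ := mul_le_mul_of_nonneg_left h3 (by positivity)

theorem exists_gradient_gain (hb : ∀ i, CVField (b i)) {K : Set (Fin n → ℝ)} (hK : IsCompact K)
    (hspan : Hormander K b) : ∃ ε : ℝ, 0 < ε ∧ ∀ ψ : (Fin n → ℝ) → ℝ, ContDiff ℝ ∞ ψ →
      HasCompactSupport ψ → ∃ C, 0 ≤ C ∧ ∀ t, 0 < t → t ≤ 1 → ∀ f, ContDiff ℝ 1 f →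
        HasCompactSupport f → (∀ x ∉ K, fderiv ℝ (moll ψ t f) x = 0) →
        t ^ 2 * ∑ j, sqInt (fun x => fderiv ℝ (moll ψ t f) x (Pi.single j 1)) ≤
          C * (t ^ ε * energy b f) := by
  obtain ⟨l, c, C0, hc, hC0, hle⟩ := exists_sum_sq_le_of_span (P := LieGen b)
    (fun c hc => (exists_gain_of_lieGen hb hc).1.1.continuous) hK hspan
  choose ε hε0 hε2 hG using fun i => (exists_gain_of_lieGen hb (hc i)).2.1
  obtain ⟨ε0, hε00, hε0le⟩ : ∃ ε0, 0 < ε0 ∧ ∀ i, ε0 ≤ ε i := by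
    by_cases hl : Nonempty (Fin l)
    · obtain ⟨i, hi⟩ := Finite.exists_min ε
      exact ⟨ε i, hε0 i, hi⟩
    · exact ⟨1, one_pos, fun i => (hl ⟨i⟩).elim⟩
  refine ⟨ε0, hε00, fun ψ hψ hψs => ?_⟩
  choose C hC hC' using fun i => (hG i).mono (hε0le i) ψ hψ hψs
  refine ⟨C0 * ∑ i, C i, mul_nonneg hC0 (Finset.sum_nonneg fun i _ => hC i),
    fun t ht ht1 f hf hfs hzero => ?_⟩
  have hg1 : ContDiff ℝ 1 (moll ψ t f) := (contDiff_moll hψ hψs hf hfs ht.ne').of_le (by simp)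
  have hgs := hasCompactSupport_moll hψs hfs t
  have k1 : ∀ j : Fin n, CCFun (fun x => fderiv ℝ (moll ψ t f) x (Pi.single j 1)) := fun j =>
    CCFun.xop (c := fun _ => Pi.single j 1) continuous_const hg1 hgs
  have k2 : ∀ i, CCFun (Xop (c i) (moll ψ t f)) := fun i =>
    CCFun.xop (exists_gain_of_lieGen hb (hc i)).1.1.continuous hg1 hgs
  have h1 : ∑ j, sqInt (fun x => fderiv ℝ (moll ψ t f) x (Pi.single j 1)) ≤
      C0 * ∑ i, sqInt (Xop (c i) (moll ψ t f)) := by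
    unfold sqInt
    rw [← integral_finsetSum _ fun j _ => (k1 j).sq, ← integral_finsetSum _ fun j _ => (k2 j).sq,
      ← integral_const_mul]
    refine integral_mono (integrable_finsetSum _ fun j _ => (k1 j).sq)
      ((integrable_finsetSum _ fun j _ => (k2 j).sq).const_mul _) fun x => ?_
    by_cases hx : x ∈ K
    · simp_rw [Xop_eq_sum]
      exact hle x hx fun j => fderiv ℝ (moll ψ t f) x (Pi.single j 1)
    · simp [hzero x hx, Xop]
  calc _ ≤ t ^ 2 * _ := mul_le_mul_of_nonneg_left h1 (by positivity)
    _ = C0 * ∑ i, t ^ 2 * sqInt (Xop (c i) (moll ψ t f)) := by rw [← Finset.mul_sum]; ring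
    _ ≤ C0 * ∑ i, C i * (t ^ ε0 * energy b f) :=
        mul_le_mul_of_nonneg_left (Finset.sum_le_sum fun i _ => hC' i t ht ht1 f hf hfs) hC0
    _ = _ := by rw [← Finset.sum_mul]; ring

theorem exists_moll_eq_zero {ψ : (Fin n → ℝ) → ℝ} (hψs : HasCompactSupport ψ)
    {K K' : Set (Fin n → ℝ)} (hK : IsCompact K) (hKK : K ⊆ interior K') :
    ∃ t0, 0 < t0 ∧ t0 ≤ 1 ∧ ∀ t, 0 ≤ t → t ≤ t0 → ∀ φ : (Fin n → ℝ) → ℝ,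
      Function.support φ ⊆ tsupport ψ →
      ∀ f : (Fin n → ℝ) → ℝ, tsupport f ⊆ K → ∀ x ∉ K', moll φ t f x = 0 := by
  obtain ⟨δ, hδ, hδK⟩ := hK.exists_thickening_subset_open isOpen_interior hKK
  obtain ⟨R, hR⟩ := hψs.isCompact.isBounded.exists_norm_le
  refine ⟨min 1 (δ / (2 * (|R| + 1))), by positivity, min_le_left _ _,
    fun t ht0 ht φ hφ f hf x hx => ?_⟩
  refine integral_eq_zero_of_ae (Eventually.of_forall fun y => ?_)
  by_cases hy : y ∈ tsupport ψ
  · have : x - t • y ∉ tsupport f := by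
      intro h
      refine hx (interior_subset (hδK (Metric.mem_thickening_iff.2 ⟨_, hf h, ?_⟩)))
      rw [dist_eq_norm, sub_sub_cancel, norm_smul, Real.norm_of_nonneg ht0]
      have h1 : ‖y‖ ≤ |R| + 1 := (hR y hy).trans ((le_abs_self R).trans (by linarith))
      calc t * ‖y‖ ≤ (δ / (2 * (|R| + 1))) * (|R| + 1) :=
            mul_le_mul (ht.trans (min_le_right _ _)) h1 (norm_nonneg _) (by positivity)
        _ = δ / 2 := by field_simp
        _ < δ := by linarith
    simp [image_eq_zero_of_notMem_tsupport this]
  · have : φ y = 0 := by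
      by_contra h
      exact hy (hφ h)
    simp [this]

end Spanning

section Sobolev

open scoped ContDiff

variable {n m : ℕ} {b : Fin m → (Fin n → ℝ) → (Fin n → ℝ)}

/-- Minkowski-type bound for a function written as an integral over a parameter. -/
theorem sqInt_le_of_eq_integral {H : ℝ → (Fin n → ℝ) → ℝ} (hHc : Continuous (Function.uncurry H))
    {K : Set (Fin n → ℝ)} (hK : IsCompact K) {τ A : ℝ} (hτ0 : 0 < τ)
    (hH0 : ∀ s, 0 < s → s ≤ τ → ∀ x ∉ K, H s x = 0)
    (hA : ∀ s, 0 < s → s ≤ τ → ∫ x, H s x ^ 2 ≤ A) {F : (Fin n → ℝ) → ℝ} (hF : CCFun F)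
    (hFH : ∀ x, F x = -∫ s in Set.Ioc 0 τ, H s x) : sqInt F ≤ τ ^ 2 * A := by
  set μ := (volume : Measure ℝ).restrict (Set.Ioc 0 τ) with hμ
  have hCS : ∀ x, F x ^ 2 ≤ τ * ∫ s, H s x ^ 2 ∂μ := by
    intro x
    have hcx : Continuous fun s => H s x := hHc.comp (Continuous.prodMk_left x)
    rw [hFH, neg_sq]
    have hi : ∀ g : ℝ → ℝ, Continuous g → Integrable g μ := fun g hg =>
      (hg.integrableOn_Icc (a := 0) (b := τ)).mono_set Set.Ioc_subset_Icc_self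
    have := sq_integral_mul_le (μ := μ) (A := fun _ => (1 : ℝ)) (B := fun s => H s x)
      (hi _ (continuous_const.pow 2)) (hi _ (hcx.pow 2)) (hi _ (continuous_const.mul hcx))
    simpa [hμ, hτ0.le] using this
  have hprod : Integrable (Function.uncurry fun x s => H s x ^ 2) (volume.prod μ) := by
    have h1 : IntegrableOn (Function.uncurry fun (x : Fin n → ℝ) (s : ℝ) => H s x ^ 2)
        (K ×ˢ Set.Icc 0 τ) (volume.prod volume) := by
      refine ContinuousOn.integrableOn_compact (hK.prod isCompact_Icc) ?_
      exact ((hHc.comp continuous_swap).pow 2).continuousOn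
    have h2 : IntegrableOn (Function.uncurry fun (x : Fin n → ℝ) (s : ℝ) => H s x ^ 2)
        (Set.univ ×ˢ Set.Ioc 0 τ) (volume.prod volume) := by
      refine h1.of_forall_sdiff_eq_zero (MeasurableSet.univ.prod measurableSet_Ioc) ?_
      rintro ⟨x, s⟩ ⟨⟨-, hs⟩, hn⟩
      have hx : x ∉ K := fun hx => hn ⟨hx, Set.Ioc_subset_Icc_self hs⟩
      simp [Function.uncurry, hH0 s hs.1 hs.2 x hx]
    rw [IntegrableOn, ← Measure.prod_restrict, Measure.restrict_univ] at h2
    exact h2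
  calc sqInt F ≤ ∫ x, τ * ∫ s, H s x ^ 2 ∂μ :=
        integral_mono hF.sq (hprod.integral_prod_left.const_mul τ) hCS
    _ = τ * ∫ s, (∫ x, H s x ^ 2) ∂μ := by
        rw [integral_const_mul, integral_integral_swap hprod]
    _ ≤ τ * ∫ _s, A ∂μ := by
        refine mul_le_mul_of_nonneg_left ?_ hτ0.le
        refine integral_mono_ae hprod.integral_prod_right (integrable_const _) ?_
        refine (ae_restrict_iff' measurableSet_Ioc).2 (Eventually.of_forall fun s hs => ?_)
        exact hA s hs.1 hs.2
    _ = _ := by simp [hμ, hτ0.le]; ring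

set_option maxHeartbeats 1000000 in
theorem exists_approximation (hb : ∀ i, CVField (b i)) {K K' : Set (Fin n → ℝ)}
    (hK : IsCompact K) (hK' : IsCompact K') (hKK : K ⊆ interior K') (hspan : Hormander K' b)
    {ψ : (Fin n → ℝ) → ℝ} (hψ : ContDiff ℝ ∞ ψ) (hψs : HasCompactSupport ψ)
    (hψ1 : ∫ y, ψ y = 1) :
    ∃ (N : ℕ) (C τ0 : ℝ), 0 ≤ C ∧ 0 < τ0 ∧ τ0 ≤ 1 ∧ ∀ τ, 0 < τ → τ ≤ τ0 →
      ∀ f, ContDiff ℝ 1 f → tsupport f ⊆ K →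
        sqInt (fun x => f x - moll ψ (τ ^ N) f x) ≤ C * τ ^ 2 * energy b f := by
  obtain ⟨ε, hε, hgain⟩ := exists_gradient_gain hb hK' hspan
  obtain ⟨t0, ht00, ht01, hzero⟩ := exists_moll_eq_zero hψs hK hKK
  obtain ⟨N, hN⟩ := exists_nat_gt (2 / ε)
  have hNε : 2 ≤ N * ε := by
    have := (div_lt_iff₀ hε).1 hN
    linarith
  have hN0 : N ≠ 0 := by
    rintro rfl
    simp at hN
    linarith [div_pos two_pos hε]
  set φ : Fin n → (Fin n → ℝ) → ℝ := fun j y => y j * ψ y with hφ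
  have hφc : ∀ j, ContDiff ℝ ∞ (φ j) := fun j => (contDiff_apply ℝ ℝ j).mul hψ
  have hφs : ∀ j, HasCompactSupport (φ j) := fun j => hψs.mul_left
  have hφsub : ∀ j, Function.support (φ j) ⊆ tsupport ψ := fun j x hx =>
    subset_tsupport _ fun h => hx (by simp [hφ, h])
  choose C hC hC' using fun j => hgain (φ j) (hφc j) (hφs j)
  refine ⟨N, N ^ 2 * (n * ∑ j, C j), t0,
    mul_nonneg (by positivity) (mul_nonneg (by positivity) (Finset.sum_nonneg fun j _ => hC j)),
    ht00, ht01, fun τ hτ0 hτ f hf hfK => ?_⟩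
  have hfs : HasCompactSupport f := hK.of_isClosed_subset (isClosed_tsupport f) hfK
  set Df : Fin n → (Fin n → ℝ) → ℝ := fun j z => fderiv ℝ f z (Pi.single j 1) with hDf
  have hDfc : ∀ j, Continuous (Df j) := fun j =>
    (hf.continuous_fderiv one_ne_zero).clm_apply continuous_const
  have hDfK : ∀ v, tsupport (fun z => fderiv ℝ f z v) ⊆ K := fun v =>
    (tsupport_Xop_subset (fun _ => v) f).trans hfK
  have hDfs : ∀ j, HasCompactSupport (Df j) := fun j => hfs.fderiv_apply (𝕜 := ℝ) _
  set G : ℝ × (Fin n → ℝ) → ℝ := fun p => ∑ j, moll (φ j) p.1 (Df j) p.2 with hG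
  have hGc : Continuous G := continuous_finsetSum _ fun j _ =>
    continuous_moll (hφc j).continuous (hφs j) (hDfc j)
  set H : ℝ → (Fin n → ℝ) → ℝ := fun s x => -(G (s ^ N, x) * (N * s ^ (N - 1))) with hH
  have hHc : Continuous (Function.uncurry H) := by
    unfold Function.uncurry
    fun_prop
  have hder : ∀ x s, HasDerivAt (fun s => moll ψ (s ^ N) f x) (H s x) s := by
    intro x s
    have h1 := (hasDerivAt_moll hψ.continuous hψs hf hfs (s ^ N) x).comp s (hasDerivAt_pow N s)
    refine h1.congr_deriv ?_
    simp [hH, hG, hφ, hDf]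
  have hpow : ∀ s, 0 ≤ s → s ≤ τ → s ^ N ≤ t0 := fun s h0 h1 =>
    (pow_le_of_le_one h0 (h1.trans (hτ.trans ht01)) hN0).trans (h1.trans hτ)
  have hH0 : ∀ s, 0 ≤ s → s ≤ τ → ∀ x ∉ K', H s x = 0 := by
    intro s h0 h1 x hx
    have : G (s ^ N, x) = 0 := Finset.sum_eq_zero fun j _ =>
      hzero _ (pow_nonneg h0 N) (hpow s h0 h1) _ (hφsub j) _ (hDfK _) x hx
    simp [hH, this]
  have hHint : ∀ s, 0 < s → s ≤ τ →
      ∫ x, H s x ^ 2 ≤ N ^ 2 * (n * ∑ j, C j) * energy b f := by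
    intro s h0 h1
    have hs1 : s ≤ 1 := h1.trans (hτ.trans ht01)
    set t := s ^ N with ht
    have ht0 : 0 < t := pow_pos h0 N
    have e1 : ∀ j x, moll (φ j) t (Df j) x = fderiv ℝ (moll (φ j) t f) x (Pi.single j 1) :=
      fun j x => (fderiv_moll (hφc j).continuous (hφs j) hf hfs t x _).symm
    have k1 : ∀ j, CCFun (moll (φ j) t (Df j)) := fun j =>
      CCFun.moll ⟨(hφc j).continuous, hφs j⟩ ⟨hDfc j, hDfs j⟩ t
    have k0 : CCFun fun x => G (t, x) := by
      refine ⟨hGc.comp (Continuous.prodMk_right t), ?_⟩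
      refine HasCompactSupport.intro hK' fun x hx => Finset.sum_eq_zero fun j _ =>
        hzero _ ht0.le (hpow s h0.le h1) _ (hφsub j) _ (hDfK _) x hx
    have h2 : sqInt (fun x => G (t, x)) ≤ n * ∑ j, sqInt (moll (φ j) t (Df j)) :=
      sqInt_le_sum k0 k1 fun x => by
        have := sq_sum_le_card_mul_sum_sq (s := (Finset.univ : Finset (Fin n)))
          (f := fun j => moll (φ j) t (Df j) x)
        simpa using this
    have h3 : ∀ j, t ^ 2 * sqInt (moll (φ j) t (Df j)) ≤ C j * (t ^ ε * energy b f) := by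
      intro j
      have hz : ∀ x ∉ K', fderiv ℝ (moll (φ j) t f) x = 0 := by
        intro x hx
        ext v
        rw [fderiv_moll (hφc j).continuous (hφs j) hf hfs t x v]
        exact hzero _ ht0.le (hpow s h0.le h1) _ (hφsub j) _ (hDfK _) x hx
      refine le_trans ?_ (hC' j t ht0 ((hpow s h0.le h1).trans ht01) f hf hfs hz)
      refine mul_le_mul_of_nonneg_left ?_ (by positivity)
      have : moll (φ j) t (Df j) = fun x => fderiv ℝ (moll (φ j) t f) x (Pi.single j 1) :=
        funext (e1 j)
      rw [this]
      exact Finset.single_le_sum (f := fun i => sqInt fun x =>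
        fderiv ℝ (moll (φ j) t f) x (Pi.single i 1)) (fun _ _ => sqInt_nonneg _)
        (Finset.mem_univ j)
    have h4 : t ^ 2 * sqInt (fun x => G (t, x)) ≤ n * ∑ j, C j * (t ^ ε * energy b f) := by
      calc _ ≤ t ^ 2 * (n * ∑ j, sqInt (moll (φ j) t (Df j))) :=
            mul_le_mul_of_nonneg_left h2 (by positivity)
        _ = n * ∑ j, t ^ 2 * sqInt (moll (φ j) t (Df j)) := by rw [← Finset.mul_sum]; ring
        _ ≤ _ := mul_le_mul_of_nonneg_left (Finset.sum_le_sum fun j _ => h3 j) (by positivity)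
    have h5 : t ^ ε ≤ s ^ 2 := by
      rw [ht, ← Real.rpow_natCast s N, ← Real.rpow_mul h0.le, ← Real.rpow_natCast s 2]
      exact Real.rpow_le_rpow_of_exponent_ge h0 hs1 (by exact_mod_cast hNε)
    have hE := energy_nonneg b f
    have h6 : ∫ x, H s x ^ 2 = (N * s ^ (N - 1)) ^ 2 * sqInt (fun x => G (t, x)) := by
      unfold sqInt
      rw [← integral_const_mul]
      congr 1; ext x; simp only [hH]; ring
    have h7 : s * s ^ (N - 1) = t := by
      rw [ht, ← pow_succ', Nat.sub_add_cancel (Nat.one_le_iff_ne_zero.2 hN0)]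
    have h8 : s ^ 2 * ∫ x, H s x ^ 2 ≤ s ^ 2 * (N ^ 2 * (n * ∑ j, C j) * energy b f) := by
      rw [h6]
      calc _ = N ^ 2 * ((s * s ^ (N - 1)) ^ 2 * sqInt (fun x => G (t, x))) := by ring
        _ ≤ N ^ 2 * (n * ∑ j, C j * (t ^ ε * energy b f)) := by
            rw [h7]; exact mul_le_mul_of_nonneg_left h4 (by positivity)
        _ = N ^ 2 * (n * ∑ j, C j) * (t ^ ε * energy b f) := by rw [← Finset.sum_mul]; ring
        _ ≤ N ^ 2 * (n * ∑ j, C j) * (s ^ 2 * energy b f) := by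
            refine mul_le_mul_of_nonneg_left (mul_le_mul_of_nonneg_right h5 hE) ?_
            exact mul_nonneg (by positivity) (mul_nonneg (by positivity)
              (Finset.sum_nonneg fun j _ => hC j))
        _ = _ := by ring
    exact le_of_mul_le_mul_left h8 (by positivity)
  have hFTC : ∀ x, f x - moll ψ (τ ^ N) f x = -∫ s in Set.Ioc 0 τ, H s x := by
    intro x
    have hcx : Continuous fun s => H s x := hHc.comp (Continuous.prodMk_left x)
    have := intervalIntegral.integral_eq_sub_of_hasDerivAt (a := 0) (b := τ)
      (fun s _ => hder x s) (hcx.intervalIntegrable _ _)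
    rw [intervalIntegral.integral_of_le hτ0.le, zero_pow hN0, moll_zero hψ1] at this
    rw [this]; ring
  have hfm : CCFun fun x => f x - moll ψ (τ ^ N) f x := by
    have := CCFun.moll ⟨hψ.continuous, hψs⟩ ⟨hf.continuous, hfs⟩ (τ ^ N)
    exact ⟨hf.continuous.sub this.1, hfs.sub this.2⟩
  calc _ ≤ τ ^ 2 * (N ^ 2 * (n * ∑ j, C j) * energy b f) :=
        sqInt_le_of_eq_integral hHc hK' hτ0 (fun s h0 h1 => hH0 s h0.le h1) hHint hfm hFTC
    _ = _ := by ring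

end Sobolev

section SobolevInequality

open scoped ContDiff

variable {n m : ℕ} {b : Fin m → (Fin n → ℝ) → (Fin n → ℝ)}

theorem abs_rpow_le_sum_of_dyadic {d : ℕ} (hd : 1 ≤ d) {L : ℝ} (hL : 0 < L) {v : ℝ} {g : ℕ → ℝ}
    (hg : ∀ i, |g i| ≤ L / 2 * (2 ^ d) ^ i) {I : ℕ} (hI : |v| < L * (2 ^ d) ^ I) :
    |v| ^ (2 + 1 / (d : ℝ)) ≤
      L ^ (1 / (d : ℝ)) * (v ^ 2 + ∑ i ∈ Finset.range I, 2 ^ (i + 3) * (v - g i) ^ 2) := by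
  have hd0 : (0 : ℝ) < d := by exact_mod_cast hd
  have hs : |v| ^ (2 + 1 / (d : ℝ)) = v ^ 2 * |v| ^ (1 / (d : ℝ)) := by
    rw [Real.rpow_add_of_nonneg (abs_nonneg v) (by norm_num) (by positivity)]
    rw [show ((2 : ℝ)) = ((2 : ℕ) : ℝ) by norm_num, Real.rpow_natCast, sq_abs]
  have hnn : ∀ i ∈ Finset.range I, 0 ≤ (2 : ℝ) ^ (i + 3) * (v - g i) ^ 2 :=
    fun i _ => by positivity
  rw [hs]
  rcases le_total |v| L with h | h
  · have h1 : |v| ^ (1 / (d : ℝ)) ≤ L ^ (1 / (d : ℝ)) :=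
      Real.rpow_le_rpow (abs_nonneg v) h (by positivity)
    have h2 := Finset.sum_nonneg hnn
    have h3 : 0 ≤ L ^ (1 / (d : ℝ)) := by positivity
    nlinarith [mul_le_mul_of_nonneg_left h1 (sq_nonneg v), mul_nonneg h3 h2]
  · have h2d : (1 : ℝ) < 2 ^ d := one_lt_pow₀ (by norm_num) (by omega)
    obtain ⟨i, hi1, hi2⟩ := exists_nat_pow_near ((one_le_div hL).2 h) h2d
    rw [le_div_iff₀ hL] at hi1
    rw [div_lt_iff₀ hL] at hi2
    have hiI : i < I := by
      have : ((2 : ℝ) ^ d) ^ i < (2 ^ d) ^ I := by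
        refine lt_of_mul_lt_mul_right ?_ hL.le
        linarith
      exact (pow_lt_pow_iff_right₀ h2d).1 this
    have h1 : |v| ≤ 2 * |v - g i| := by
      have := abs_sub_abs_le_abs_sub v (g i)
      have := hg i
      linarith
    have h2 : v ^ 2 ≤ 4 * (v - g i) ^ 2 := by
      rw [← sq_abs v, ← sq_abs (v - g i)]
      nlinarith [abs_nonneg v]
    have h3 : |v| ^ (1 / (d : ℝ)) ≤ L ^ (1 / (d : ℝ)) * 2 ^ (i + 1) := by
      calc |v| ^ (1 / (d : ℝ)) ≤ ((2 ^ d) ^ (i + 1) * L) ^ (1 / (d : ℝ)) :=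
            Real.rpow_le_rpow (abs_nonneg v) hi2.le (by positivity)
        _ = L ^ (1 / (d : ℝ)) * 2 ^ (i + 1) := by
            rw [Real.mul_rpow (by positivity) hL.le, mul_comm, ← pow_mul, mul_comm d, pow_mul]
            rw [one_div, Real.pow_rpow_inv_natCast (by positivity) (by omega)]
    have h4 := Finset.single_le_sum hnn (Finset.mem_range.2 hiI)
    calc v ^ 2 * |v| ^ (1 / (d : ℝ))
        ≤ (4 * (v - g i) ^ 2) * (L ^ (1 / (d : ℝ)) * 2 ^ (i + 1)) :=
          mul_le_mul h2 h3 (by positivity) (by positivity)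
      _ = L ^ (1 / (d : ℝ)) * (2 ^ (i + 3) * (v - g i) ^ 2) := by ring
      _ ≤ _ := mul_le_mul_of_nonneg_left (by nlinarith [sq_nonneg v]) (by positivity)

theorem exists_sobolev (hb : ∀ i, CVField (b i)) {K K' : Set (Fin n → ℝ)}
    (hK : IsCompact K) (hK' : IsCompact K') (hKK : K ⊆ interior K') (hspan : Hormander K' b) :
    ∃ κ > (1 : ℝ), ∃ C ≥ (0 : ℝ), ∀ f, ContDiff ℝ 1 f → tsupport f ⊆ K →
      ∫ x, |f x| ^ (2 * κ) ≤ C * energy b f ^ κ := by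
  let φ : ContDiffBump (0 : Fin n → ℝ) := ⟨1, 2, one_pos, one_lt_two⟩
  set ψ : (Fin n → ℝ) → ℝ := φ.normed volume with hψd
  have hψ : ContDiff ℝ ∞ ψ := φ.contDiff_normed
  have hψs : HasCompactSupport ψ := φ.hasCompactSupport_normed
  have hψ1 : ∫ y, ψ y = 1 := φ.integral_normed
  obtain ⟨N, C, τ0, hC, hτ0, hτ1, happ⟩ := exists_approximation hb hK hK' hKK hspan hψ hψs hψ1
  obtain ⟨d, hd1, hdN⟩ : ∃ d : ℕ, 1 ≤ d ∧ N * n ≤ 2 * d := ⟨N * n + 1, by omega, by omega⟩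
  have hd0 : (0 : ℝ) < d := by exact_mod_cast hd1
  set M := (sqInt ψ + 1) / τ0 ^ (N * n) with hM
  have hM0 : 0 < M := div_pos (by linarith [sqInt_nonneg ψ]) (by positivity)
  refine ⟨1 + 1 / (2 * d), by simp only [gt_iff_lt, lt_add_iff_pos_right]; positivity,
    (4 * M) ^ (1 / (2 * d : ℝ)) * (1 + 16 * C), by positivity, fun f hf hfK => ?_⟩
  have hfs : HasCompactSupport f := hK.of_isClosed_subset (isClosed_tsupport f) hfK
  have hfc : CCFun f := ⟨hf.continuous, hfs⟩
  set E := energy b f with hE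
  have hκ : (2 : ℝ) * (1 + 1 / (2 * d)) = 2 + 1 / d := by field_simp
  rw [hκ]
  rcases (energy_nonneg b f).eq_or_lt with h0 | hE0
  · have h1 : sqInt f = 0 :=
      le_antisymm ((sqInt_le_energy b f).trans h0.ge) (sqInt_nonneg f)
    have h2 := (integral_eq_zero_iff_of_nonneg (fun x => sq_nonneg (f x)) hfc.sq).1 h1
    rw [integral_eq_zero_of_ae]
    · rw [hE, ← h0]
      positivity
    · filter_upwards [h2] with x hx
      have : f x = 0 := by simpa using hx
      have h3 : (2 + 1 / (d : ℝ)) ≠ 0 := by positivity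
      simp only [this, abs_zero, Pi.zero_apply]
      exact Real.zero_rpow h3
  · rw [← hE] at hE0
    set L := 2 * √(M * E) with hL
    have hL0 : 0 < L := by positivity
    set g : ℕ → (Fin n → ℝ) → ℝ := fun i => moll ψ ((τ0 / 2 ^ i) ^ N) f with hg
    have hgb : ∀ x i, |g i x| ≤ L / 2 * (2 ^ d) ^ i := by
      intro x i
      have h1 := sq_moll_le hψ.continuous hψs hf.continuous hfs
        (pow_pos (div_pos hτ0 (by positivity : (0 : ℝ) < 2 ^ i)) N) x
      have h2 : sqInt ψ * sqInt f ≤ (sqInt ψ + 1) * E :=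
        mul_le_mul (by linarith) (sqInt_le_energy b f) (sqInt_nonneg f)
          (by linarith [sqInt_nonneg ψ])
      have h3 : g i x ^ 2 ≤ M * E * (2 ^ i) ^ (N * n) := by
        rw [← pow_mul, div_pow] at h1
        rw [hM]
        have h4 := h1.trans h2
        rw [div_mul_eq_mul_div, div_le_iff₀ (by positivity)] at h4
        rw [div_mul_eq_mul_div, div_mul_eq_mul_div, le_div_iff₀ (by positivity)]
        linarith
      have h4 : g i x ^ 2 ≤ (L / 2 * (2 ^ d) ^ i) ^ 2 := by
        have h5 : (L / 2 * (2 ^ d) ^ i) ^ 2 = M * E * (2 ^ i) ^ (2 * d) := by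
          rw [mul_pow, hL, mul_div_cancel_left₀ _ two_ne_zero, Real.sq_sqrt (by positivity)]
          ring
        rw [h5]
        refine h3.trans (mul_le_mul_of_nonneg_left ?_ (by positivity))
        exact pow_le_pow_right₀ (one_le_pow₀ one_le_two) hdN
      exact abs_le_of_sq_le_sq h4 (by positivity)
    obtain ⟨B, hB⟩ := hfs.exists_bound_of_continuous hf.continuous
    obtain ⟨I, hI⟩ : ∃ I : ℕ, B < L * (2 ^ d) ^ I := by
      obtain ⟨I, hI⟩ := pow_unbounded_of_one_lt (B / L)
        (one_lt_pow₀ one_lt_two (by omega : d ≠ 0) : (1 : ℝ) < 2 ^ d)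
      exact ⟨I, by rwa [div_lt_iff₀' hL0] at hI⟩
    have hpt : ∀ x, |f x| ^ (2 + 1 / (d : ℝ)) ≤ L ^ (1 / (d : ℝ)) *
        (f x ^ 2 + ∑ i ∈ Finset.range I, 2 ^ (i + 3) * (f x - g i x) ^ 2) := fun x =>
      abs_rpow_le_sum_of_dyadic hd1 hL0 (hgb x) ((hB x).trans_lt hI)
    have hdc : ∀ i, CCFun fun x => f x - g i x := fun i => by
      have := CCFun.moll ⟨hψ.continuous, hψs⟩ hfc ((τ0 / 2 ^ i) ^ N)
      exact ⟨hf.continuous.sub this.1, hfs.sub this.2⟩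
    have hdi : ∀ i ∈ Finset.range I, Integrable fun x => (2 : ℝ) ^ (i + 3) * (f x - g i x) ^ 2 :=
      fun i _ => (hdc i).sq.const_mul _
    have hle : ∀ i, (2 : ℝ) ^ (i + 3) * sqInt (fun x => f x - g i x) ≤
        8 * C * E * (1 / 2) ^ i := by
      intro i
      have h1 := happ (τ0 / 2 ^ i) (by positivity)
        (div_le_self hτ0.le (one_le_pow₀ one_le_two)) f hf hfK
      have h2 : τ0 ^ 2 ≤ 1 := pow_le_one₀ hτ0.le hτ1
      calc (2 : ℝ) ^ (i + 3) * sqInt (fun x => f x - g i x)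
          ≤ 2 ^ (i + 3) * (C * (τ0 / 2 ^ i) ^ 2 * E) :=
            mul_le_mul_of_nonneg_left h1 (by positivity)
        _ = τ0 ^ 2 * (8 * C * E * (1 / 2) ^ i) := by
            rw [one_div, inv_pow]
            field_simp
            ring
        _ ≤ 1 * (8 * C * E * (1 / 2) ^ i) := mul_le_mul_of_nonneg_right h2 (by positivity)
        _ = _ := one_mul _
    have hgeo : ∑ i ∈ Finset.range I, (1 / 2 : ℝ) ^ i ≤ 2 := by
      have := Summable.sum_le_tsum (f := fun i : ℕ => (1 / 2 : ℝ) ^ i) (Finset.range I)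
        (fun i _ => by positivity) summable_geometric_two
      rwa [tsum_geometric_two] at this
    calc ∫ x, |f x| ^ (2 + 1 / (d : ℝ))
        ≤ ∫ x, L ^ (1 / (d : ℝ)) *
          (f x ^ 2 + ∑ i ∈ Finset.range I, 2 ^ (i + 3) * (f x - g i x) ^ 2) :=
          integral_mono_of_nonneg (Eventually.of_forall fun x => by positivity)
            ((hfc.sq.add (integrable_finsetSum _ hdi)).const_mul _) (Eventually.of_forall hpt)
      _ = L ^ (1 / (d : ℝ)) * (sqInt f +
          ∑ i ∈ Finset.range I, 2 ^ (i + 3) * sqInt (fun x => f x - g i x)) := by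
          rw [integral_const_mul, integral_add hfc.sq (integrable_finsetSum _ hdi),
            integral_finsetSum _ hdi]
          simp only [integral_const_mul, sqInt]
      _ ≤ L ^ (1 / (d : ℝ)) * (E + 8 * C * E * 2) := by
          refine mul_le_mul_of_nonneg_left (add_le_add (sqInt_le_energy b f) ?_) (by positivity)
          refine (Finset.sum_le_sum fun i _ => hle i).trans ?_
          rw [← Finset.mul_sum]
          exact mul_le_mul_of_nonneg_left hgeo (by positivity)
      _ = (4 * M) ^ (1 / (2 * d : ℝ)) * (1 + 16 * C) * E ^ (1 + 1 / (2 * d : ℝ)) := by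
          have h1 : L ^ (1 / (d : ℝ)) = (4 * M) ^ (1 / (2 * d : ℝ)) * E ^ (1 / (2 * d : ℝ)) := by
            rw [← Real.mul_rpow (by positivity) hE0.le]
            have h2 : L = (4 * M * E) ^ (1 / 2 : ℝ) := by
              rw [hL, ← Real.sqrt_eq_rpow, mul_assoc 4, show (4 : ℝ) = 2 ^ 2 by norm_num,
                Real.sqrt_mul (by norm_num) (M * E), Real.sqrt_sq (by norm_num)]
            rw [h2, ← Real.rpow_mul (by positivity)]
            congr 1
            field_simp
          rw [h1, Real.rpow_add hE0, Real.rpow_one]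
          ring

end SobolevInequality

section LocalBounds

open scoped ContDiff

variable {n m : ℕ} {b : Fin m → (Fin n → ℝ) → (Fin n → ℝ)}

theorem exists_cutoff {K U : Set (Fin n → ℝ)} (hK : IsCompact K) (hU : IsOpen U) (hKU : K ⊆ U) :
    ∃ η : (Fin n → ℝ) → ℝ, ContDiff ℝ ∞ η ∧ HasCompactSupport η ∧ tsupport η ⊆ U ∧
      (∀ᶠ x in 𝓝ˢ K, η x = 1) ∧ ∀ x, η x ∈ Set.Icc (0 : ℝ) 1 := by
  obtain ⟨L, hL, hKL, hLU⟩ := exists_compact_between hK hU hKU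
  obtain ⟨f, hf1, hf0, hf⟩ := exists_contMDiffMap_one_nhds_of_subset_interior
    (n := ⊤) (modelWithCornersSelf ℝ (Fin n → ℝ)) hK.isClosed hKL
  have hs : tsupport f ⊆ L := closure_minimal
    (fun x hx => by_contra fun hxL => hx (hf0 x hxL)) hL.isClosed
  exact ⟨f, contMDiff_iff_contDiff.1 f.contMDiff,
    hL.of_isClosed_subset (isClosed_tsupport _) hs, hs.trans hLU, hf1, hf⟩

/-- Local bounds for integrals of an expression in `u`, uniform over a class `P` of functions. -/
def LocBdd (P : ((Fin n → ℝ) → ℝ) → Prop) (U : Set (Fin n → ℝ))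
    (F : ((Fin n → ℝ) → ℝ) → (Fin n → ℝ) → ℝ) : Prop :=
  ∀ K, IsCompact K → K ⊆ U → ∃ C, ∀ u, P u → ∫ x in K, F u x ≤ C

variable {P : ((Fin n → ℝ) → ℝ) → Prop} {U : Set (Fin n → ℝ)}
  {F G : ((Fin n → ℝ) → ℝ) → (Fin n → ℝ) → ℝ}

theorem LocBdd.of_le (hG : LocBdd P U G) (hFc : ∀ u, P u → Continuous (F u))
    (hGc : ∀ u, P u → Continuous (G u)) {M : ℝ} (hM : 0 ≤ M)
    (h : ∀ u, P u → ∀ x ∈ U, F u x ≤ M * G u x) : LocBdd P U F := by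
  intro K hK hKU
  obtain ⟨C, hC⟩ := hG K hK hKU
  refine ⟨M * C, fun u hu => ?_⟩
  calc ∫ x in K, F u x ≤ ∫ x in K, M * G u x :=
        setIntegral_mono_on ((hFc u hu).continuousOn.integrableOn_compact hK)
          (((hGc u hu).const_mul M).continuousOn.integrableOn_compact hK) hK.measurableSet
          fun x hx => h u hu x (hKU hx)
    _ = M * ∫ x in K, G u x := integral_const_mul _ _
    _ ≤ M * C := mul_le_mul_of_nonneg_left (hC u hu) hM

theorem LocBdd.add (hF : LocBdd P U F) (hG : LocBdd P U G) (hFc : ∀ u, P u → Continuous (F u))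
    (hGc : ∀ u, P u → Continuous (G u)) : LocBdd P U fun u x => F u x + G u x := by
  intro K hK hKU
  obtain ⟨C, hC⟩ := hF K hK hKU
  obtain ⟨D, hD⟩ := hG K hK hKU
  refine ⟨C + D, fun u hu => ?_⟩
  rw [integral_add ((hFc u hu).continuousOn.integrableOn_compact hK)
    ((hGc u hu).continuousOn.integrableOn_compact hK)]
  exact add_le_add (hC u hu) (hD u hu)

theorem locBdd_const (c : ℝ) : LocBdd P U fun _ _ => c := fun K _ _ =>
  ⟨∫ _ in K, c, fun _ _ => le_rfl⟩

/-- Bounds obtained by testing against a cutoff function. -/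
theorem LocBdd.of_test (hU : IsOpen U) (hG : LocBdd P U G) (hFc : ∀ u, P u → Continuous (F u))
    (hF0 : ∀ u, P u → ∀ x ∈ U, 0 ≤ F u x) (hGc : ∀ u, P u → Continuous (G u))
    (h : ∀ η : (Fin n → ℝ) → ℝ, ContDiff ℝ ∞ η → HasCompactSupport η → tsupport η ⊆ U →
      (∀ x, η x ∈ Set.Icc (0 : ℝ) 1) → ∃ M, 0 ≤ M ∧ ∀ u, P u →
        ∃ Φ : (Fin n → ℝ) → ℝ, Continuous Φ ∧ (∀ x ∉ tsupport η, Φ x = 0) ∧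
          (∀ x ∈ U, Φ x ≤ M * G u x) ∧ ∫ x, η x * F u x ≤ ∫ x, Φ x) : LocBdd P U F := by
  intro K hK hKU
  obtain ⟨η, hη, hηs, hηU, hη1, hη01⟩ := exists_cutoff hK hU hKU
  obtain ⟨M, hM, hΦ⟩ := h η hη hηs hηU hη01
  obtain ⟨C, hC⟩ := hG (tsupport η) hηs.isCompact hηU
  refine ⟨M * C, fun u hu => ?_⟩
  obtain ⟨Φ, hΦc, hΦ0, hΦG, hint⟩ := hΦ u hu
  have hc : Continuous fun x => η x * F u x := hη.continuous.mul (hFc u hu)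
  have h0 : ∀ x, 0 ≤ η x * F u x := by
    intro x
    by_cases hx : x ∈ U
    · exact mul_nonneg (hη01 x).1 (hF0 u hu x hx)
    · rw [image_eq_zero_of_notMem_tsupport fun hx' => hx (hηU hx'), zero_mul]
  have hηK : ∀ x ∈ K, η x = 1 := fun x hx => hη1.self_of_nhdsSet x hx
  calc ∫ x in K, F u x = ∫ x in K, η x * F u x :=
        setIntegral_congr_fun hK.measurableSet fun x hx => by simp [hηK x hx]
    _ ≤ ∫ x, η x * F u x := setIntegral_le_integral
        (hc.integrable_of_hasCompactSupport hηs.mul_right) (Eventually.of_forall h0)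
    _ ≤ ∫ x, Φ x := hint
    _ = ∫ x in tsupport η, Φ x :=
        (setIntegral_eq_integral_of_forall_compl_eq_zero hΦ0).symm
    _ ≤ ∫ x in tsupport η, M * G u x :=
        setIntegral_mono_on (hΦc.continuousOn.integrableOn_compact hηs.isCompact)
          (((hGc u hu).const_mul M).continuousOn.integrableOn_compact hηs.isCompact)
          (isClosed_tsupport η).measurableSet fun x hx => hΦG x (hηU hx)
    _ = M * ∫ x in tsupport η, G u x := integral_const_mul _ _
    _ ≤ M * C := mul_le_mul_of_nonneg_left (hC u hu) hM

theorem exists_test_bound (hb : ∀ i, CVField (b i)) {η : (Fin n → ℝ) → ℝ} (hη : ContDiff ℝ ∞ η)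
    (hηs : HasCompactSupport η) :
    ∃ M, 0 ≤ M ∧ (∀ x, ∑ i, |Xop (b i) η x| ≤ M) ∧ (∀ x, ∑ i, Xop (b i) η x ^ 2 ≤ M) ∧
      ∀ x, ∑ i, |Xop (b i) (Xop (b i) η) x| ≤ M := by
  have hc : ∀ i, Continuous (Xop (b i) η) := fun i =>
    continuous_Xop (hb i).1.continuous (hη.of_le (by simp))
  have hc' : ∀ i, Continuous (Xop (b i) (Xop (b i) η)) := fun i =>
    continuous_Xop (hb i).1.continuous
      (contDiff_Xop (hb i).contDiff_one (hη.of_le two_le_infty) (by norm_num))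
  have hs : ∀ i x, x ∉ tsupport η → Xop (b i) η x = 0 := fun i x hx =>
    image_eq_zero_of_notMem_tsupport fun h => hx (tsupport_Xop_subset _ _ h)
  have hs' : ∀ i x, x ∉ tsupport η → Xop (b i) (Xop (b i) η) x = 0 := fun i x hx =>
    image_eq_zero_of_notMem_tsupport fun h =>
      hx (tsupport_Xop_subset _ _ (tsupport_Xop_subset _ _ h))
  have key : ∀ f : (Fin n → ℝ) → ℝ, Continuous f → (∀ x ∉ tsupport η, f x = 0) →
      ∃ M, 0 ≤ M ∧ ∀ x, f x ≤ M := by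
    intro f hf hf0
    obtain ⟨C, hC⟩ :=
      (HasCompactSupport.intro hηs.isCompact hf0).exists_bound_of_continuous hf
    exact ⟨|C|, abs_nonneg C, fun x => (le_abs_self _).trans ((hC x).trans (le_abs_self C))⟩
  obtain ⟨M1, h1, h1'⟩ := key (fun x => ∑ i, |Xop (b i) η x|)
    (continuous_finsetSum _ fun i _ => (hc i).abs)
    fun x hx => Finset.sum_eq_zero fun i _ => by simp [hs i x hx]
  obtain ⟨M2, h2, h2'⟩ := key (fun x => ∑ i, Xop (b i) η x ^ 2)
    (continuous_finsetSum _ fun i _ => (hc i).pow 2)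
    fun x hx => Finset.sum_eq_zero fun i _ => by simp [hs i x hx]
  obtain ⟨M3, h3, h3'⟩ := key (fun x => ∑ i, |Xop (b i) (Xop (b i) η) x|)
    (continuous_finsetSum _ fun i _ => (hc' i).abs)
    fun x hx => Finset.sum_eq_zero fun i _ => by simp [hs' i x hx]
  refine ⟨M1 + M2 + M3, by positivity, fun x => ?_, fun x => ?_, fun x => ?_⟩
  · linarith [h1' x]
  · linarith [h2' x]
  · linarith [h3' x]

theorem Xop_comp {c : (Fin n → ℝ) → (Fin n → ℝ)} {φ : ℝ → ℝ} {φ' : ℝ} {f : (Fin n → ℝ) → ℝ}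
    {x : Fin n → ℝ} (hφ : HasDerivAt φ φ' (f x)) (hf : DifferentiableAt ℝ f x) :
    Xop c (fun y => φ (f y)) x = φ' * Xop c f x := by
  unfold Xop
  have h := (hφ.comp_hasFDerivAt x hf.hasFDerivAt).fderiv
  rw [show (fun y => φ (f y)) = φ ∘ f from rfl, h]
  simp

theorem integral_mul_Xop_of_vfDiv_eq_zero {c : (Fin n → ℝ) → (Fin n → ℝ)} (hc : ContDiff ℝ 1 c)
    (hdiv : ∀ x ∈ U, vfDiv c x = 0) {f g : (Fin n → ℝ) → ℝ} (hf : ContDiff ℝ 1 f)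
    (hg : ContDiff ℝ 1 g) (hfs : HasCompactSupport f) (hfU : tsupport f ⊆ U) :
    ∫ x, f x * Xop c g x = -∫ x, Xop c f x * g x := by
  rw [integral_mul_Xop hc hf hg hfs]
  congr 1
  refine integral_congr_ae (Eventually.of_forall fun x => ?_)
  by_cases hx : x ∈ tsupport f
  · simp [hdiv x (hfU hx)]
  · simp [image_eq_zero_of_notMem_tsupport hx]

/-- Green's formula for divergence-free fields. -/
theorem integral_mul_sum_Xop (hb : ∀ i, CVField (b i)) (hdiv : ∀ i, ∀ x ∈ U, vfDiv (b i) x = 0)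
    {η : (Fin n → ℝ) → ℝ} (hη : ContDiff ℝ 1 η) (hηs : HasCompactSupport η)
    (hηU : tsupport η ⊆ U) {V : Fin m → (Fin n → ℝ) → ℝ} (hV : ∀ i, ContDiff ℝ 1 (V i)) :
    ∫ x, η x * ∑ i, Xop (b i) (V i) x = -∫ x, ∑ i, Xop (b i) η x * V i x := by
  simp_rw [Finset.mul_sum]
  rw [integral_finsetSum, integral_finsetSum, ← Finset.sum_neg_distrib]
  · exact Finset.sum_congr rfl fun i _ =>
      integral_mul_Xop_of_vfDiv_eq_zero (hb i).contDiff_one (hdiv i) hη (hV i) hηs hηU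
  · exact fun i _ => ((continuous_Xop (hb i).1.continuous hη).mul
      (hV i).continuous).integrable_of_hasCompactSupport (hasCompactSupport_Xop _ hηs).mul_right
  · exact fun i _ => (hη.continuous.mul
      (continuous_Xop (hb i).1.continuous (hV i))).integrable_of_hasCompactSupport hηs.mul_right

/-- The weight `(1 + v²)^(-(1 + γ)/2)`. -/
noncomputable def decay (γ v : ℝ) : ℝ := (1 + v ^ 2) ^ (-(1 + γ) / 2)

/-- The primitive of `decay γ` vanishing at the origin. -/
noncomputable def decayPrim (γ v : ℝ) : ℝ := ∫ t in (0 : ℝ)..v, decay γ t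

/-- The second primitive of `decay γ`. -/
noncomputable def decayPrimTwo (γ v : ℝ) : ℝ := ∫ t in (0 : ℝ)..v, decayPrim γ t

theorem decay_pos (γ v : ℝ) : 0 < decay γ v := by
  unfold decay; positivity

theorem decay_le_one {γ : ℝ} (hγ : 0 < γ) (v : ℝ) : decay γ v ≤ 1 :=
  Real.rpow_le_one_of_one_le_of_nonpos (by nlinarith [sq_nonneg v]) (by linarith)

theorem continuous_decay (γ : ℝ) : Continuous (decay γ) := by
  unfold decay
  exact (by fun_prop : Continuous fun v : ℝ => 1 + v ^ 2).rpow_const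
    fun v => Or.inl (by positivity)

theorem hasDerivAt_decayPrim (γ v : ℝ) : HasDerivAt (decayPrim γ) (decay γ v) v :=
  ((continuous_decay γ).integral_hasStrictDerivAt 0 v).hasDerivAt

theorem continuous_decayPrim (γ : ℝ) : Continuous (decayPrim γ) :=
  continuous_iff_continuousAt.2 fun v => (hasDerivAt_decayPrim γ v).continuousAt

theorem contDiff_decayPrim (γ : ℝ) : ContDiff ℝ 1 (decayPrim γ) := by
  rw [contDiff_one_iff_deriv]
  refine ⟨fun v => (hasDerivAt_decayPrim γ v).differentiableAt, ?_⟩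
  rw [show deriv (decayPrim γ) = decay γ from funext fun v => (hasDerivAt_decayPrim γ v).deriv]
  exact continuous_decay γ

theorem hasDerivAt_decayPrimTwo (γ v : ℝ) :
    HasDerivAt (decayPrimTwo γ) (decayPrim γ v) v :=
  ((continuous_decayPrim γ).integral_hasStrictDerivAt 0 v).hasDerivAt

theorem contDiff_decayPrimTwo (γ : ℝ) : ContDiff ℝ 1 (decayPrimTwo γ) := by
  rw [contDiff_one_iff_deriv]
  refine ⟨fun v => (hasDerivAt_decayPrimTwo γ v).differentiableAt, ?_⟩
  rw [show deriv (decayPrimTwo γ) = decayPrim γ from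
    funext fun v => (hasDerivAt_decayPrimTwo γ v).deriv]
  exact continuous_decayPrim γ

theorem exists_decayPrim_bound {γ : ℝ} (hγ : 0 < γ) :
    ∃ C, 0 ≤ C ∧ (∀ v, |decayPrim γ v| ≤ C) ∧ ∀ v, |decayPrimTwo γ v| ≤ C * |v| := by
  have hi : Integrable (decay γ) := by
    have := integrable_rpow_neg_one_add_norm_sq (E := ℝ) (μ := volume) (r := 1 + γ)
      (by simpa using hγ)
    simp only [Real.norm_eq_abs, sq_abs] at this
    exact this
  have h0 : 0 ≤ ∫ t, decay γ t := integral_nonneg fun t => (decay_pos γ t).le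
  have h1 : ∀ v, |decayPrim γ v| ≤ ∫ t, decay γ t := by
    intro v
    rw [decayPrim, intervalIntegral.abs_integral_eq_abs_integral_uIoc,
      abs_of_nonneg (integral_nonneg fun t => (decay_pos γ t).le)]
    exact setIntegral_le_integral hi (Eventually.of_forall fun t => (decay_pos γ t).le)
  refine ⟨∫ t, decay γ t, h0, h1, fun v => ?_⟩
  have := intervalIntegral.norm_integral_le_of_norm_le_const (a := 0) (b := v)
    (f := decayPrim γ) (C := ∫ t, decay γ t) fun t _ => h1 t
  simpa [decayPrimTwo] using this

end LocalBounds

section WeightedEstimates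

open scoped ContDiff

variable {n m : ℕ} {b : Fin m → (Fin n → ℝ) → (Fin n → ℝ)}

/-- The weight `1 + |Xu|²`. -/
noncomputable def wgt (b : Fin m → (Fin n → ℝ) → (Fin n → ℝ)) (u : (Fin n → ℝ) → ℝ)
    (x : Fin n → ℝ) : ℝ := 1 + ∑ i, Xop (b i) u x ^ 2

theorem one_le_wgt (b : Fin m → (Fin n → ℝ) → (Fin n → ℝ)) (u : (Fin n → ℝ) → ℝ)
    (x : Fin n → ℝ) : 1 ≤ wgt b u x :=
  le_add_of_nonneg_right (Finset.sum_nonneg fun _ _ => sq_nonneg _)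

theorem wgt_pos (b : Fin m → (Fin n → ℝ) → (Fin n → ℝ)) (u : (Fin n → ℝ) → ℝ)
    (x : Fin n → ℝ) : 0 < wgt b u x :=
  one_pos.trans_le (one_le_wgt b u x)

theorem sum_sq_Xop_le_wgt (b : Fin m → (Fin n → ℝ) → (Fin n → ℝ)) (u : (Fin n → ℝ) → ℝ)
    (x : Fin n → ℝ) : ∑ i, Xop (b i) u x ^ 2 ≤ wgt b u x :=
  le_add_of_nonneg_left zero_le_one

theorem abs_Xop_le_wgt (b : Fin m → (Fin n → ℝ) → (Fin n → ℝ)) (u : (Fin n → ℝ) → ℝ)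
    (i : Fin m) (x : Fin n → ℝ) : |Xop (b i) u x| ≤ wgt b u x ^ (1 / 2 : ℝ) := by
  rw [← Real.sqrt_eq_rpow]
  refine Real.abs_le_sqrt ((?_ : _ ≤ _).trans (sum_sq_Xop_le_wgt b u x))
  exact Finset.single_le_sum (f := fun i => Xop (b i) u x ^ 2) (fun _ _ => sq_nonneg _)
    (Finset.mem_univ i)

/-- Normalised `C²` functions satisfying the structural inequalities of `k`-convex functions. -/
structure StructClass (b : Fin m → (Fin n → ℝ) → (Fin n → ℝ)) (U : Set (Fin n → ℝ)) (c₀ : ℝ)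
    (u : (Fin n → ℝ) → ℝ) : Prop where
  contDiff : ContDiff ℝ 2 u
  integral_abs_le : ∀ K, IsCompact K → K ⊆ U → ∫ x in K, |u x| ≤ 1
  subLap_nonneg : ∀ x ∈ U, 0 ≤ subLap b u x
  quadForm_ge : ∀ x ∈ U, -c₀ * subLap b u x * ∑ i, Xop (b i) u x ^ 2 ≤
    ∑ i, ∑ j, Xop (b i) u x * Xop (b j) u x * Xop (b i) (Xop (b j) u) x

variable {U : Set (Fin n → ℝ)} {c₀ : ℝ} {u : (Fin n → ℝ) → ℝ}

theorem contDiff_one_Xop (hb : ∀ i, CVField (b i)) (hu : ContDiff ℝ 2 u) (i : Fin m) :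
    ContDiff ℝ 1 (Xop (b i) u) :=
  contDiff_Xop (hb i).contDiff_one hu (by norm_num)

theorem continuous_subLap (hb : ∀ i, CVField (b i)) (hu : ContDiff ℝ 2 u) :
    Continuous (subLap b u) :=
  continuous_finsetSum _ fun i _ =>
    continuous_Xop (hb i).1.continuous (contDiff_one_Xop hb hu i)

theorem contDiff_wgt (hb : ∀ i, CVField (b i)) (hu : ContDiff ℝ 2 u) : ContDiff ℝ 1 (wgt b u) :=
  contDiff_const.add (ContDiff.sum fun i _ => (contDiff_one_Xop hb hu i).pow 2)

theorem contDiff_wgt_rpow (hb : ∀ i, CVField (b i)) (hu : ContDiff ℝ 2 u) (s : ℝ) :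
    ContDiff ℝ 1 fun x => wgt b u x ^ s :=
  (contDiff_wgt hb hu).rpow_const_of_ne fun x => (wgt_pos b u x).ne'

theorem Xop_wgt (hb : ∀ i, CVField (b i)) (hu : ContDiff ℝ 2 u) (c : (Fin n → ℝ) → (Fin n → ℝ))
    (x : Fin n → ℝ) :
    Xop c (wgt b u) x = 2 * ∑ j, Xop (b j) u x * Xop c (Xop (b j) u) x := by
  have h : HasFDerivAt (wgt b u)
      (∑ j, (2 * Xop (b j) u x) • fderiv ℝ (Xop (b j) u) x) x := by
    refine HasFDerivAt.const_add 1 (HasFDerivAt.fun_sum fun j _ => ?_)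
    have := ((contDiff_one_Xop hb hu j).differentiable one_ne_zero x).hasFDerivAt.pow 2
    simpa using this
  unfold Xop at h ⊢
  rw [h.fderiv]
  simp [Finset.mul_sum, mul_assoc]

theorem sum_Xop_wgt_mul_ge (hb : ∀ i, CVField (b i)) (hu : StructClass b U c₀ u) {r s : ℝ}
    (hc₀ : 0 ≤ c₀) (hs0 : 0 ≤ s) (hsr : s ≤ r) {x : Fin n → ℝ} (hx : x ∈ U) :
    (1 - r * c₀) * (wgt b u x ^ (s / 2) * subLap b u x) ≤
      ∑ i, Xop (b i) (fun y => wgt b u y ^ (s / 2) * Xop (b i) u y) x := by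
  have hw := wgt_pos b u x
  have h1 : ∀ i, Xop (b i) (fun y => wgt b u y ^ (s / 2) * Xop (b i) u y) x =
      wgt b u x ^ (s / 2) * Xop (b i) (Xop (b i) u) x + s * wgt b u x ^ (s / 2 - 1) *
        ∑ j, Xop (b i) u x * Xop (b j) u x * Xop (b i) (Xop (b j) u) x := by
    intro i
    rw [Xop_mul ((contDiff_wgt_rpow hb hu.contDiff _).differentiable one_ne_zero x)
      ((contDiff_one_Xop hb hu.contDiff i).differentiable one_ne_zero x),
      Xop_comp (Real.hasDerivAt_rpow_const (Or.inl hw.ne'))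
        ((contDiff_wgt hb hu.contDiff).differentiable one_ne_zero x), Xop_wgt hb hu.contDiff]
    congr 1
    simp only [Finset.mul_sum]
    exact Finset.sum_congr rfl fun j _ => by ring
  simp_rw [h1]
  rw [Finset.sum_add_distrib, ← Finset.mul_sum, ← Finset.mul_sum]
  have hq := hu.quadForm_ge x hx
  have hL := hu.subLap_nonneg x hx
  have hp : wgt b u x ^ (s / 2) = wgt b u x ^ (s / 2 - 1) * wgt b u x := by
    rw [← Real.rpow_add_one hw.ne']; congr 1; ring
  have hp0 : 0 ≤ wgt b u x ^ (s / 2 - 1) := by positivity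
  have hle := sum_sq_Xop_le_wgt b u x
  have h2 : s * wgt b u x ^ (s / 2 - 1) *
      (-c₀ * subLap b u x * ∑ i, Xop (b i) u x ^ 2) ≤ s * wgt b u x ^ (s / 2 - 1) *
      ∑ i, ∑ j, Xop (b i) u x * Xop (b j) u x * Xop (b i) (Xop (b j) u) x :=
    mul_le_mul_of_nonneg_left hq (by positivity)
  have h3 : s * wgt b u x ^ (s / 2 - 1) * (c₀ * subLap b u x * ∑ i, Xop (b i) u x ^ 2) ≤
      r * wgt b u x ^ (s / 2 - 1) * (c₀ * subLap b u x * wgt b u x) := by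
    have h4 : 0 ≤ ∑ i, Xop (b i) u x ^ 2 := Finset.sum_nonneg fun _ _ => sq_nonneg _
    have h5 : 0 ≤ r := hs0.trans hsr
    gcongr
  have h6 : r * wgt b u x ^ (s / 2 - 1) * (c₀ * subLap b u x * wgt b u x) =
      r * c₀ * (wgt b u x ^ (s / 2) * subLap b u x) := by rw [hp]; ring
  change _ ≤ wgt b u x ^ (s / 2) * subLap b u x + _
  linarith

theorem abs_sum_Xop_mul_le (b : Fin m → (Fin n → ℝ) → (Fin n → ℝ)) {η : (Fin n → ℝ) → ℝ} {M : ℝ}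
    {x : Fin n → ℝ} (hM : ∑ i, |Xop (b i) η x| ≤ M) (u : (Fin n → ℝ) → ℝ) (s : ℝ) :
    |∑ i, Xop (b i) η x * (wgt b u x ^ (s / 2) * Xop (b i) u x)| ≤
      M * wgt b u x ^ ((s + 1) / 2) := by
  have hw := wgt_pos b u x
  have h : wgt b u x ^ ((s + 1) / 2) = wgt b u x ^ (s / 2) * wgt b u x ^ (1 / 2 : ℝ) := by
    rw [← Real.rpow_add hw]; congr 1; ring
  calc _ ≤ ∑ i, |Xop (b i) η x * (wgt b u x ^ (s / 2) * Xop (b i) u x)| :=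
        Finset.abs_sum_le_sum_abs _ _
    _ ≤ ∑ i, |Xop (b i) η x| * wgt b u x ^ ((s + 1) / 2) := by
        refine Finset.sum_le_sum fun i _ => ?_
        rw [abs_mul, abs_mul, h, abs_of_pos (Real.rpow_pos_of_pos hw _)]
        gcongr
        exact abs_Xop_le_wgt b u i x
    _ = (∑ i, |Xop (b i) η x|) * wgt b u x ^ ((s + 1) / 2) := (Finset.sum_mul _ _ _).symm
    _ ≤ _ := mul_le_mul_of_nonneg_right hM (by positivity)

theorem abs_subLap_le {η : (Fin n → ℝ) → ℝ} {M : ℝ} {x : Fin n → ℝ}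
    (hM : ∑ i, |Xop (b i) (Xop (b i) η) x| ≤ M) : |subLap b η x| ≤ M :=
  (Finset.abs_sum_le_sum_abs _ _).trans hM

theorem integral_sum_Xop_mul_Xop (hb : ∀ i, CVField (b i))
    (hdiv : ∀ i, ∀ x ∈ U, vfDiv (b i) x = 0) {η g : (Fin n → ℝ) → ℝ} (hη : ContDiff ℝ 2 η)
    (hηs : HasCompactSupport η) (hηU : tsupport η ⊆ U) (hg : ContDiff ℝ 1 g) :
    ∫ x, ∑ i, Xop (b i) η x * Xop (b i) g x = -∫ x, subLap b η x * g x := by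
  unfold subLap
  simp_rw [Finset.sum_mul]
  rw [integral_finsetSum, integral_finsetSum, ← Finset.sum_neg_distrib]
  · exact Finset.sum_congr rfl fun i _ =>
      integral_mul_Xop_of_vfDiv_eq_zero (hb i).contDiff_one (hdiv i) (contDiff_one_Xop hb hη i) hg
        (hasCompactSupport_Xop _ hηs) ((tsupport_Xop_subset _ _).trans hηU)
  · exact fun i _ => ((continuous_Xop (hb i).1.continuous (contDiff_one_Xop hb hη i)).mul
      hg.continuous).integrable_of_hasCompactSupport
        (hasCompactSupport_Xop _ (hasCompactSupport_Xop _ hηs)).mul_right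
  · exact fun i _ => ((contDiff_one_Xop hb hη i).continuous.mul
      (continuous_Xop (hb i).1.continuous hg)).integrable_of_hasCompactSupport
        (hasCompactSupport_Xop _ hηs).mul_right

theorem subLap_eq_zero_of_notMem {η : (Fin n → ℝ) → ℝ} {x : Fin n → ℝ} (hx : x ∉ tsupport η) :
    subLap b η x = 0 :=
  Finset.sum_eq_zero fun _ _ => image_eq_zero_of_notMem_tsupport fun h =>
    hx (tsupport_Xop_subset _ _ (tsupport_Xop_subset _ _ h))

theorem Xop_eq_zero_of_notMem (c : (Fin n → ℝ) → (Fin n → ℝ)) {η : (Fin n → ℝ) → ℝ}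
    {x : Fin n → ℝ} (hx : x ∉ tsupport η) : Xop c η x = 0 :=
  image_eq_zero_of_notMem_tsupport fun h => hx (tsupport_Xop_subset _ _ h)

theorem locBdd_abs : LocBdd (StructClass b U c₀) U fun u x => |u x| :=
  fun K hK hKU => ⟨1, fun _ hu => hu.integral_abs_le K hK hKU⟩

theorem locBdd_subLap (hb : ∀ i, CVField (b i)) (hU : IsOpen U)
    (hdiv : ∀ i, ∀ x ∈ U, vfDiv (b i) x = 0) :
    LocBdd (StructClass b U c₀) U (subLap b) := by
  refine LocBdd.of_test hU locBdd_abs (fun u hu => continuous_subLap hb hu.contDiff)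
    (fun u hu => hu.subLap_nonneg) (fun u hu => hu.contDiff.continuous.abs)
    fun η hη hηs hηU _ => ?_
  obtain ⟨M, hM, -, -, h3⟩ := exists_test_bound hb hη hηs
  have hη2 : ContDiff ℝ 2 η := hη.of_le two_le_infty
  refine ⟨M, hM, fun u hu => ⟨fun x => subLap b η x * u x,
    (continuous_subLap hb hη2).mul hu.contDiff.continuous,
    fun x hx => by simp [subLap_eq_zero_of_notMem hx], fun x _ => ?_, ?_⟩⟩
  · calc _ ≤ |subLap b η x * u x| := le_abs_self _
      _ = |subLap b η x| * |u x| := abs_mul _ _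
      _ ≤ _ := mul_le_mul_of_nonneg_right (abs_subLap_le (h3 x)) (abs_nonneg _)
  · have h1 := integral_mul_sum_Xop hb hdiv (hη2.of_le one_le_two) hηs hηU
      (contDiff_one_Xop hb hu.contDiff)
    have h2 := integral_sum_Xop_mul_Xop hb hdiv hη2 hηs hηU (hu.contDiff.of_le one_le_two)
    rw [h2, neg_neg] at h1
    exact h1.le

theorem Xop_mul_decayPrim {η : (Fin n → ℝ) → ℝ} (hη : Differentiable ℝ η)
    (hu : Differentiable ℝ u) (γ : ℝ) (c : (Fin n → ℝ) → (Fin n → ℝ)) (x : Fin n → ℝ) :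
    Xop c (fun y => η y * decayPrim γ (u y)) x =
      η x * (decay γ (u x) * Xop c u x) + decayPrim γ (u x) * Xop c η x := by
  have hd : DifferentiableAt ℝ (fun y => decayPrim γ (u y)) x :=
    (hasDerivAt_decayPrim γ (u x)).differentiableAt.comp x (hu x)
  rw [Xop_mul (hη x) hd, Xop_comp (hasDerivAt_decayPrim γ (u x)) (hu x)]

theorem locBdd_decay_mul_wgt (hb : ∀ i, CVField (b i)) (hU : IsOpen U)
    (hdiv : ∀ i, ∀ x ∈ U, vfDiv (b i) x = 0) {γ : ℝ} (hγ : 0 < γ) :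
    LocBdd (StructClass b U c₀) U fun u x => decay γ (u x) * wgt b u x := by
  have hdc : ∀ u, StructClass b U c₀ u → Continuous fun x => decay γ (u x) :=
    fun u hu => (continuous_decay γ).comp hu.contDiff.continuous
  have hXc : ∀ u, StructClass b U c₀ u → Continuous fun x => ∑ i, Xop (b i) u x ^ 2 :=
    fun u hu => continuous_finsetSum _ fun i _ =>
      (contDiff_one_Xop hb hu.contDiff i).continuous.pow 2
  have hmain : LocBdd (StructClass b U c₀) U
      fun u x => decay γ (u x) * ∑ i, Xop (b i) u x ^ 2 := by
    refine LocBdd.of_test hU ((locBdd_subLap hb hU hdiv).add locBdd_abs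
        (fun u hu => continuous_subLap hb hu.contDiff) fun u hu => hu.contDiff.continuous.abs)
      (fun u hu => (hdc u hu).mul (hXc u hu))
      (fun u hu x _ => mul_nonneg (decay_pos _ _).le (Finset.sum_nonneg fun _ _ => sq_nonneg _))
      (fun u hu => (continuous_subLap hb hu.contDiff).add hu.contDiff.continuous.abs)
      fun η hη hηs hηU hη01 => ?_
    obtain ⟨M, hM, -, -, h3⟩ := exists_test_bound hb hη hηs
    obtain ⟨C, hC, hC1, hC2⟩ := exists_decayPrim_bound hγ
    have hη2 : ContDiff ℝ 2 η := hη.of_le two_le_infty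
    have hη1 : ContDiff ℝ 1 η := hη2.of_le one_le_two
    refine ⟨C + M * C, by positivity, fun u hu => ?_⟩
    have hu1 : ContDiff ℝ 1 u := hu.contDiff.of_le one_le_two
    have hg1 : ContDiff ℝ 1 fun x => decayPrim γ (u x) := (contDiff_decayPrim γ).comp hu1
    have hG1 : ContDiff ℝ 1 fun x => decayPrimTwo γ (u x) := (contDiff_decayPrimTwo γ).comp hu1
    have hL := continuous_subLap hb hu.contDiff
    refine ⟨fun x => -(η x * decayPrim γ (u x) * subLap b u x) +
      subLap b η x * decayPrimTwo γ (u x), ?_, fun x hx => ?_, fun x hx => ?_, ?_⟩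
    · exact ((hη1.continuous.mul hg1.continuous).mul hL).neg.add
        ((continuous_subLap hb hη2).mul hG1.continuous)
    · simp [subLap_eq_zero_of_notMem hx, image_eq_zero_of_notMem_tsupport hx]
    · have hΔ := hu.subLap_nonneg x hx
      have e1 : -(η x * decayPrim γ (u x) * subLap b u x) ≤ C * subLap b u x := by
        refine (neg_le_abs _).trans ?_
        rw [abs_mul, abs_mul, abs_of_nonneg hΔ, abs_of_nonneg (hη01 x).1]
        refine mul_le_mul_of_nonneg_right ?_ hΔ
        exact (mul_le_of_le_one_left (abs_nonneg _) (hη01 x).2).trans (hC1 _)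
      have e2 : subLap b η x * decayPrimTwo γ (u x) ≤ M * (C * |u x|) := by
        refine (le_abs_self _).trans ?_
        rw [abs_mul]
        exact mul_le_mul (abs_subLap_le (h3 x)) (hC2 _) (abs_nonneg _) hM
      have e3 : 0 ≤ M * C * subLap b u x := by positivity
      have e4 : 0 ≤ C * |u x| := by positivity
      nlinarith
    · have h1 := integral_mul_sum_Xop hb hdiv (hη1.mul hg1) hηs.mul_right
        ((tsupport_mul_subset_left).trans hηU) (contDiff_one_Xop hb hu.contDiff)
      have h2 := integral_sum_Xop_mul_Xop hb hdiv hη2 hηs hηU hG1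
      have h4 : ∀ x, ∑ i, Xop (b i) (fun y => η y * decayPrim γ (u y)) x * Xop (b i) u x =
          η x * (decay γ (u x) * ∑ i, Xop (b i) u x ^ 2) +
            ∑ i, Xop (b i) η x * Xop (b i) (fun y => decayPrimTwo γ (u y)) x := by
        intro x
        simp_rw [Xop_mul_decayPrim (hη1.differentiable one_ne_zero)
          (hu1.differentiable one_ne_zero), Xop_comp (hasDerivAt_decayPrimTwo γ (u x))
          (hu1.differentiable one_ne_zero x)]
        rw [Finset.mul_sum, Finset.mul_sum, ← Finset.sum_add_distrib]
        exact Finset.sum_congr rfl fun i _ => by ring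
      have i1 : Integrable fun x => η x * (decay γ (u x) * ∑ i, Xop (b i) u x ^ 2) :=
        (hη1.continuous.mul ((hdc u hu).mul (hXc u hu))).integrable_of_hasCompactSupport
          hηs.mul_right
      have i2 : Integrable fun x =>
          ∑ i, Xop (b i) η x * Xop (b i) (fun y => decayPrimTwo γ (u y)) x :=
        integrable_finsetSum _ fun i _ => ((contDiff_one_Xop hb hη2 i).continuous.mul
          (continuous_Xop (hb i).1.continuous hG1)).integrable_of_hasCompactSupport
          (hasCompactSupport_Xop _ hηs).mul_right
      have i3 : Integrable fun x => η x * decayPrim γ (u x) * subLap b u x :=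
        ((hη1.continuous.mul hg1.continuous).mul hL).integrable_of_hasCompactSupport
          hηs.mul_right.mul_right
      have i4 : Integrable fun x => subLap b η x * decayPrimTwo γ (u x) :=
        ((continuous_subLap hb hη2).mul hG1.continuous).integrable_of_hasCompactSupport
          (HasCompactSupport.intro hηs.isCompact fun x hx => by
            simp [subLap_eq_zero_of_notMem hx])
      simp_rw [h4] at h1
      rw [integral_add i1 i2, h2] at h1
      have h5 : ∫ x, (-(η x * decayPrim γ (u x) * subLap b u x) +
          subLap b η x * decayPrimTwo γ (u x)) =
          -(∫ x, η x * decayPrim γ (u x) * subLap b u x) +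
          ∫ x, subLap b η x * decayPrimTwo γ (u x) := by
        rw [← integral_neg]
        exact integral_add i3.neg i4
      rw [h5]
      change ∫ x, η x * decayPrim γ (u x) * subLap b u x = _ at h1
      linarith
  refine (hmain.add (locBdd_const 1) (fun u hu => (hdc u hu).mul (hXc u hu))
    fun u hu => continuous_const).of_le (M := 1)
    (fun u hu => (hdc u hu).mul (contDiff_wgt hb hu.contDiff).continuous)
    (fun u hu => ((hdc u hu).mul (hXc u hu)).add continuous_const) zero_le_one fun u hu x _ => ?_
  have := decay_le_one hγ (u x)
  unfold wgt
  linarith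

end WeightedEstimates

section GradientIteration

open scoped ContDiff

variable {n m : ℕ} {b : Fin m → (Fin n → ℝ) → (Fin n → ℝ)} {U : Set (Fin n → ℝ)} {c₀ : ℝ}
  {u : (Fin n → ℝ) → ℝ}

theorem contDiff_wgt_rpow_mul_Xop (hb : ∀ i, CVField (b i)) (hu : ContDiff ℝ 2 u) (s : ℝ)
    (i : Fin m) : ContDiff ℝ 1 fun y => wgt b u y ^ s * Xop (b i) u y :=
  (contDiff_wgt_rpow hb hu s).mul (contDiff_one_Xop hb hu i)

theorem continuous_sum_Xop_wgt_mul (hb : ∀ i, CVField (b i)) (hu : ContDiff ℝ 2 u) (s : ℝ) :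
    Continuous fun x => ∑ i, Xop (b i) (fun y => wgt b u y ^ s * Xop (b i) u y) x :=
  continuous_finsetSum _ fun i _ =>
    continuous_Xop (hb i).1.continuous (contDiff_wgt_rpow_mul_Xop hb hu s i)

theorem sum_Xop_wgt_mul_nonneg (hb : ∀ i, CVField (b i)) (hu : StructClass b U c₀ u) {r s : ℝ}
    (hc₀ : 0 ≤ c₀) (hr : r * c₀ < 1) (hs0 : 0 ≤ s) (hsr : s ≤ r) {x : Fin n → ℝ} (hx : x ∈ U) :
    0 ≤ ∑ i, Xop (b i) (fun y => wgt b u y ^ (s / 2) * Xop (b i) u y) x := by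
  refine le_trans ?_ (sum_Xop_wgt_mul_ge hb hu hc₀ hs0 hsr hx)
  have h1 := hu.subLap_nonneg x hx
  have h2 := (wgt_pos b u x).le
  have h3 : 0 ≤ 1 - r * c₀ := by linarith
  positivity

theorem locBdd_sum_Xop_wgt_mul (hb : ∀ i, CVField (b i)) (hU : IsOpen U)
    (hdiv : ∀ i, ∀ x ∈ U, vfDiv (b i) x = 0) {r s : ℝ} (hc₀ : 0 ≤ c₀) (hr : r * c₀ < 1)
    (hs0 : 0 ≤ s) (hsr : s ≤ r)
    (hG : LocBdd (StructClass b U c₀) U fun u x => wgt b u x ^ ((s + 1) / 2)) :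
    LocBdd (StructClass b U c₀) U
      fun u x => ∑ i, Xop (b i) (fun y => wgt b u y ^ (s / 2) * Xop (b i) u y) x := by
  refine LocBdd.of_test hU hG (fun u hu => continuous_sum_Xop_wgt_mul hb hu.contDiff _)
    (fun u hu x hx => sum_Xop_wgt_mul_nonneg hb hu hc₀ hr hs0 hsr hx)
    (fun u hu => (contDiff_wgt_rpow hb hu.contDiff _).continuous) fun η hη hηs hηU _ => ?_
  obtain ⟨M, hM, h1, -, -⟩ := exists_test_bound hb hη hηs
  have hη1 : ContDiff ℝ 1 η := (hη.of_le two_le_infty).of_le one_le_two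
  refine ⟨M, hM, fun u hu => ⟨fun x =>
    -∑ i, Xop (b i) η x * (wgt b u x ^ (s / 2) * Xop (b i) u x), ?_, fun x hx => ?_,
    fun x _ => (neg_le_abs _).trans (abs_sum_Xop_mul_le b (h1 x) u s), ?_⟩⟩
  · exact (continuous_finsetSum _ fun i _ => (continuous_Xop (hb i).1.continuous hη1).mul
      (contDiff_wgt_rpow_mul_Xop hb hu.contDiff _ i).continuous).neg
  · simp [Xop_eq_zero_of_notMem _ hx]
  · rw [integral_mul_sum_Xop hb hdiv hη1 hηs hηU
      (fun i => contDiff_wgt_rpow_mul_Xop hb hu.contDiff (s / 2) i), integral_neg]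

theorem locBdd_wgt_rpow_mul_subLap (hb : ∀ i, CVField (b i)) (hU : IsOpen U)
    (hdiv : ∀ i, ∀ x ∈ U, vfDiv (b i) x = 0) {s : ℝ} (hc₀ : 0 ≤ c₀) (hs : s * c₀ < 1)
    (hs0 : 0 ≤ s)
    (hG : LocBdd (StructClass b U c₀) U fun u x => wgt b u x ^ ((s + 1) / 2)) :
    LocBdd (StructClass b U c₀) U fun u x => wgt b u x ^ (s / 2) * subLap b u x := by
  have hθ : 0 < 1 - s * c₀ := by linarith
  refine (locBdd_sum_Xop_wgt_mul hb hU hdiv hc₀ hs hs0 le_rfl hG).of_le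
    (fun u hu => (contDiff_wgt_rpow hb hu.contDiff _).continuous.mul
      (continuous_subLap hb hu.contDiff))
    (fun u hu => continuous_sum_Xop_wgt_mul hb hu.contDiff _) (inv_pos.2 hθ).le
    fun u hu x hx => ?_
  rw [← div_eq_inv_mul, le_div_iff₀' hθ]
  exact sum_Xop_wgt_mul_ge hb hu hc₀ hs0 le_rfl hx

theorem locBdd_decay_mul_wgt_rpow (hb : ∀ i, CVField (b i)) (hU : IsOpen U)
    (hdiv : ∀ i, ∀ x ∈ U, vfDiv (b i) x = 0) {r s γ : ℝ} (hγ : 0 < γ) (hc₀ : 0 ≤ c₀)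
    (hr : r * c₀ < 1) (hs0 : 0 ≤ s) (hsr : s ≤ r)
    (hG : LocBdd (StructClass b U c₀) U fun u x => wgt b u x ^ ((s + 1) / 2)) :
    LocBdd (StructClass b U c₀) U
      fun u x => decay γ (u x) * wgt b u x ^ (s / 2 + 1) := by
  have hdc : ∀ u, StructClass b U c₀ u → Continuous fun x => decay γ (u x) :=
    fun u hu => (continuous_decay γ).comp hu.contDiff.continuous
  have hwc : ∀ (p : ℝ) u, StructClass b U c₀ u → Continuous fun x => wgt b u x ^ p :=
    fun p u hu => (contDiff_wgt_rpow hb hu.contDiff p).continuous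
  have hXc : ∀ u, StructClass b U c₀ u → Continuous fun x => ∑ i, Xop (b i) u x ^ 2 :=
    fun u hu => continuous_finsetSum _ fun i _ =>
      (contDiff_one_Xop hb hu.contDiff i).continuous.pow 2
  have hLc : ∀ u, StructClass b U c₀ u → Continuous fun x =>
      ∑ i, Xop (b i) (fun y => wgt b u y ^ (s / 2) * Xop (b i) u y) x :=
    fun u hu => continuous_sum_Xop_wgt_mul hb hu.contDiff _
  have hFc : ∀ u, StructClass b U c₀ u → Continuous fun x =>
      decay γ (u x) * (wgt b u x ^ (s / 2) * ∑ i, Xop (b i) u x ^ 2) :=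
    fun u hu => (hdc u hu).mul ((hwc _ u hu).mul (hXc u hu))
  have hmain : LocBdd (StructClass b U c₀) U fun u x =>
      decay γ (u x) * (wgt b u x ^ (s / 2) * ∑ i, Xop (b i) u x ^ 2) := by
    refine LocBdd.of_test hU ((locBdd_sum_Xop_wgt_mul hb hU hdiv hc₀ hr hs0 hsr hG).add hG hLc
        (hwc _)) hFc
      (fun u hu x _ => mul_nonneg (decay_pos _ _).le (mul_nonneg
        (Real.rpow_nonneg (wgt_pos b u x).le _) (Finset.sum_nonneg fun _ _ => sq_nonneg _)))
      (fun u hu => (hLc u hu).add (hwc _ u hu)) fun η hη hηs hηU hη01 => ?_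
    obtain ⟨M, hM, h1, -, -⟩ := exists_test_bound hb hη hηs
    obtain ⟨C, hC, hC1, -⟩ := exists_decayPrim_bound hγ
    have hη1 : ContDiff ℝ 1 η := (hη.of_le two_le_infty).of_le one_le_two
    refine ⟨C + C * M, by positivity, fun u hu => ?_⟩
    have hu1 : ContDiff ℝ 1 u := hu.contDiff.of_le one_le_two
    have hg1 : ContDiff ℝ 1 fun x => decayPrim γ (u x) := (contDiff_decayPrim γ).comp hu1
    have hV := fun i => contDiff_wgt_rpow_mul_Xop hb hu.contDiff (s / 2) i
    have hηV : Continuous fun x =>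
        ∑ i, Xop (b i) η x * (wgt b u x ^ (s / 2) * Xop (b i) u x) :=
      continuous_finsetSum _ fun i _ =>
        (continuous_Xop (hb i).1.continuous hη1).mul (hV i).continuous
    have c1 := (hη1.continuous.mul hg1.continuous).mul (hLc u hu)
    have c2 := hg1.continuous.mul hηV
    refine ⟨fun x => -(η x * decayPrim γ (u x) *
        ∑ i, Xop (b i) (fun y => wgt b u y ^ (s / 2) * Xop (b i) u y) x) -
      decayPrim γ (u x) * ∑ i, Xop (b i) η x * (wgt b u x ^ (s / 2) * Xop (b i) u x),
      c1.neg.sub c2, fun x hx => ?_, fun x hx => ?_, ?_⟩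
    · simp [Xop_eq_zero_of_notMem _ hx, image_eq_zero_of_notMem_tsupport hx]
    · have hΔ := sum_Xop_wgt_mul_nonneg hb hu hc₀ hr hs0 hsr hx
      set Λ := ∑ i, Xop (b i) (fun y => wgt b u y ^ (s / 2) * Xop (b i) u y) x
      have e1 : -(η x * decayPrim γ (u x) * Λ) ≤ C * Λ := by
        refine (neg_le_abs _).trans ?_
        rw [abs_mul, abs_mul, abs_of_nonneg hΔ, abs_of_nonneg (hη01 x).1]
        refine mul_le_mul_of_nonneg_right ?_ hΔ
        exact (mul_le_of_le_one_left (abs_nonneg _) (hη01 x).2).trans (hC1 _)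
      have e2 : -(decayPrim γ (u x) *
          ∑ i, Xop (b i) η x * (wgt b u x ^ (s / 2) * Xop (b i) u x)) ≤
          C * (M * wgt b u x ^ ((s + 1) / 2)) := by
        refine (neg_le_abs _).trans ?_
        rw [abs_mul]
        exact mul_le_mul (hC1 _) (abs_sum_Xop_mul_le b (h1 x) u s) (abs_nonneg _) hC
      have e3 : 0 ≤ C * M * Λ := by positivity
      have e4 : 0 ≤ C * wgt b u x ^ ((s + 1) / 2) :=
        mul_nonneg hC (Real.rpow_nonneg (wgt_pos b u x).le _)
      nlinarith
    · have h2 := integral_mul_sum_Xop hb hdiv (hη1.mul hg1) hηs.mul_right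
        ((tsupport_mul_subset_left).trans hηU) hV
      have h4 : ∀ x, ∑ i, Xop (b i) (fun y => η y * decayPrim γ (u y)) x *
          (wgt b u x ^ (s / 2) * Xop (b i) u x) =
          η x * (decay γ (u x) * (wgt b u x ^ (s / 2) * ∑ i, Xop (b i) u x ^ 2)) +
            decayPrim γ (u x) *
              ∑ i, Xop (b i) η x * (wgt b u x ^ (s / 2) * Xop (b i) u x) := by
        intro x
        simp_rw [Xop_mul_decayPrim (hη1.differentiable one_ne_zero)
          (hu1.differentiable one_ne_zero)]
        simp only [Finset.mul_sum, ← Finset.sum_add_distrib]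
        exact Finset.sum_congr rfl fun i _ => by ring
      have i1 : Integrable fun x =>
          η x * (decay γ (u x) * (wgt b u x ^ (s / 2) * ∑ i, Xop (b i) u x ^ 2)) :=
        (hη1.continuous.mul (hFc u hu)).integrable_of_hasCompactSupport hηs.mul_right
      have i2 : Integrable fun x => decayPrim γ (u x) *
          ∑ i, Xop (b i) η x * (wgt b u x ^ (s / 2) * Xop (b i) u x) :=
        c2.integrable_of_hasCompactSupport (HasCompactSupport.intro hηs.isCompact fun x hx => by
            simp [Xop_eq_zero_of_notMem _ hx])
      have i3 : Integrable fun x => η x * decayPrim γ (u x) *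
          ∑ i, Xop (b i) (fun y => wgt b u y ^ (s / 2) * Xop (b i) u y) x :=
        c1.integrable_of_hasCompactSupport hηs.mul_right.mul_right
      simp_rw [h4] at h2
      rw [integral_add i1 i2] at h2
      have h5 : ∫ x, (-(η x * decayPrim γ (u x) *
            ∑ i, Xop (b i) (fun y => wgt b u y ^ (s / 2) * Xop (b i) u y) x) -
          decayPrim γ (u x) *
            ∑ i, Xop (b i) η x * (wgt b u x ^ (s / 2) * Xop (b i) u x)) =
          -(∫ x, η x * decayPrim γ (u x) *
            ∑ i, Xop (b i) (fun y => wgt b u y ^ (s / 2) * Xop (b i) u y) x) -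
          ∫ x, decayPrim γ (u x) *
            ∑ i, Xop (b i) η x * (wgt b u x ^ (s / 2) * Xop (b i) u x) := by
        rw [← integral_neg]
        exact integral_sub i3.neg i2
      rw [h5]
      linarith
  refine (hmain.add hG hFc (hwc _)).of_le (M := 1)
    (fun u hu => (hdc u hu).mul (hwc _ u hu))
    (fun u hu => (hFc u hu).add (hwc _ u hu)) zero_le_one fun u hu x _ => ?_
  have hw := wgt_pos b u x
  have e1 : wgt b u x ^ (s / 2 + 1) = wgt b u x ^ (s / 2) * (1 + ∑ i, Xop (b i) u x ^ 2) := by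
    rw [Real.rpow_add_one hw.ne']; rfl
  have e2 : decay γ (u x) * wgt b u x ^ (s / 2) ≤ wgt b u x ^ ((s + 1) / 2) :=
    (mul_le_of_le_one_left (by positivity) (decay_le_one hγ _)).trans
      (Real.rpow_le_rpow_of_exponent_le (one_le_wgt b u x) (by linarith))
  rw [e1]
  linarith

end GradientIteration

section IntegrabilityGain

open scoped ContDiff

variable {n m : ℕ} {b : Fin m → (Fin n → ℝ) → (Fin n → ℝ)} {U : Set (Fin n → ℝ)} {c₀ : ℝ}
  {u : (Fin n → ℝ) → ℝ}

theorem energy_le_setIntegral (hb : ∀ i, CVField (b i)) {f G : (Fin n → ℝ) → ℝ}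
    {K : Set (Fin n → ℝ)} (hK : IsCompact K) (hf : ContDiff ℝ 1 f) (hfK : tsupport f ⊆ K)
    (hG : Continuous G) (h : ∀ x, f x ^ 2 + ∑ i, Xop (b i) f x ^ 2 ≤ G x) :
    energy b f ≤ ∫ x in K, G x := by
  have hfs : HasCompactSupport f := hK.of_isClosed_subset (isClosed_tsupport _) hfK
  have hf' : CCFun f := ⟨hf.continuous, hfs⟩
  have hX : ∀ i, CCFun (Xop (b i) f) := fun i =>
    ⟨continuous_Xop (hb i).1.continuous hf, hasCompactSupport_Xop _ hfs⟩
  have e : energy b f = ∫ x, (f x ^ 2 + ∑ i, Xop (b i) f x ^ 2) := by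
    unfold energy sqInt
    rw [integral_add hf'.sq (integrable_finsetSum _ fun i _ => (hX i).sq),
      integral_finsetSum _ fun i _ => (hX i).sq]
  have hc : Continuous fun x => f x ^ 2 + ∑ i, Xop (b i) f x ^ 2 :=
    (hf.continuous.pow 2).add (continuous_finsetSum _ fun i _ => (hX i).1.pow 2)
  rw [e, ← setIntegral_eq_integral_of_forall_compl_eq_zero (s := K) fun x hx => ?_]
  · exact setIntegral_mono_on (hc.continuousOn.integrableOn_compact hK)
      (hG.continuousOn.integrableOn_compact hK) hK.measurableSet fun x _ => h x
  · have hx' : x ∉ tsupport f := fun h' => hx (hfK h')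
    simp [image_eq_zero_of_notMem_tsupport hx', Xop_eq_zero_of_notMem _ hx']

theorem rpow_sub_one_mul_le {A w q γ : ℝ} (hA : 1 ≤ A) (hw : 1 ≤ w) (hq : 1 ≤ q) :
    A ^ ((q - γ) / 2 - 1) * w ≤ A ^ (-(1 + γ) / 2) * w ^ ((q + 1) / 2) + A ^ ((q - γ) / 2) := by
  have hA0 : 0 < A := by linarith
  have hw0 : 0 < w := by linarith
  rcases le_total w A with h | h
  · have h1 : A ^ ((q - γ) / 2) = A ^ ((q - γ) / 2 - 1) * A := by
      rw [← Real.rpow_add_one hA0.ne']; congr 1; ring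
    have h2 : A ^ ((q - γ) / 2 - 1) * w ≤ A ^ ((q - γ) / 2 - 1) * A := by gcongr
    have h3 : 0 ≤ A ^ (-(1 + γ) / 2) * w ^ ((q + 1) / 2) := by positivity
    linarith
  · have h1 : A ^ ((q - γ) / 2 - 1) = A ^ (-(1 + γ) / 2) * A ^ ((q - 1) / 2) := by
      rw [← Real.rpow_add hA0]; congr 1; ring
    have h2 : w ^ ((q + 1) / 2) = w ^ ((q - 1) / 2) * w := by
      rw [← Real.rpow_add_one hw0.ne']; congr 1; ring
    have h3 : A ^ ((q - 1) / 2) ≤ w ^ ((q - 1) / 2) :=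
      Real.rpow_le_rpow hA0.le h (by linarith)
    have h4 : 0 ≤ A ^ ((q - γ) / 2) := by positivity
    have h5 : A ^ (-(1 + γ) / 2) * A ^ ((q - 1) / 2) * w ≤
        A ^ (-(1 + γ) / 2) * w ^ ((q - 1) / 2) * w := by gcongr
    rw [h1, h2]
    linarith

theorem contDiff_one_add_sq_rpow (hu : ContDiff ℝ 2 u) (p : ℝ) :
    ContDiff ℝ 1 fun x => (1 + u x ^ 2) ^ p :=
  (contDiff_const.add ((hu.of_le one_le_two).pow 2)).rpow_const_of_ne fun x => by positivity

theorem Xop_one_add_sq_rpow (hu : ContDiff ℝ 2 u) (c : (Fin n → ℝ) → (Fin n → ℝ)) (p : ℝ)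
    (x : Fin n → ℝ) : Xop c (fun y => (1 + u y ^ 2) ^ p) x =
      2 * p * u x * (1 + u x ^ 2) ^ (p - 1) * Xop c u x := by
  have h1 : HasDerivAt (fun v : ℝ => (1 + v ^ 2) ^ p)
      (2 * u x * p * (1 + u x ^ 2) ^ (p - 1)) (u x) := by
    have := ((hasDerivAt_pow 2 (u x)).const_add 1).rpow_const (p := p)
      (Or.inl (by positivity : (1 + u x ^ 2) ≠ 0))
    simpa using this
  rw [Xop_comp h1 (hu.differentiable two_ne_zero x)]
  ring

/-- One step of the gain of integrability coming from the Sobolev inequality. -/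
theorem locBdd_sobolev_gain (hb : ∀ i, CVField (b i)) (hU : IsOpen U) {κ C : ℝ} (hκ : 0 < κ)
    (hC : 0 ≤ C) (hsob : ∀ f : (Fin n → ℝ) → ℝ, ContDiff ℝ 1 f → tsupport f ⊆ U →
      ∫ x, |f x| ^ (2 * κ) ≤ C * energy b f ^ κ) {q γ : ℝ} (hq : 1 ≤ q)
    (hH : LocBdd (StructClass b U c₀) U
      fun u x => decay γ (u x) * wgt b u x ^ ((q + 1) / 2))
    (hA : LocBdd (StructClass b U c₀) U fun u x => (1 + u x ^ 2) ^ ((q - γ) / 2)) :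
    LocBdd (StructClass b U c₀) U fun u x => (1 + u x ^ 2) ^ ((q - γ) * κ / 2) := by
  intro K hK hKU
  obtain ⟨η, hη, hηs, hηU, hη1, hη01⟩ := exists_cutoff hK hU hKU
  obtain ⟨M, hM, -, hM2, -⟩ := exists_test_bound hb hη hηs
  have hHc : ∀ u, StructClass b U c₀ u →
      Continuous fun x => decay γ (u x) * wgt b u x ^ ((q + 1) / 2) := fun u hu =>
    ((continuous_decay γ).comp hu.contDiff.continuous).mul
      (contDiff_wgt_rpow hb hu.contDiff _).continuous
  have hAc : ∀ u, StructClass b U c₀ u → ∀ p : ℝ, Continuous fun x => (1 + u x ^ 2) ^ p :=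
    fun u hu p => (contDiff_one_add_sq_rpow hu.contDiff p).continuous
  obtain ⟨D, hD⟩ := hH.add hA hHc (fun u hu => hAc u hu _) (tsupport η) hηs.isCompact hηU
  set a : ℝ := (q - γ) / 4
  set N : ℝ := 1 + 2 * M + 8 * a ^ 2 with hN
  refine ⟨C * (N * D) ^ κ, fun u hu => ?_⟩
  have hη1' : ContDiff ℝ 1 η := (hη.of_le two_le_infty).of_le one_le_two
  have hF := contDiff_one_add_sq_rpow hu.contDiff a
  have hf : ContDiff ℝ 1 fun x => η x * (1 + u x ^ 2) ^ a := hη1'.mul hF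
  have hfs : tsupport (fun x => η x * (1 + u x ^ 2) ^ a) ⊆ tsupport η := tsupport_mul_subset_left
  have hen : energy b (fun x => η x * (1 + u x ^ 2) ^ a) ≤ N * D := by
    have hGc : Continuous fun x => N * (decay γ (u x) * wgt b u x ^ ((q + 1) / 2) +
        (1 + u x ^ 2) ^ ((q - γ) / 2)) := ((hHc u hu).add (hAc u hu _)).const_mul N
    have h1 := energy_le_setIntegral hb hηs.isCompact hf hfs hGc fun x => ?_
    · rw [integral_const_mul] at h1
      exact h1.trans (mul_le_mul_of_nonneg_left (hD u hu) (by positivity))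
    have hA1 : 1 ≤ 1 + u x ^ 2 := le_add_of_nonneg_right (sq_nonneg _)
    have hA0 : 0 < 1 + u x ^ 2 := by positivity
    have hη2 : η x ^ 2 ≤ 1 := pow_le_one₀ (hη01 x).1 (hη01 x).2
    have e1 : ((1 + u x ^ 2) ^ a) ^ 2 = (1 + u x ^ 2) ^ ((q - γ) / 2) := by
      rw [← Real.rpow_natCast, ← Real.rpow_mul hA0.le]
      congr 1; simp only [a]; push_cast; ring
    have e2 : (1 + u x ^ 2) * ((1 + u x ^ 2) ^ (a - 1)) ^ 2 =
        (1 + u x ^ 2) ^ ((q - γ) / 2 - 1) := by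
      rw [← Real.rpow_natCast (_ ^ (a - 1)), ← Real.rpow_mul hA0.le, mul_comm, ← Real.rpow_add_one hA0.ne']
      congr 1; simp only [a]; push_cast; ring
    have h2 := rpow_sub_one_mul_le (γ := γ) hA1 (one_le_wgt b u x) hq
    have h3 : ∀ i, Xop (b i) (fun y => η y * (1 + u y ^ 2) ^ a) x ^ 2 ≤
        2 * (1 + u x ^ 2) ^ ((q - γ) / 2) * Xop (b i) η x ^ 2 +
          8 * a ^ 2 * (1 + u x ^ 2) ^ ((q - γ) / 2 - 1) * Xop (b i) u x ^ 2 := by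
      intro i
      rw [Xop_mul (hη1'.differentiable one_ne_zero x) (hF.differentiable one_ne_zero x),
        Xop_one_add_sq_rpow hu.contDiff, ← e1, ← e2]
      set B := (1 + u x ^ 2) ^ (a - 1)
      set E := (1 + u x ^ 2) ^ a
      have h4 : η x ^ 2 * (u x ^ 2 * (B ^ 2 * Xop (b i) u x ^ 2)) ≤
          1 * ((1 + u x ^ 2) * (B ^ 2 * Xop (b i) u x ^ 2)) := by
        gcongr
        linarith
      nlinarith [sq_nonneg (η x * (2 * a * u x * B * Xop (b i) u x) - Xop (b i) η x * E),
        mul_le_mul_of_nonneg_left h4 (by positivity : 0 ≤ 8 * a ^ 2)]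
    have h5 := Finset.sum_le_sum fun i (_ : i ∈ Finset.univ) => h3 i
    rw [Finset.sum_add_distrib, ← Finset.mul_sum, ← Finset.mul_sum] at h5
    have h6 : 2 * (1 + u x ^ 2) ^ ((q - γ) / 2) * ∑ i, Xop (b i) η x ^ 2 ≤
        2 * (1 + u x ^ 2) ^ ((q - γ) / 2) * M := by
      gcongr; exact hM2 x
    have h7 : 8 * a ^ 2 * (1 + u x ^ 2) ^ ((q - γ) / 2 - 1) * ∑ i, Xop (b i) u x ^ 2 ≤
        8 * a ^ 2 * ((1 + u x ^ 2) ^ ((q - γ) / 2 - 1) * wgt b u x) := by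
      rw [mul_assoc]
      gcongr
      exact sum_sq_Xop_le_wgt b u x
    have h8 := mul_le_mul_of_nonneg_left h2 (by positivity : 0 ≤ 8 * a ^ 2)
    have h9 : (η x * (1 + u x ^ 2) ^ a) ^ 2 ≤ (1 + u x ^ 2) ^ ((q - γ) / 2) := by
      rw [mul_pow, e1]
      exact mul_le_of_le_one_left (by positivity) hη2
    have h10 : 0 ≤ (1 + 2 * M) * (decay γ (u x) * wgt b u x ^ ((q + 1) / 2)) :=
      mul_nonneg (by positivity) (mul_nonneg (decay_pos _ _).le
        (Real.rpow_nonneg (wgt_pos b u x).le _))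
    change _ ≤ _ * (decay γ (u x) * _ + _) at h8
    rw [hN]
    linarith
  have hηK : ∀ x ∈ K, η x = 1 := fun x hx => hη1.self_of_nhdsSet x hx
  have hc : Continuous fun x => |η x * (1 + u x ^ 2) ^ a| ^ (2 * κ) :=
    hf.continuous.abs.rpow_const fun _ => Or.inr (by positivity)
  calc ∫ x in K, (1 + u x ^ 2) ^ ((q - γ) * κ / 2)
      = ∫ x in K, |η x * (1 + u x ^ 2) ^ a| ^ (2 * κ) := by
        refine setIntegral_congr_fun hK.measurableSet fun x hx => ?_
        have hA0 : 0 < 1 + u x ^ 2 := by positivity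
        simp only [hηK x hx, one_mul]
        rw [abs_of_pos (by positivity), ← Real.rpow_mul hA0.le]
        congr 1; simp only [a]; ring
    _ ≤ ∫ x, |η x * (1 + u x ^ 2) ^ a| ^ (2 * κ) := setIntegral_le_integral
        (hc.integrable_of_hasCompactSupport (HasCompactSupport.intro hηs.isCompact fun x hx => by
          simp [image_eq_zero_of_notMem_tsupport hx, Real.zero_rpow, hκ.ne']))
        (Eventually.of_forall fun x => by positivity)
    _ ≤ C * energy b (fun x => η x * (1 + u x ^ 2) ^ a) ^ κ := hsob _ hf (hfs.trans hηU)
    _ ≤ C * (N * D) ^ κ := mul_le_mul_of_nonneg_left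
        (Real.rpow_le_rpow (energy_nonneg _ _) hen hκ.le) hC

end IntegrabilityGain

section IntegrabilityIteration

open scoped ContDiff

variable {n m : ℕ} {b : Fin m → (Fin n → ℝ) → (Fin n → ℝ)} {U : Set (Fin n → ℝ)} {c₀ : ℝ}

theorem exists_gain_step {κ : ℝ} (hκ : 1 < κ) :
    ∃ δ : ℝ, 0 < δ ∧ δ < 1 ∧ (1 + δ) ^ 2 ≤ κ * (1 - δ) ^ 2 := by
  have h : Tendsto (fun δ : ℝ => κ * (1 - δ) ^ 2 - (1 + δ) ^ 2) (𝓝[>] 0) (𝓝 (κ - 1)) := by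
    have : Continuous fun δ : ℝ => κ * (1 - δ) ^ 2 - (1 + δ) ^ 2 := by fun_prop
    have h := this.tendsto 0
    simp only [sub_zero, one_pow, mul_one, add_zero] at h
    exact h.mono_left nhdsWithin_le_nhds
  have h1 := h.eventually (lt_mem_nhds (by linarith : (0 : ℝ) < κ - 1))
  have h2 : ∀ᶠ δ : ℝ in 𝓝[>] 0, δ < 1 :=
    nhdsWithin_le_nhds (gt_mem_nhds one_pos)
  obtain ⟨δ, h3, h4, h5⟩ := (h1.and (h2.and self_mem_nhdsWithin)).exists
  exact ⟨δ, h5, h4, by linarith⟩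

theorem rpow_half_le_add {A w q q' δ κ : ℝ} (hA : 1 ≤ A) (hw : 1 ≤ w) (hδ : 0 < δ) (hδ1 : δ < 1)
    (hκ : (1 + δ) ^ 2 ≤ κ * (1 - δ) ^ 2) (hq : 1 ≤ q) (hq' : q' ≤ q + δ) :
    w ^ (q' / 2) ≤ A ^ (-(1 + δ) / 2) * w ^ ((q + 1) / 2) + A ^ ((q - δ) * κ / 2) := by
  have hA0 : 0 < A := by linarith
  have hw0 : 0 < w := by linarith
  refine (Real.rpow_le_rpow_of_exponent_le hw
    (by linarith : q' / 2 ≤ (q + δ) / 2)).trans ?_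
  rcases le_total (w ^ ((1 - δ) / 2)) (A ^ ((1 + δ) / 2)) with h | h
  · have hθ : 0 < 1 - δ := by linarith
    have h1 : w ^ ((q + δ) / 2) = (w ^ ((1 - δ) / 2)) ^ ((q + δ) / (1 - δ)) := by
      rw [← Real.rpow_mul hw0.le]; congr 1; field_simp
    have h2 : w ^ ((q + δ) / 2) ≤ (A ^ ((1 + δ) / 2)) ^ ((q + δ) / (1 - δ)) := by
      rw [h1]; exact Real.rpow_le_rpow (by positivity) h (by positivity)
    rw [← Real.rpow_mul hA0.le] at h2
    have h3 : (1 + δ) / 2 * ((q + δ) / (1 - δ)) ≤ (q - δ) * κ / 2 := by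
      rw [div_mul_div_comm, div_le_div_iff₀ (by positivity) two_pos]
      have h4 : (1 - δ) * (q + δ) ≤ (1 + δ) * (q - δ) := by nlinarith
      have h5 : (1 - δ) * ((1 + δ) * (q + δ)) ≤ (1 - δ) * ((q - δ) * κ * (1 - δ)) := by
        have : (1 + δ) * ((1 - δ) * (q + δ)) ≤ (1 + δ) * ((1 + δ) * (q - δ)) := by gcongr
        nlinarith [mul_le_mul_of_nonneg_left hκ (by linarith : 0 ≤ q - δ)]
      have := le_of_mul_le_mul_left h5 hθ
      linarith
    have h6 : 0 ≤ A ^ (-(1 + δ) / 2) * w ^ ((q + 1) / 2) := by positivity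
    linarith [h2.trans (Real.rpow_le_rpow_of_exponent_le hA h3)]
  · have h1 : w ^ ((q + 1) / 2) = w ^ ((1 - δ) / 2) * w ^ ((q + δ) / 2) := by
      rw [← Real.rpow_add hw0]; congr 1; ring
    have h2 : A ^ (-(1 + δ) / 2) * A ^ ((1 + δ) / 2) = 1 := by
      rw [← Real.rpow_add hA0, neg_div, neg_add_cancel, Real.rpow_zero]
    have h3 : 0 ≤ A ^ ((q - δ) * κ / 2) := by positivity
    calc w ^ ((q + δ) / 2) = A ^ (-(1 + δ) / 2) * A ^ ((1 + δ) / 2) * w ^ ((q + δ) / 2) := by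
          rw [h2, one_mul]
      _ ≤ A ^ (-(1 + δ) / 2) * w ^ ((1 - δ) / 2) * w ^ ((q + δ) / 2) := by gcongr
      _ ≤ _ := by rw [h1, ← mul_assoc]; linarith

/-- Local bounds for the powers of `|Xu|` below the critical exponent. -/
theorem locBdd_wgt_rpow (hb : ∀ i, CVField (b i)) (hU : IsOpen U)
    (hdiv : ∀ i, ∀ x ∈ U, vfDiv (b i) x = 0) {κ C : ℝ} (hκ : 1 < κ) (hC : 0 ≤ C)
    (hsob : ∀ f : (Fin n → ℝ) → ℝ, ContDiff ℝ 1 f → tsupport f ⊆ U →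
      ∫ x, |f x| ^ (2 * κ) ≤ C * energy b f ^ κ) {r : ℝ} (hc₀ : 0 ≤ c₀) (hr : r * c₀ < 1)
    (hr0 : 0 ≤ r) :
    LocBdd (StructClass b U c₀) U fun u x => wgt b u x ^ ((r + 1) / 2) := by
  obtain ⟨δ, hδ, hδ1, hδκ⟩ := exists_gain_step hκ
  have hHc : ∀ u, StructClass b U c₀ u → ∀ q : ℝ,
      Continuous fun x => decay δ (u x) * wgt b u x ^ q := fun u hu q =>
    ((continuous_decay δ).comp hu.contDiff.continuous).mul
      (contDiff_wgt_rpow hb hu.contDiff _).continuous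
  have hAc : ∀ u, StructClass b U c₀ u → ∀ p : ℝ, Continuous fun x => (1 + u x ^ 2) ^ p :=
    fun u hu p => (contDiff_one_add_sq_rpow hu.contDiff p).continuous
  have hA1 : ∀ v : ℝ, 1 ≤ 1 + v ^ 2 := fun v => le_add_of_nonneg_right (sq_nonneg _)
  have key : ∀ q q' : ℝ, 1 ≤ q → q' ≤ q + δ →
      LocBdd (StructClass b U c₀) U (fun u x => decay δ (u x) * wgt b u x ^ ((q + 1) / 2)) →
      LocBdd (StructClass b U c₀) U (fun u x => (1 + u x ^ 2) ^ ((q - δ) / 2)) →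
      LocBdd (StructClass b U c₀) U (fun u x => (1 + u x ^ 2) ^ ((q - δ) * κ / 2)) ∧
      LocBdd (StructClass b U c₀) U (fun u x => wgt b u x ^ (q' / 2)) := by
    intro q q' hq hq' hH hA
    have hG := locBdd_sobolev_gain hb hU (one_pos.trans hκ) hC hsob hq hH hA
    refine ⟨hG, (hH.add hG (fun u hu => hHc u hu _) fun u hu => hAc u hu _).of_le (M := 1)
      (fun u hu => (contDiff_wgt_rpow hb hu.contDiff _).continuous)
      (fun u hu => (hHc u hu _).add (hAc u hu _)) zero_le_one fun u hu x _ => ?_⟩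
    rw [one_mul]
    exact rpow_half_le_add (hA1 _) (one_le_wgt b u x) hδ hδ1 hδκ hq hq'
  have main : ∀ j : ℕ,
      LocBdd (StructClass b U c₀) U (fun u x => decay δ (u x) *
        wgt b u x ^ ((min (1 + j * δ) (r + 1) + 1) / 2)) ∧
      LocBdd (StructClass b U c₀) U
        (fun u x => (1 + u x ^ 2) ^ ((min (1 + j * δ) (r + 1) - δ) / 2)) := by
    intro j
    induction j with
    | zero =>
      have e : min (1 + ((0 : ℕ) : ℝ) * δ) (r + 1) = 1 := by
        rw [Nat.cast_zero, zero_mul, add_zero]; exact min_eq_left (by linarith)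
      rw [e]
      refine ⟨?_, ?_⟩
      · have h := locBdd_decay_mul_wgt (c₀ := c₀) hb hU hdiv hδ
        simpa using h
      · refine (locBdd_abs.add (locBdd_const 1) (fun u hu => hu.contDiff.continuous.abs)
          fun _ _ => continuous_const).of_le (M := 1) (fun u hu => hAc u hu _)
          (fun u hu => hu.contDiff.continuous.abs.add continuous_const) zero_le_one
          fun u hu x _ => ?_
        refine (Real.rpow_le_rpow_of_exponent_le (hA1 _)
          (by linarith : (1 - δ) / 2 ≤ 1 / 2)).trans ?_
        rw [← Real.sqrt_eq_rpow, one_mul]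
        refine Real.sqrt_le_iff.2 ⟨by positivity, ?_⟩
        nlinarith [abs_nonneg (u x), sq_abs (u x)]
    | succ j ih =>
      set q := min (1 + j * δ) (r + 1)
      set q' := min (1 + (j + 1 : ℕ) * δ) (r + 1)
      have hq : 1 ≤ q := le_min (by simp; positivity) (by linarith)
      have hq1 : 1 ≤ q' := le_min (by simp; positivity) (by linarith)
      have hqr : q' ≤ r + 1 := min_le_right _ _
      have hqq : q' ≤ q + δ := by
        rw [← min_add_add_right]
        refine min_le_min ?_ (by linarith)
        push_cast; linarith
      obtain ⟨h1, h2⟩ := key q q' hq hqq ih.1 ih.2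
      refine ⟨?_, h1.of_le (M := 1) (fun u hu => hAc u hu _) (fun u hu => hAc u hu _)
        zero_le_one fun u hu x _ => ?_⟩
      · have h3 := locBdd_decay_mul_wgt_rpow (s := q' - 1) hb hU hdiv hδ hc₀ hr (by linarith)
          (by linarith) (by simpa using h2)
        have e : (q' - 1) / 2 + 1 = (q' + 1) / 2 := by ring
        rwa [e] at h3
      · rw [one_mul]
        refine Real.rpow_le_rpow_of_exponent_le (hA1 _) ?_
        have hκδ : 1 ≤ κ * (1 - δ) := by
          by_contra! h
          nlinarith [mul_lt_mul_of_pos_right h (by linarith : 0 < 1 - δ)]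
        have h4 : q * (1 - δ) * κ ≤ (q - δ) * κ := by gcongr; nlinarith
        nlinarith [mul_le_mul_of_nonneg_left hκδ (by linarith : 0 ≤ q)]
  obtain ⟨j, hj⟩ := exists_nat_gt (r / δ)
  have e : min (1 + (j : ℝ) * δ) (r + 1) = r + 1 :=
    min_eq_right (by rw [div_lt_iff₀ hδ] at hj; linarith)
  have h := main j
  rw [e] at h
  exact (key (r + 1) (r + 1) (by linarith) (by linarith) h.1 h.2).2

end IntegrabilityIteration

section Localization

open scoped ContDiff

variable {n m : ℕ} {b b' : Fin m → (Fin n → ℝ) → (Fin n → ℝ)}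

theorem Xop_congr {c c' : (Fin n → ℝ) → (Fin n → ℝ)} {f g : (Fin n → ℝ) → ℝ} {x : Fin n → ℝ}
    (hc : c =ᶠ[𝓝 x] c') (hf : f =ᶠ[𝓝 x] g) : Xop c f =ᶠ[𝓝 x] Xop c' g := by
  filter_upwards [hc, hf.fderiv (𝕜 := ℝ)] with y h1 h2
  rw [Xop, Xop, h1, h2]

theorem vfBracket_congr {c c' d d' : (Fin n → ℝ) → (Fin n → ℝ)} {x : Fin n → ℝ}
    (hc : c =ᶠ[𝓝 x] c') (hd : d =ᶠ[𝓝 x] d') : vfBracket c d =ᶠ[𝓝 x] vfBracket c' d' := by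
  filter_upwards [hc.eventuallyEq_nhds, hd.eventuallyEq_nhds] with y h1 h2
  funext l
  have h3 : (fun z => c z l) =ᶠ[𝓝 y] fun z => c' z l := h1.mono fun z hz => congrFun hz l
  have h4 : (fun z => d z l) =ᶠ[𝓝 y] fun z => d' z l := h2.mono fun z hz => congrFun hz l
  rw [vfBracket, vfBracket, h3.fderiv_eq, h4.fderiv_eq, h1.self_of_nhds, h2.self_of_nhds]

theorem vfDiv_congr {c c' : (Fin n → ℝ) → (Fin n → ℝ)} {x : Fin n → ℝ} (h : c =ᶠ[𝓝 x] c') :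
    vfDiv c x = vfDiv c' x := by
  refine Finset.sum_congr rfl fun j _ => ?_
  have h3 : (fun z => c z j) =ᶠ[𝓝 x] fun z => c' z j := h.mono fun z hz => congrFun hz j
  rw [h3.fderiv_eq]

theorem LieGen.exists_congr {W : Set (Fin n → ℝ)} (h : ∀ i, ∀ x ∈ W, b i =ᶠ[𝓝 x] b' i)
    {c : (Fin n → ℝ) → (Fin n → ℝ)} (hc : LieGen b c) :
    ∃ c', LieGen b' c' ∧ ∀ x ∈ W, c =ᶠ[𝓝 x] c' := by
  induction hc with
  | base i => exact ⟨b' i, .base i, h i⟩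
  | bracket _ _ ih1 ih2 =>
    obtain ⟨c1, h1, e1⟩ := ih1
    obtain ⟨c2, h2, e2⟩ := ih2
    exact ⟨_, .bracket h1 h2, fun x hx => vfBracket_congr (e1 x hx) (e2 x hx)⟩

theorem Hormander.congr {W : Set (Fin n → ℝ)} (hb : Hormander W b)
    (h : ∀ i, ∀ x ∈ W, b i =ᶠ[𝓝 x] b' i) : Hormander W b' := by
  intro x hx
  rw [eq_top_iff, ← hb x hx]
  refine Submodule.span_mono ?_
  rintro v ⟨c, hc, rfl⟩
  obtain ⟨c', hc', e⟩ := hc.exists_congr h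
  exact ⟨c', hc', (e x hx).self_of_nhds.symm⟩

theorem contDiff_cutoff_smul {E : Type*} [NormedAddCommGroup E] [NormedSpace ℝ E] {k : ℕ∞}
    {χ : (Fin n → ℝ) → ℝ} {f : (Fin n → ℝ) → E} {Ω : Set (Fin n → ℝ)} (hΩ : IsOpen Ω)
    (hχ : ContDiff ℝ ∞ χ) (hχΩ : tsupport χ ⊆ Ω) (hf : ContDiffOn ℝ k f Ω) :
    ContDiff ℝ k fun x => χ x • f x := by
  refine contDiff_iff_contDiffAt.2 fun x => ?_
  by_cases hx : x ∈ tsupport χ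
  swap
  · refine (contDiffAt_const (c := 0)).congr_of_eventuallyEq ?_
    filter_upwards [notMem_tsupport_iff_eventuallyEq.1 hx] with y hy
    simp [hy]
  have hx' : x ∈ Ω := hχΩ hx
  exact (hχ.contDiffAt.of_le (by exact_mod_cast le_top)).smul (hf.contDiffAt (hΩ.mem_nhds hx'))

theorem Xop_const_mul (c : (Fin n → ℝ) → (Fin n → ℝ)) (a : ℝ) (f : (Fin n → ℝ) → ℝ) :
    Xop c (fun y => a * f y) = fun y => a * Xop c f y := by
  funext x
  change fderiv ℝ (a • f) x (c x) = _
  rw [fderiv_const_smul_field]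
  rfl

/-- The scale-invariant form of the estimate on a compact subset. -/
theorem exists_estimate_of_subset {Ω K : Set (Fin n → ℝ)} (hΩ : IsOpen Ω)
    (hb : ∀ i, ContDiffOn ℝ (⊤ : ℕ∞) (b i) Ω) (hdiv : DivFree Ω b) (hspan : Hormander Ω b)
    {k : ℕ} (hk2 : 2 ≤ k) (hkm : k < m) {r : ℝ} (hr0 : 0 ≤ r)
    (hr : r * (((m : ℝ) - k) / (m * (k - 1))) < 1) (hK : IsCompact K) (hKΩ : K ⊆ Ω) :
    ∃ C, ∀ u : (Fin n → ℝ) → ℝ, ContDiffOn ℝ 2 u Ω → IntegrableOn u Ω → IsKConvex Ω b k u →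
      ∀ t > 0, ∫ x in Ω, |u x| ≤ t → ∀ V ⊆ K, MeasurableSet V →
        ∫ x in V, XgradNorm b u x ^ r * subLap b u x ≤ C * t ^ (1 + r) := by
  obtain ⟨K₀, hK₀, hKK₀, hK₀Ω⟩ := exists_compact_between hK hΩ hKΩ
  obtain ⟨K', hK', hK₀K', hK'Ω⟩ := exists_compact_between hK₀ hΩ hK₀Ω
  obtain ⟨χ, hχ, hχs, hχΩ, hχ1, -⟩ := exists_cutoff hK' hΩ hK'Ω
  set U := interior K₀
  have hUK' : U ⊆ K' := interior_subset.trans (hK₀K'.trans interior_subset)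
  have hUΩ : U ⊆ Ω := hUK'.trans hK'Ω
  have hχx : ∀ x ∈ K', ∀ᶠ y in 𝓝 x, χ y = 1 := fun x hx =>
    hχ1.filter_mono (nhds_le_nhdsSet hx)
  set b' : Fin m → (Fin n → ℝ) → (Fin n → ℝ) := fun i x => χ x • b i x
  have hb' : ∀ i, CVField (b' i) := fun i =>
    ⟨contDiff_cutoff_smul hΩ hχ hχΩ (hb i), hχs.smul_right⟩
  have hbb : ∀ i, ∀ x ∈ K', b i =ᶠ[𝓝 x] b' i := fun i x hx =>
    (hχx x hx).mono fun y hy => by simp [b', hy]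
  obtain ⟨κ, hκ, C₀, hC₀, hsob⟩ := exists_sobolev hb' hK₀ hK' hK₀K'
    (Hormander.congr (fun x hx => hspan x (hK'Ω hx)) hbb)
  have hdiv' : ∀ i, ∀ x ∈ U, vfDiv (b' i) x = 0 := fun i x hx => by
    rw [← vfDiv_congr (hbb i x (hUK' hx))]
    exact hdiv i x (hUΩ hx)
  set c₀ : ℝ := ((m : ℝ) - k) / (m * (k - 1))
  have hc₀ : 0 ≤ c₀ := by
    have h1 : (k : ℝ) < m := by exact_mod_cast hkm
    have h2 : (2 : ℝ) ≤ k := by exact_mod_cast hk2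
    exact div_nonneg (by linarith) (mul_nonneg (by linarith) (by linarith))
  have hmain := locBdd_wgt_rpow_mul_subLap (c₀ := c₀) hb' isOpen_interior hdiv' hc₀ hr hr0
    (locBdd_wgt_rpow hb' isOpen_interior hdiv' hκ hC₀
      (fun f hf hfU => hsob f hf (hfU.trans interior_subset)) hc₀ hr hr0)
  obtain ⟨C, hC⟩ := hmain K hK hKK₀
  refine ⟨C, fun u hu hui hconv t ht hut V hVK hV => ?_⟩
  set v : (Fin n → ℝ) → ℝ := fun x => t⁻¹ * (χ x • u x)
  have hv : ContDiff ℝ 2 v := contDiff_const.mul (contDiff_cutoff_smul (k := 2) hΩ hχ hχΩ hu)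
  have hvu : ∀ x ∈ K', v =ᶠ[𝓝 x] fun y => t⁻¹ * u y := fun x hx =>
    (hχx x hx).mono fun y hy => by simp [v, hy]
  have hX : ∀ i, ∀ x ∈ K', Xop (b' i) v =ᶠ[𝓝 x] fun y => t⁻¹ * Xop (b i) u y := by
    intro i x hx
    rw [← Xop_const_mul]
    exact Xop_congr (hbb i x hx).symm (hvu x hx)
  have hXX : ∀ i j, ∀ x ∈ K',
      Xop (b' i) (Xop (b' j) v) x = t⁻¹ * Xop (b i) (Xop (b j) u) x := by
    intro i j x hx
    have h := (Xop_congr (hbb i x hx).symm (hX j x hx)).self_of_nhds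
    rw [Xop_const_mul (b i)] at h
    exact h
  have hL : ∀ x ∈ K', subLap b' v x = t⁻¹ * subLap b u x := fun x hx => by
    simp only [subLap, hXX _ _ x hx, Finset.mul_sum]
  have hquad := fun x (hx : x ∈ Ω) => symmHess_quadForm_ge hk2 hkm b u x (hconv x hx)
  have ht' : 0 < t⁻¹ := inv_pos.2 ht
  have hS : StructClass b' U c₀ v := by
    refine ⟨hv, fun A hA hAU => ?_, fun x hx => ?_, fun x hx => ?_⟩
    · have hAΩ := hAU.trans hUΩ
      calc ∫ x in A, |v x| = ∫ x in A, t⁻¹ * |u x| :=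
            setIntegral_congr_fun hA.measurableSet fun x hx => by
              simp only [(hvu x (hUK' (hAU hx))).self_of_nhds, abs_mul, abs_of_pos ht']
        _ = t⁻¹ * ∫ x in A, |u x| := integral_const_mul _ _
        _ ≤ t⁻¹ * ∫ x in Ω, |u x| := mul_le_mul_of_nonneg_left
            (setIntegral_mono_set hui.abs (Eventually.of_forall fun _ => abs_nonneg _)
              hAΩ.eventuallyLE) ht'.le
        _ ≤ t⁻¹ * t := mul_le_mul_of_nonneg_left hut ht'.le
        _ = 1 := inv_mul_cancel₀ ht.ne'
    · rw [hL x (hUK' hx)]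
      exact mul_nonneg ht'.le (hquad x (hUΩ hx) 0).1
    · have h1 := (hquad x (hUΩ hx) fun i => Xop (b i) u x).2
      have h2 := mul_le_mul_of_nonneg_left h1 (by positivity : 0 ≤ t⁻¹ ^ 3)
      simp only [hL x (hUK' hx), hXX _ _ x (hUK' hx), (hX _ x (hUK' hx)).self_of_nhds]
      have e1 : -c₀ * (t⁻¹ * subLap b u x) * ∑ i, (t⁻¹ * Xop (b i) u x) ^ 2 =
          t⁻¹ ^ 3 * (-c₀ * subLap b u x * ∑ i, Xop (b i) u x ^ 2) := by
        simp only [mul_pow, ← Finset.mul_sum]; ring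
      have e2 : ∑ i, ∑ j, t⁻¹ * Xop (b i) u x * (t⁻¹ * Xop (b j) u x) *
          (t⁻¹ * Xop (b i) (Xop (b j) u) x) =
          t⁻¹ ^ 3 * ∑ i, ∑ j, Xop (b i) u x * Xop (b j) u x * Xop (b i) (Xop (b j) u) x := by
        simp only [Finset.mul_sum]
        exact Finset.sum_congr rfl fun i _ => Finset.sum_congr rfl fun j _ => by ring
      rw [e1, e2]
      exact h2
  have hHc : Continuous fun x => wgt b' v x ^ (r / 2) * subLap b' v x :=
    (contDiff_wgt_rpow hb' hv _).continuous.mul (continuous_subLap hb' hv)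
  have hKK' : K ⊆ K' := hKK₀.trans hUK'
  have hHi : IntegrableOn (fun x => wgt b' v x ^ (r / 2) * subLap b' v x) K :=
    hHc.continuousOn.integrableOn_compact hK
  have hH0 : ∀ x ∈ K, 0 ≤ wgt b' v x ^ (r / 2) * subLap b' v x := fun x hx =>
    mul_nonneg (Real.rpow_nonneg (wgt_pos _ _ _).le _) (hS.subLap_nonneg x (hKK₀ hx))
  have hpt : ∀ x ∈ V, XgradNorm b u x ^ r * subLap b u x ≤
      t ^ (1 + r) * (wgt b' v x ^ (r / 2) * subLap b' v x) := by
    intro x hx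
    have hxK := hKK' (hVK hx)
    have hL0 := hS.subLap_nonneg x (hKK₀ (hVK hx))
    have e1 : subLap b u x = t * subLap b' v x := by
      rw [hL x hxK, mul_inv_cancel_left₀ ht.ne']
    have e2 : ∑ i, Xop (b i) u x ^ 2 = t ^ 2 * ∑ i, Xop (b' i) v x ^ 2 := by
      simp only [(hX _ x hxK).self_of_nhds, mul_pow, ← Finset.mul_sum]
      rw [inv_pow, mul_inv_cancel_left₀ (by positivity)]
    have e3 : 0 ≤ ∑ i, Xop (b' i) v x ^ 2 := Finset.sum_nonneg fun _ _ => sq_nonneg _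
    have e4 : XgradNorm b u x ^ r = t ^ r * (∑ i, Xop (b' i) v x ^ 2) ^ (r / 2) := by
      rw [XgradNorm, e2, Real.sqrt_mul (sq_nonneg t), Real.sqrt_sq ht.le,
        Real.mul_rpow ht.le (Real.sqrt_nonneg _), Real.sqrt_eq_rpow, ← Real.rpow_mul e3]
      congr 2; ring
    rw [e1, e4, Real.rpow_add ht, Real.rpow_one]
    have e5 : (∑ i, Xop (b' i) v x ^ 2) ^ (r / 2) ≤ wgt b' v x ^ (r / 2) :=
      Real.rpow_le_rpow e3 (sum_sq_Xop_le_wgt _ _ _) (by positivity)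
    calc t ^ r * (∑ i, Xop (b' i) v x ^ 2) ^ (r / 2) * (t * subLap b' v x)
        ≤ t ^ r * wgt b' v x ^ (r / 2) * (t * subLap b' v x) := by gcongr
      _ = _ := by ring
  have hpt0 : ∀ x ∈ V, 0 ≤ XgradNorm b u x ^ r * subLap b u x := fun x hx =>
    mul_nonneg (Real.rpow_nonneg (Real.sqrt_nonneg _) _) (hquad x (hKΩ (hVK hx)) 0).1
  calc ∫ x in V, XgradNorm b u x ^ r * subLap b u x
      ≤ ∫ x in V, t ^ (1 + r) * (wgt b' v x ^ (r / 2) * subLap b' v x) :=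
        integral_mono_of_nonneg (ae_restrict_of_forall_mem hV hpt0)
          ((hHi.mono_set hVK).const_mul _) (ae_restrict_of_forall_mem hV hpt)
    _ = t ^ (1 + r) * ∫ x in V, wgt b' v x ^ (r / 2) * subLap b' v x := integral_const_mul _ _
    _ ≤ t ^ (1 + r) * C := by
        gcongr
        exact (setIntegral_mono_set hHi (ae_restrict_of_forall_mem hK.measurableSet hH0)
          hVK.eventuallyLE).trans (hC v hS)
    _ = C * t ^ (1 + r) := mul_comm _ _

end Localization

/-- Theorem 3.1, estimate (3.14). For `k`-convex functions,
`∫_{Ω'} |Xu|^r Δ_X u ≤ C (∫_Ω |u|)^{1+r}` for `0 ≤ r < m(k-1)/(m-k)`. -/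
theorem grad_subLap_integral_estimate (n m k : ℕ) (Ω : Set (Fin n → ℝ))
    (hΩo : IsOpen Ω) (hΩb : Bornology.IsBounded Ω)
    (b : Fin m → (Fin n → ℝ) → (Fin n → ℝ))
    (hb : ∀ i, ContDiffOn ℝ (⊤ : ℕ∞) (b i) (closure Ω))
    (hcond1 : DivFree Ω b) (hcond2 : Hormander Ω b)
    (hk2 : 2 ≤ k) (hkm : k ≤ m)
    (r : ℝ) (hr0 : 0 ≤ r)
    (hr : r < ((m : ℝ) * ((k : ℝ) - 1)) / ((m : ℝ) - (k : ℝ))) :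
    ∀ Ω' : Set (Fin n → ℝ), CptIn Ω' Ω →
      ∃ C > (0 : ℝ), ∀ u : (Fin n → ℝ) → ℝ,
        ContDiffOn ℝ 2 u Ω → MeasureTheory.IntegrableOn u Ω → IsKConvex Ω b k u →
        (∫ x in Ω', XgradNorm b u x ^ r * subLap b u x) ≤
          C * (∫ x in Ω, |u x|) ^ (1 + r) := by
  rintro Ω' ⟨hΩ'o, hΩ'c, hΩ'Ω⟩
  rcases hkm.eq_or_lt with rfl | hkm
  · rw [sub_self, div_zero] at hr
    exact absurd hr0 hr.not_ge
  have hk2' : (2 : ℝ) ≤ k := by exact_mod_cast hk2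
  have hkm' : (k : ℝ) < m := by exact_mod_cast hkm
  have hrc : r * (((m : ℝ) - k) / (m * (k - 1))) < 1 := by
    rw [lt_div_iff₀ (by linarith)] at hr
    rw [← mul_div_assoc, div_lt_one (mul_pos (by linarith) (by linarith))]
    exact hr
  obtain ⟨C, hC⟩ := exists_estimate_of_subset hΩo (fun i => (hb i).mono subset_closure) hcond1
    hcond2 hk2 hkm hr0 hrc hΩ'c hΩ'Ω
  refine ⟨|C| + 1, by positivity, fun u hu hui hconv => ?_⟩
  have hI : 0 ≤ ∫ x in Ω, |u x| := integral_nonneg fun _ => abs_nonneg _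
  have hlim : Tendsto (fun t : ℝ => C * t ^ (1 + r)) (𝓝[>] ∫ x in Ω, |u x|)
      (𝓝 (C * (∫ x in Ω, |u x|) ^ (1 + r))) :=
    (((Real.continuous_rpow_const (by linarith)).const_mul C).tendsto _).mono_left
      nhdsWithin_le_nhds
  refine (ge_of_tendsto hlim (eventually_mem_nhdsWithin.mono fun t ht => ?_)).trans ?_
  · exact hC u hu hui hconv t (hI.trans_lt ht) (le_of_lt ht) Ω' subset_closure
      hΩ'o.measurableSet
  · gcongr
    linarith [le_abs_self C]
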